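/- Let G be a minimal counterexample as in the context and let S be a Sylow 2-subgroup of G. Then O_2(G) ≤ Z(S): every normal subgroup of G that is a 2-group is contained in the center of S (in particular it is contained in S and its elements commute with every element of S). -/

import Mathlib

namespace Wreathed

/-- The cyclic group of order `2^n`. -/
abbrev C (n : ℕ) : Type := Multiplicative (ZMod (2^n))

/-- The coordinate-swapping automorphism of `C n × C n`. -/
def swapAut (n : ℕ) : MulAut (C n × C n) := MulEquiv.prodComm

lemma swapAut_mul_self (n : ℕ) : swapAut n * swapAut n = 1 := by
  ext x <;> rfl

lemma two_cases (x : Multiplicative (ZMod 2)) :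
    x = 1 ∨ x = Multiplicative.ofAdd 1 := by
  revert x; decide

/-- The action of `C_2` on `C n × C n` by swapping the two coordinates. -/
def act (n : ℕ) : Multiplicative (ZMod 2) →* MulAut (C n × C n) where
  toFun x := if x = 1 then 1 else swapAut n
  map_one' := if_pos rfl
  map_mul' := by
    have h11 : (Multiplicative.ofAdd 1 : Multiplicative (ZMod 2)) *
        Multiplicative.ofAdd 1 = 1 := by decide
    have h1ne : (Multiplicative.ofAdd 1 : Multiplicative (ZMod 2)) ≠ 1 := by decide
    intro x y
    rcases two_cases x with hx | hx <;> rcases two_cases y with hy | hy <;>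
      subst hx <;> subst hy <;>
      simp [h11, h1ne, swapAut_mul_self]

/-- The wreathed 2-group `W = (C_{2^n} × C_{2^n}) ⋊ C_2`,
i.e. the wreath product `Z_{2^n} ≀ Z_2`. -/
abbrev W (n : ℕ) : Type := (C n × C n) ⋊[act n] (Multiplicative (ZMod 2))

/-- The element `a = ((g,1); 0)`. -/
def a (n : ℕ) : W n := SemidirectProduct.inl (Multiplicative.ofAdd 1, 1)

/-- The element `b = ((1,g); 0)`. -/
def b (n : ℕ) : W n := SemidirectProduct.inl (1, Multiplicative.ofAdd 1)

/-- The element `t = ((1,1); 1)`. -/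
def t (n : ℕ) : W n := SemidirectProduct.inr (Multiplicative.ofAdd 1)

/-- The base subgroup `A = ⟨a, b⟩`. -/
def A (n : ℕ) : Subgroup (W n) := Subgroup.closure {a n, b n}

/-- The diagonal `Δ = ⟨ab⟩`. -/
def diag (n : ℕ) : Subgroup (W n) := Subgroup.zpowers (a n * b n)

/-- The anti-diagonal `Δ⁻ = ⟨ab⁻¹⟩`. -/
def antidiag (n : ℕ) : Subgroup (W n) := Subgroup.zpowers (a n * (b n)⁻¹)

end Wreathed

/-- The subgroup of inner automorphisms of `G`, i.e. `Inn(G)` inside `Aut(G)`. -/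
def innAut (G : Type*) [Group G] : Subgroup (MulAut G) :=
  (MulAut.conj : G →* MulAut G).range

instance innAut_normal (G : Type*) [Group G] : (innAut G).Normal := by
  constructor
  intro x hx f
  obtain ⟨g, rfl⟩ := hx
  refine ⟨f g, ?_⟩
  ext y
  simp only [MulAut.conj_apply, MulAut.mul_apply, map_mul, map_inv,
    MulEquiv.apply_symm_apply, MulAut.inv_def]

/-- An automorphism is class-preserving if it maps every element to a conjugate. -/
def IsClassPreserving {G : Type*} [Group G] (φ : MulAut G) : Prop :=
  ∀ x : G, IsConj x (φ x)

/-- An automorphism is a Coleman automorphism if its restriction to every Sylow subgroup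
is induced by conjugation by a group element. -/
def IsColeman {G : Type*} [Group G] (φ : MulAut G) : Prop :=
  ∀ (p : ℕ), p.Prime → ∀ P : Sylow p G, ∃ y : G,
    ∀ u ∈ (P : Subgroup G), φ u = y⁻¹ * u * y

/-- The subgroup `Aut_c(G)` of class-preserving automorphisms. -/
def autC (G : Type*) [Group G] : Subgroup (MulAut G) where
  carrier := {φ | IsClassPreserving φ}
  one_mem' := fun x => by simpa using IsConj.refl x
  mul_mem' := by
    intro φ ψ hφ hψ x
    exact (hψ x).trans (hφ (ψ x))
  inv_mem' := by
    intro φ hφ x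
    have := (hφ (φ⁻¹ x)).symm
    simpa using this

/-- The subgroup `Aut_Col(G)` of Coleman automorphisms. -/
def autCol (G : Type*) [Group G] : Subgroup (MulAut G) where
  carrier := {φ | IsColeman φ}
  one_mem' := fun p hp P => ⟨1, fun u _ => by simp⟩
  mul_mem' := by
    intro φ ψ hφ hψ p hp P
    obtain ⟨y, hy⟩ := hψ p hp P
    obtain ⟨z, hz⟩ := hφ p hp (y⁻¹ • P)
    refine ⟨y * z, fun u hu => ?_⟩
    have hmem : ψ u ∈ ((y⁻¹ • P : Sylow p G) : Subgroup G) := by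
      rw [Sylow.coe_subgroup_smul, Subgroup.mem_pointwise_smul_iff_inv_smul_mem]
      have : (MulAut.conj y⁻¹)⁻¹ • (ψ u) = u := by
        rw [hy u hu]
        simp [MulAut.smul_def, mul_assoc]
      rw [this]; exact hu
    have h2 := hz _ hmem
    calc (φ * ψ) u = φ (ψ u) := rfl
      _ = z⁻¹ * (ψ u) * z := h2
      _ = (y * z)⁻¹ * u * (y * z) := by rw [hy u hu]; group
  inv_mem' := by
    intro φ hφ p hp P
    obtain ⟨z, hz⟩ := hφ p hp (φ⁻¹ • P)
    refine ⟨z⁻¹, fun u hu => ?_⟩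
    have hmem : φ⁻¹ u ∈ ((φ⁻¹ • P : Sylow p G) : Subgroup G) := by
      rw [Sylow.pointwise_smul_def, Subgroup.mem_pointwise_smul_iff_inv_smul_mem]
      have : (φ⁻¹)⁻¹ • (φ⁻¹ u) = u := by
        simp [MulAut.smul_def]
      rw [this]; exact hu
    have h2 := hz _ hmem
    have : u = z⁻¹ * (φ⁻¹ u) * z := by
      conv_lhs => rw [show u = φ (φ⁻¹ u) by simp]
      exact h2
    rw [show (φ⁻¹ : MulAut G) u = (z⁻¹)⁻¹ * ((z⁻¹ * (φ⁻¹ u) * z) * z⁻¹) from by group]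
    rw [← this]; group

/-- The image `Out_c(G)` of `Aut_c(G)` in `Out(G) = Aut(G)/Inn(G)`. -/
def outC (G : Type*) [Group G] : Subgroup (MulAut G ⧸ innAut G) :=
  (autC G).map (QuotientGroup.mk' (innAut G))

/-- The image `Out_Col(G)` of `Aut_Col(G)` in `Out(G) = Aut(G)/Inn(G)`. -/
def outCol (G : Type*) [Group G] : Subgroup (MulAut G ⧸ innAut G) :=
  (autCol G).map (QuotientGroup.mk' (innAut G))

/-- A group has wreathed Sylow 2-subgroups if its Sylow 2-subgroups are isomorphic to
the wreathed 2-group `(C_{2^n} × C_{2^n}) ⋊ C_2` for some `n ≥ 2`. -/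
def HasWreathedSylow2 (G : Type*) [Group G] : Prop :=
  ∃ n : ℕ, 2 ≤ n ∧ ∀ P : Sylow 2 G, Nonempty ((P : Subgroup G) ≃* Wreathed.W n)

set_option linter.unusedSectionVars false

namespace OddG

variable {K : Type*} [Group K]

lemma conj_inv_elt {κ k : K} (hκ : Odd (orderOf κ)) (hk : Odd (orderOf k))
    (h : κ * k * κ⁻¹ = k⁻¹) : k = 1 := by
  have h2 : Commute (κ ^ 2) k := by
    have h3 : κ * k = k⁻¹ * κ := by rw [← h]; group
    have h4 : κ * k⁻¹ = k * κ := by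
      have := congrArg (fun x => x⁻¹) h
      simp only [inv_inv, mul_inv_rev] at this
      conv_rhs => rw [← this]
      group
    show κ ^ 2 * k = k * κ ^ 2
    rw [pow_two, mul_assoc, h3, ← mul_assoc, h4, mul_assoc]
  obtain ⟨n, hn⟩ := hκ
  have h5 : (κ ^ 2) ^ (n + 1) = κ := by
    rw [← pow_mul, show 2 * (n + 1) = orderOf κ + 1 by omega, pow_succ, pow_orderOf_eq_one, one_mul]
  have h6 : Commute κ k := by
    rw [← h5]; exact h2.pow_left _
  have h7 : k = k⁻¹ := by
    rw [← h, h6.eq, mul_assoc, mul_inv_cancel, mul_one]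
  have h8 : k ^ 2 = 1 := by
    rw [pow_two]; nth_rewrite 2 [h7]; simp
  have h9 : orderOf k ∣ 2 := orderOf_dvd_of_pow_eq_one h8
  rcases (Nat.dvd_prime Nat.prime_two).1 h9 with h | h
  · exact orderOf_eq_one_iff.1 h
  · rw [h] at hk; exact absurd hk (by decide)

variable [Finite K]

lemma odd_orderOf (hodd : Odd (Nat.card K)) (x : K) : Odd (orderOf x) :=
  hodd.of_dvd_nat (orderOf_dvd_natCard x)

lemma conj_inv (hodd : Odd (Nat.card K)) {κ k : K} (h : k⁻¹ = κ * k * κ⁻¹) : k = 1 :=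
  conj_inv_elt (odd_orderOf hodd κ) (odd_orderOf hodd k) h.symm

lemma sq_eq_one (hodd : Odd (Nat.card K)) {k : K} (h : k⁻¹ = k) : k = 1 :=
  conj_inv hodd (κ := 1) (by simpa using h)

/-- square root in an odd order group -/
noncomputable def rt (x : K) : K := x ^ ((Nat.card K + 1) / 2)

lemma rt_sq (hodd : Odd (Nat.card K)) (x : K) : rt x * rt x = x := by
  obtain ⟨n, hn⟩ := hodd
  rw [rt, ← pow_add, show (Nat.card K + 1) / 2 + (Nat.card K + 1) / 2 = Nat.card K + 1 by omega,
    pow_succ, pow_card_eq_one', one_mul]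

lemma sq_rt (hodd : Odd (Nat.card K)) (x : K) : rt (x * x) = x := by
  obtain ⟨n, hn⟩ := hodd
  rw [rt, ← pow_two, ← pow_mul, show 2 * ((Nat.card K + 1) / 2) = Nat.card K + 1 by omega,
    pow_succ, pow_card_eq_one', one_mul]

lemma rt_map (f : MulAut K) (x : K) : f (rt x) = rt (f x) := by simp [rt]

lemma rt_inv (x : K) : rt x⁻¹ = (rt x)⁻¹ := by simp [rt]

lemma rt_conj (x y : K) : rt (y * x * y⁻¹) = y * rt x * y⁻¹ := by simp [rt, conj_pow]

lemma commute_of_sq (hodd : Odd (Nat.card K)) {x y : K} (h : Commute (x * x) y) :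
    Commute x y := by
  rw [← sq_rt hodd x]; exact h.pow_left _

/-- Lemma I -/
lemma lemI (hodd : Odd (Nat.card K)) (J : Subgroup K) (b ρ : MulAut K)
    (hbJ : ∀ x ∈ J, b x ∈ J) (hb : ∀ x ∈ J, b (b x) = x) (hc : Commute b ρ)
    (hf : ∀ x ∈ J, b x = x → ρ x = x) (r : K) (hr : r ∈ J) (hρ : ρ r = r⁻¹) : b r = r⁻¹ := by
  have hy : b (b r * r⁻¹) = (b r * r⁻¹)⁻¹ := by simp [hb r hr]
  have hbρ : ρ (b r) = b (ρ r) := (DFunLike.congr_fun hc.eq r).symm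
  have hy2 : ρ (b r * r⁻¹) = r⁻¹ * (b r * r⁻¹)⁻¹ * (r⁻¹)⁻¹ := by
    rw [map_mul, map_inv, hbρ, hρ]; simp
  have hs := rt_sq hodd (b r * r⁻¹)
  have hsJ : rt (b r * r⁻¹) ∈ J := J.pow_mem (J.mul_mem (hbJ r hr) (J.inv_mem hr)) _
  have hs1 : b (rt (b r * r⁻¹)) = (rt (b r * r⁻¹))⁻¹ := by rw [rt_map, hy, rt_inv]
  have hs2 : ρ (rt (b r * r⁻¹)) = r⁻¹ * (rt (b r * r⁻¹))⁻¹ * r := by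
    rw [rt_map, hy2, rt_conj, rt_inv, inv_inv]
  generalize rt (b r * r⁻¹) = s at *
  have hbr : b r = s * s * r := by rw [hs]; simp
  have hm1 : b (s * r) = s * r := by rw [map_mul, hs1, hbr]; group
  have hm2 : ρ (s * r) = (s * r)⁻¹ := by rw [map_mul, hs2, hρ]; group
  have hm3 := hf (s * r) (J.mul_mem hsJ hr) hm1
  have hm : s * r = 1 := sq_eq_one hodd (hm2.symm.trans hm3)
  have : s = r⁻¹ := eq_inv_of_mul_eq_one_left hm
  rw [hbr, this]; simp

lemma inv_of (ρ : MulAut K) (x : K) (hρ : ρ (ρ x) = x) : ρ (x⁻¹ * ρ x) = (x⁻¹ * ρ x)⁻¹ := by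
  simp [hρ]

/-- V4 corollary -/
lemma V4 (hodd : Odd (Nat.card K)) (J : Subgroup K) (a b ρ : MulAut K)
    (haJ : ∀ x ∈ J, a x ∈ J) (hbJ : ∀ x ∈ J, b x ∈ J) (hρJ : ∀ x ∈ J, ρ x ∈ J)
    (ha : ∀ x ∈ J, a (a x) = x) (hb : ∀ x ∈ J, b (b x) = x) (hρ : ∀ x ∈ J, ρ (ρ x) = x)
    (hab : ∀ x ∈ J, a (b x) = b (a x))
    (hca : Commute a ρ) (hcb : Commute b ρ)
    (hfa : ∀ x ∈ J, a x = x → ρ x = x) (hfb : ∀ x ∈ J, b x = x → ρ x = x)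
    (hfab : ∀ x ∈ J, a (b x) = x → ρ x = x) : ∀ x ∈ J, ρ x = x := by
  intro x hx
  have h0 := inv_of ρ x (hρ x hx)
  have hr : x⁻¹ * ρ x ∈ J := J.mul_mem (J.inv_mem hx) (hρJ x hx)
  have h1 := lemI hodd J a ρ haJ ha hca hfa _ hr h0
  have h2 := lemI hodd J b ρ hbJ hb hcb hfb _ hr h0
  have h3 := lemI hodd J (a * b) ρ (fun x hx => haJ _ (hbJ _ hx))
    (fun y hy => by
      simp only [MulAut.mul_apply]
      rw [← hab _ (hbJ _ hy), hb _ hy, ha _ hy]) (hca.mul_left hcb) hfab _ hr h0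
  rw [MulAut.mul_apply, h2, map_inv, h1, inv_inv] at h3
  have := sq_eq_one hodd h3.symm
  exact (inv_mul_eq_one.1 this).symm

lemma conj_pow_aut (τ : MulAut K) (J : Subgroup K) (hJ : ∀ x ∈ J, τ x ∈ J) {k κ : K} (hκ : κ ∈ J)
    (h : τ k = κ * k * κ⁻¹) (N : ℕ) : ∃ κ' ∈ J, (τ ^ N) k = κ' * k * κ'⁻¹ := by
  induction N with
  | zero => exact ⟨1, J.one_mem, by simp⟩
  | succ N ih =>
    obtain ⟨κ', h1, h2⟩ := ih
    refine ⟨τ κ' * κ, J.mul_mem (hJ _ h1) hκ, ?_⟩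
    rw [pow_succ', MulAut.mul_apply, h2]
    simp [h, mul_assoc]

/-- triviality of an automorphism from its inverted elements -/
lemma triv_of_inv (ρ : MulAut K) (J : Subgroup K) (hρJ : ∀ x ∈ J, ρ x ∈ J)
    (hρ : ∀ x ∈ J, ρ (ρ x) = x)
    (h : ∀ r ∈ J, ρ r = r⁻¹ → r = 1) : ∀ x ∈ J, ρ x = x := by
  intro x hx
  have := h _ (J.mul_mem (J.inv_mem hx) (hρJ x hx)) (inv_of ρ x (hρ x hx))
  exact (inv_mul_eq_one.1 this).symm

lemma mix_core (hodd : Odd (Nat.card K)) (ρ ι : MulAut K) (hι : ∀ x, ι (ι x) = x)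
    (hfix : ∀ s, ι s = s⁻¹ → ρ s = s) {k e f κ : K} (hk : ρ k = k⁻¹) (he : ι e = e⁻¹)
    (hf : ι f = f⁻¹) (h : k⁻¹ * e = κ * (k * f) * κ⁻¹) : k = 1 := by
  let X := Subgroup.normalClosure {s : K | ι s = s⁻¹}
  have hX : ∀ x ∈ X, ρ x = x := by
    intro x hx
    have : X ≤ (ρ.toMonoidHom).eqLocus (MonoidHom.id K) := by
      refine (Subgroup.closure_le _).2 ?_
      intro y hy
      obtain ⟨s, hs, hsy⟩ := Group.mem_conjugatesOfSet_iff.1 hy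
      obtain ⟨g, rfl⟩ := isConj_iff.1 hsy
      have hs : ι s = s⁻¹ := hs
      have e1 : g * s * g⁻¹ =
          ((rt s⁻¹ * g⁻¹)⁻¹ * ι (rt s⁻¹ * g⁻¹)) * (g⁻¹⁻¹ * ι g⁻¹)⁻¹ := by
        have : ι (rt s⁻¹) = rt s := by rw [rt_map, map_inv, hs, inv_inv]
        rw [map_mul, this, rt_inv]
        simp only [mul_inv_rev, inv_inv, mul_assoc]
        rw [← mul_assoc (rt s) (rt s), rt_sq hodd s]
        simp
      show ρ _ = _
      rw [e1, map_mul, map_inv, hfix _ (inv_of ι _ (hι _)), hfix _ (inv_of ι _ (hι _))]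
      rfl
    exact this hx
  have hsub : {s : K | ι s = s⁻¹} ⊆ X := Subgroup.subset_normalClosure
  have hq : Odd (Nat.card (K ⧸ X)) := hodd.of_dvd_nat (Subgroup.card_quotient_dvd_card X)
  have h2 := congrArg (QuotientGroup.mk' X) h
  have he' : QuotientGroup.mk' X e = 1 := (QuotientGroup.eq_one_iff _).2 (hsub he)
  have hf' : QuotientGroup.mk' X f = 1 := (QuotientGroup.eq_one_iff _).2 (hsub hf)
  simp only [map_mul, map_inv, he', hf', mul_one] at h2
  have h3 := conj_inv hq h2
  have h4 : k ∈ X := (QuotientGroup.eq_one_iff _).1 h3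
  exact sq_eq_one hodd (hk.symm.trans (hX k h4))

/-- the mixing lemma -/
lemma mix (hodd : Odd (Nat.card K)) (i ρ : MulAut K) (hi : i * i = 1) (hρ : ρ * ρ = 1)
    (hc : Commute i ρ) (hf : ∀ x, i x = x → ρ x = x) (k1 k2 : K)
    (h1 : ρ k1 = k1⁻¹) (h2 : (i * ρ) k2 = k2⁻¹) (σ : MulAut K)
    (hσ : σ = i ∨ σ = ρ ∨ σ = i * ρ) (κ : K) (h : σ (k1 * k2) = κ * (k1 * k2) * κ⁻¹) :
    k1 = 1 ∨ k2 = 1 := by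
  have hi' : ∀ x, i (i x) = x := fun x => by rw [← MulAut.mul_apply, hi]; rfl
  have hρ' : ∀ x, ρ (ρ x) = x := fun x => by rw [← MulAut.mul_apply, hρ]; rfl
  have hιc : Commute i (i * ρ) := (Commute.refl i).mul_right hc
  have hι : ∀ x, (i * ρ) ((i * ρ) x) = x := fun x => by
    rw [← MulAut.mul_apply, hc.symm.mul_mul_mul_comm, hi, hρ]; rfl
  have a1 : ∀ r, ρ r = r⁻¹ → i r = r⁻¹ := fun r hr =>
    lemI hodd ⊤ i ρ (by simp) (fun x _ => hi' x) hc (fun x _ => hf x) r trivial hr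
  have a2 : ∀ r, (i * ρ) r = r⁻¹ → i r = r⁻¹ := fun r hr =>
    lemI hodd ⊤ i (i * ρ) (by simp) (fun x _ => hi' x) hιc
      (fun x _ hx => by rw [MulAut.mul_apply, hf x hx, hx]) r trivial hr
  have b1 : ∀ r, ρ r = r⁻¹ → (i * ρ) r = r := fun r hr => by
    rw [MulAut.mul_apply, hr, map_inv, a1 r hr, inv_inv]
  have b2 : ∀ r, (i * ρ) r = r⁻¹ → ρ r = r := fun r hr => by
    have := a2 r hr
    have h5 : i (ρ r) = i r := by rw [this, ← hr]; rfl
    exact i.injective h5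
  have hcomm : Commute k2 k1 := by
    apply commute_of_sq hodd
    have c1 : ρ (k2 * k1 * k2⁻¹) = (k2 * k1 * k2⁻¹)⁻¹ := by
      simp [h1, b2 k2 h2, mul_assoc]
    have c2 := b1 _ c1
    rw [map_mul, map_mul, map_inv, h2, b1 k1 h1, inv_inv] at c2
    show k2 * k2 * k1 = k1 * (k2 * k2)
    have : k2 * (k2⁻¹ * k1 * k2) * k2 = k2 * (k2 * k1 * k2⁻¹) * k2 := by rw [c2]
    simpa [mul_assoc] using this.symm
  have core1 : ∀ e, (i * ρ) e = e⁻¹ → k1⁻¹ * e = κ * (k1 * k2) * κ⁻¹ → k1 = 1 := fun e he hh =>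
    mix_core hodd ρ (i * ρ) hι b2 h1 he h2 hh
  rcases hσ with rfl | rfl | rfl
  · left
    refine core1 k2⁻¹ (by rw [map_inv, h2]) ?_
    rw [← h, map_mul, a1 _ h1, a2 _ h2]
  · left
    refine core1 k2 h2 ?_
    rw [← h, map_mul, h1, b2 _ h2]
  · right
    refine mix_core hodd (i * ρ) ρ hρ' b1 h2 (e := k1) (f := k1) h1 h1 (κ := κ) ?_
    rw [hcomm.eq, ← h, map_mul, b1 _ h1, h2, (hcomm.inv_left).eq]

lemma exists_inverted (ρ : MulAut K) (hρ : ρ * ρ = 1) (hne : ρ ≠ 1) :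
    ∃ k, ρ k = k⁻¹ ∧ k ≠ 1 := by
  by_contra hcon
  push Not at hcon
  apply hne
  ext x
  exact triv_of_inv ρ ⊤ (by simp) (fun x _ => by rw [← MulAut.mul_apply, hρ]; rfl)
    (fun r _ hr => hcon r hr) x trivial

end OddG

set_option linter.unusedSectionVars false

namespace OddG

section num
variable {A : Type*} [Group A]

lemma pow2_order {g : A} {k : ℕ} (h : g ^ 2 ^ k = 1) (hne : g ≠ 1) :
    ∃ j, orderOf g = 2 ^ (j + 1) := by
  obtain ⟨j, _, hj⟩ := (Nat.dvd_prime_pow Nat.prime_two).1 (orderOf_dvd_of_pow_eq_one h)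
  cases j with
  | zero => exact absurd (orderOf_eq_one_iff.1 (by simpa using hj)) hne
  | succ j => exact ⟨j, hj⟩

lemma half_sq {g : A} {j : ℕ} (h : orderOf g = 2 ^ (j + 1)) : g ^ 2 ^ j * g ^ 2 ^ j = 1 := by
  rw [← pow_add, ← two_mul, ← pow_succ', ← h, pow_orderOf_eq_one]

lemma half_ne {g : A} {j : ℕ} (h : orderOf g = 2 ^ (j + 1)) : g ^ 2 ^ j ≠ 1 := by
  intro hh
  have := orderOf_dvd_of_pow_eq_one hh
  rw [h] at this
  have := Nat.le_of_dvd (by positivity) this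
  rw [pow_succ] at this
  have : 0 < 2 ^ j := by positivity
  omega

lemma cyc_invol {z : A} {l : ℕ} (h : orderOf z = 2 ^ (l + 1)) (a : ℤ)
    (hg : z ^ a * z ^ a = 1) : z ^ a = 1 ∨ z ^ a = z ^ 2 ^ l := by
  rw [← zpow_add, ← orderOf_dvd_iff_zpow_eq_one, h, pow_succ] at hg
  push_cast at hg
  obtain ⟨c, hc⟩ := hg
  have ha : a = 2 ^ l * c := by
    have : 2 * a = 2 * (2 ^ l * c) := by linarith
    linarith
  have hz := half_sq h
  rw [ha, zpow_mul]
  have e : z ^ (2 ^ l : ℤ) = z ^ 2 ^ l := by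
    rw [← zpow_natCast]; push_cast; rfl
  rw [e]
  obtain ⟨q, hq⟩ := Int.even_or_odd' c
  rcases hq with rfl | rfl
  · left; rw [zpow_mul, zpow_ofNat, pow_two, hz, one_zpow]
  · right; rw [zpow_add, zpow_mul, zpow_ofNat, pow_two, hz, one_zpow]; simp

lemma pow_ge {g : A} {j k : ℕ} (h : orderOf g = 2 ^ (j + 1)) (hk : j + 1 ≤ k) : g ^ 2 ^ k = 1 := by
  apply orderOf_dvd_iff_pow_eq_one.1; rw [h]; exact pow_dvd_pow 2 hk

lemma zpow_half {z : A} {l : ℕ} (hz : orderOf z = 2 ^ (l + 1)) (n : ℤ) (hn : z ^ n ≠ 1) :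
    ∃ l', orderOf (z ^ n) = 2 ^ (l' + 1) ∧ (z ^ n) ^ 2 ^ l' = z ^ 2 ^ l := by
  have : (z ^ n) ^ 2 ^ (l + 1) = 1 := by
    rw [← zpow_natCast, ← zpow_mul, mul_comm, zpow_mul, zpow_natCast, ← hz, pow_orderOf_eq_one,
      one_zpow]
  obtain ⟨l', hl'⟩ := pow2_order this hn
  refine ⟨l', hl', ?_⟩
  have h1 := half_sq hl'
  have h2 := half_ne hl'
  have e : (z ^ n) ^ 2 ^ l' = z ^ (n * (2 ^ l' : ℕ)) := by
    rw [zpow_mul, zpow_natCast]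
  rw [e] at h1 h2 ⊢
  exact (cyc_invol hz _ h1).resolve_left h2

lemma numeric {z φ : A} (hc : Commute z φ) {l j : ℕ} (hz : orderOf z = 2 ^ (l + 1))
    (hφ : orderOf φ = 2 ^ (j + 1)) (n : ℤ) :
    ∃ N : ℕ, (z ^ n * φ) ^ N = z ^ 2 ^ l ∨ (z ^ n * φ) ^ N = φ ^ 2 ^ j ∨
      (z ^ n * φ) ^ N = z ^ 2 ^ l * φ ^ 2 ^ j := by
  by_cases h1 : z ^ n = 1
  · exact ⟨2 ^ j, by simp [h1]⟩
  obtain ⟨l', hl', hh⟩ := zpow_half hz n h1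
  rcases lt_trichotomy l' j with h | h | h
  · refine ⟨2 ^ j, Or.inr (Or.inl ?_)⟩
    rw [(hc.zpow_left n).mul_pow, pow_ge hl' h, one_mul]
  · refine ⟨2 ^ j, Or.inr (Or.inr ?_)⟩
    rw [(hc.zpow_left n).mul_pow, ← h, hh]
  · refine ⟨2 ^ l', Or.inl ?_⟩
    rw [(hc.zpow_left n).mul_pow, pow_ge hφ h, hh, mul_one]

end num

variable {K : Type*} [Group K] [Finite K]

/-- fixed points -/
def fx (u : MulAut K) : Subgroup K := (u.toMonoidHom).eqLocus (MonoidHom.id K)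

lemma mem_fx {u : MulAut K} {x : K} : x ∈ fx u ↔ u x = x := Iff.rfl

lemma fx_inv {u τ : MulAut K} (h : Commute u τ) {x : K} (hx : x ∈ fx u) : τ x ∈ fx u := by
  rw [mem_fx] at *
  rw [← MulAut.mul_apply, h.eq, MulAut.mul_apply, hx]

lemma fx_pow {u : MulAut K} {x : K} (hx : u x = x) (n : ℤ) : (u ^ n) x = x := by
  have : u ∈ MulAction.stabilizer (MulAut K) x := hx
  exact Subgroup.zpow_mem _ this n

lemma sq_apply {i : MulAut K} (hi : i * i = 1) (x : K) : i (i x) = x := by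
  rw [← MulAut.mul_apply, hi]; rfl

theorem thmF_min (hodd : Odd (Nat.card K)) (φ w t w' z : MulAut K)
    (hφ2 : ∃ k, φ ^ 2 ^ k = 1) (hw2 : ∃ k, w ^ 2 ^ k = 1) (ht : t * t = 1)
    (cφw : Commute φ w) (cφt : Commute φ t) (hw' : w' = t * w * t⁻¹) (cww : Commute w w')
    (hz : z = w * w')
    (H2 : ∀ u, (u = w ∨ ∃ a b : ℤ, u = z ^ a * w ^ b * t) → ∀ k, u k = k →
      ∃ m : ℤ, ∃ κ, u κ = κ ∧ (z ^ m * φ) k = κ * k * κ⁻¹)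
    (H3 : ∀ k, ∃ x y : ℤ, ∃ κ, (w ^ x * w' ^ y * φ) k = κ * k * κ⁻¹)
    (H4 : ∀ a : ℤ, z ^ a * z ^ a = 1 → z ^ a ≠ 1 → ∀ k, (z ^ a) k = k → z k = k)
    (hmin : ∀ n : ℤ, orderOf φ ≤ orderOf (φ * z ^ n)) : φ = 1 := by
  by_contra hne
  have ht1 : t⁻¹ = t := inv_eq_of_mul_eq_one_left ht
  rw [ht1] at hw'
  have e1 : t * w = w' * t := by rw [hw', mul_assoc _ t t, ht, mul_one]
  have e2 : t * w' = w * t := by rw [hw', ← mul_assoc, ← mul_assoc, ht, one_mul]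
  have ctz : Commute t z := by
    show t * z = z * t
    rw [hz, ← mul_assoc, e1, mul_assoc, e2, ← mul_assoc, cww.eq]
  have cwz : Commute w z := by rw [hz]; exact (Commute.refl w).mul_right cww
  have cφw' : Commute φ w' := by rw [hw']; exact (cφt.mul_right cφw).mul_right cφt
  have cφz : Commute φ z := by rw [hz]; exact cφw.mul_right cφw'
  obtain ⟨kφ, hkφ⟩ := hφ2
  obtain ⟨kw, hkw⟩ := hw2
  obtain ⟨j, hj⟩ := pow2_order hkφ hne
  have hkw' : w' ^ 2 ^ kw = 1 := by
    have : w' = t * w * t⁻¹ := by rw [ht1, hw']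
    rw [this, conj_pow, hkw]; simp
  have hkz : z ^ 2 ^ kw = 1 := by rw [hz, cww.mul_pow, hkw, hkw', one_mul]
  obtain ⟨ρ, hρdef⟩ : ∃ ρ, ρ = φ ^ 2 ^ j := ⟨_, rfl⟩
  have hρ2 : ρ * ρ = 1 := by rw [hρdef]; exact half_sq hj
  have hρne : ρ ≠ 1 := by rw [hρdef]; exact half_ne hj
  have cρ : ∀ u, Commute φ u → Commute ρ u := fun u hu => by rw [hρdef]; exact hu.pow_left _
  -- basic conjugation principle
  have P : ∀ u, (u = w ∨ ∃ a b : ℤ, u = z ^ a * w ^ b * t) → Commute φ u →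
      ∀ k, u k = k → z k = k → ρ k = k := by
    intro u hu hcu k hk hzk
    refine triv_of_inv ρ (fx u ⊓ fx z) (fun x hx => ⟨fx_inv (cρ u hcu).symm hx.1,
      fx_inv (cρ z cφz).symm hx.2⟩) (fun x _ => sq_apply hρ2 x) ?_ k ⟨hk, hzk⟩
    rintro r ⟨hr1, hr2⟩ hr
    obtain ⟨m, κ, hκ, hm⟩ := H2 u hu r hr1
    have : φ r = κ * r * κ⁻¹ := by
      rw [← hm, cφz.symm.zpow_left m |>.eq, MulAut.mul_apply, fx_pow hr2]
    obtain ⟨κ', _, h'⟩ := conj_pow_aut φ (fx u) (fun x hx => fx_inv hcu.symm hx) hκ this (2 ^ j)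
    rw [← hρdef, hr] at h'
    exact conj_inv hodd h'
  -- (A)
  have hA : ∀ d, ∀ k, z k = k → (w ^ 2 ^ d) k = k → ρ k = k := by
    intro d
    induction d with
    | zero =>
      intro k hk hwk
      exact P w (Or.inl rfl) cφw k (by simpa using hwk) hk
    | succ d ih =>
      intro k hk hwk
      have hJt : ∀ x ∈ fx z ⊓ fx (w ^ 2 ^ (d + 1)), t x ∈ fx z ⊓ fx (w ^ 2 ^ (d + 1)) := by
        rintro x ⟨hx1, hx2⟩
        refine ⟨fx_inv ctz.symm hx1, ?_⟩
        change (w ^ 2 ^ (d + 1)) (t x) = t x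
        change z x = x at hx1
        change (w ^ 2 ^ (d + 1)) x = x at hx2
        have e3 : w ^ 2 ^ (d + 1) * t = t * w' ^ 2 ^ (d + 1) := by
          have : w = t * w' * t⁻¹ := by rw [e2, mul_assoc, mul_inv_cancel, mul_one]
          rw [this, conj_pow]; simp
        have e4 : w' = w⁻¹ * z := by rw [hz]; simp
        have e5 : (w' ^ 2 ^ (d + 1)) x = x := by
          rw [e4, (cwz.inv_left).mul_pow, MulAut.mul_apply]
          have := fx_pow hx1 (2 ^ (d + 1) : ℕ)
          rw [zpow_natCast] at this
          rw [this, inv_pow]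
          have := fx_pow hx2 (-1)
          rwa [zpow_neg_one] at this
        rw [← MulAut.mul_apply, e3, MulAut.mul_apply, e5]
      have hJw : ∀ x ∈ fx z ⊓ fx (w ^ 2 ^ (d + 1)), (w ^ 2 ^ d) x ∈ fx z ⊓ fx (w ^ 2 ^ (d + 1)) :=
        fun x hx => ⟨fx_inv (cwz.pow_left _).symm hx.1, fx_inv (Commute.pow_pow (.refl w) _ _) hx.2⟩
      refine V4 hodd (fx z ⊓ fx (w ^ 2 ^ (d + 1))) (w ^ 2 ^ d) t ρ hJw hJt
        (fun x hx => ⟨fx_inv (cρ z cφz).symm hx.1, fx_inv ((cρ w cφw).pow_right _).symm hx.2⟩)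
        ?_ (fun x _ => sq_apply ht x) (fun x _ => sq_apply hρ2 x) ?_
        ((cρ w cφw).pow_right _).symm (cρ t cφt).symm ?_ ?_ ?_ k ⟨hk, hwk⟩
      · rintro x ⟨hx1, hx2⟩
        rw [← MulAut.mul_apply, ← pow_add, ← two_mul, ← pow_succ']
        exact hx2
      · rintro x ⟨hx1, hx2⟩
        have e4 : w' = w⁻¹ * z := by rw [hz]; simp
        have e3 : t * w ^ 2 ^ d = w' ^ 2 ^ d * t := by
          have : w' = t * w * t⁻¹ := by rw [ht1, hw']
          rw [this, conj_pow]; simp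
        rw [show t ((w ^ 2 ^ d) x) = (t * w ^ 2 ^ d) x from rfl, e3, MulAut.mul_apply, e4, (cwz.inv_left).mul_pow,
          MulAut.mul_apply]
        have h5 := hJt x ⟨hx1, hx2⟩
        have := fx_pow h5.1 (2 ^ d : ℕ)
        rw [zpow_natCast] at this
        rw [this, inv_pow]
        have h6 : (w ^ 2 ^ d) ((w ^ 2 ^ d) (t x)) = t x := by
          rw [← MulAut.mul_apply, ← pow_add, ← two_mul, ← pow_succ']
          exact h5.2
        conv_rhs => rw [← h6]
        simp
      · rintro x ⟨hx1, _⟩ hx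
        exact ih x hx1 hx
      · rintro x ⟨hx1, _⟩ hx
        exact P t (Or.inr ⟨0, 0, by simp⟩) cφt x hx hx1
      · rintro x ⟨hx1, _⟩ hx
        exact P (w ^ 2 ^ d * t) (Or.inr ⟨0, (2 ^ d : ℕ), by simp [← zpow_natCast]⟩)
          ((cφw.pow_right _).mul_right cφt) x hx hx1
  have hA' : ∀ k, z k = k → ρ k = k := fun k hk => hA kw k hk (by rw [hkw]; rfl)
  by_cases hz1 : z = 1
  · apply hρne; ext x; exact hA' x (by rw [hz1]; rfl)
  obtain ⟨l, hl⟩ := pow2_order hkz hz1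
  obtain ⟨i, hidef⟩ : ∃ i, i = z ^ 2 ^ l := ⟨_, rfl⟩
  have hidef' : i = z ^ (2 ^ l : ℤ) := by rw [hidef, ← zpow_natCast]; push_cast; rfl
  have hi2 : i * i = 1 := by rw [hidef]; exact half_sq hl
  have hine : i ≠ 1 := by rw [hidef]; exact half_ne hl
  have hfi : ∀ x, i x = x → ρ x = x := fun x hx => by
    refine hA' x (H4 (2 ^ l : ℤ) ?_ ?_ x ?_) <;> rw [← hidef'] <;> assumption
  have cφi : Commute φ i := by rw [hidef]; exact cφz.pow_right _
  have cti : Commute t i := by rw [hidef]; exact ctz.pow_right _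
  have cρi := cρ i cφi
  have hut : ∀ u, (u = t ∨ u = i * t) → (u = w ∨ ∃ a b : ℤ, u = z ^ a * w ^ b * t) := by
    rintro u (rfl | rfl)
    · exact Or.inr ⟨0, 0, by simp⟩
    · exact Or.inr ⟨(2 ^ l : ℤ), 0, by simp [← hidef']⟩
  have cut : ∀ u, (u = t ∨ u = i * t) → Commute z u ∧ Commute φ u ∧ Commute i u := by
    rintro u (rfl | rfl)
    · exact ⟨ctz.symm, cφt, cti.symm⟩
    · exact ⟨(by rw [hidef]; exact ((Commute.refl z).pow_right _).mul_right ctz.symm),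
        cφi.mul_right cφt, (Commute.refl i).mul_right cti.symm⟩
  -- V4 for an automorphism σ
  have V : ∀ σ : MulAut K, σ * σ = 1 → Commute i σ → Commute t σ → (∀ x, i x = x → σ x = x) →
      (∀ x, t x = x → σ x = x) → (∀ x, (i * t) x = x → σ x = x) → σ = 1 := by
    intro σ h1 h2 h3 h4 h5 h6
    ext x
    exact V4 hodd ⊤ i t σ (by simp) (by simp) (by simp) (fun x _ => sq_apply hi2 x)
      (fun x _ => sq_apply ht x) (fun x _ => sq_apply h1 x)
      (fun x _ => by rw [← MulAut.mul_apply, ← cti.eq]; rfl) h2 h3 (fun x _ => h4 x)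
      (fun x _ => h5 x) (fun x _ => h6 x) x trivial
  by_cases hρi : ρ = i
  · rcases le_or_gt j l with hjl | hjl
    · -- m ≤ h
      obtain ⟨q, rfl⟩ := Nat.exists_eq_add_of_le hjl
      have h1 : (φ * z ^ (-(2 ^ q : ℤ))) ^ 2 ^ j = 1 := by
        rw [(cφz.zpow_right _).mul_pow, ← hρdef, hρi, hidef', ← zpow_natCast (z ^ _), ← zpow_mul,
          ← zpow_add, pow_add]
        convert zpow_zero z using 2
        push_cast; ring
      have h2 := hmin (-(2 ^ q : ℤ))
      have h3 := Nat.le_of_dvd (by positivity) (orderOf_dvd_of_pow_eq_one h1)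
      rw [hj, pow_succ] at h2
      have : 0 < 2 ^ j := by positivity
      omega
    · have key : ∀ u, (u = t ∨ u = i * t) → ∀ x, u x = x → i x = x := by
        intro u hu x hx
        obtain ⟨c1, c2, c3⟩ := cut u hu
        refine triv_of_inv i (fx u) (fun x hx => fx_inv c3.symm hx) (fun x _ => sq_apply hi2 x)
          ?_ x hx
        intro r hr hir
        obtain ⟨m, κ, hκ, hm⟩ := H2 u (hut u hu) r hr
        obtain ⟨κ', _, h'⟩ := conj_pow_aut (z ^ m * φ) (fx u)
          (fun x hx => fx_inv (((c1.zpow_left m).mul_left c2).symm) hx) hκ hm (2 ^ j)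
        rw [((cφz.symm).zpow_left m).mul_pow, ← hρdef, hρi, ← zpow_natCast, ← zpow_mul, mul_comm m,
          zpow_mul, zpow_natCast, pow_ge hl hjl, one_zpow, one_mul, hir] at h'
        exact conj_inv hodd h'
      exact hine (V i hi2 (.refl i) cti (fun _ h => h) (key t (.inl rfl)) (key _ (.inr rfl)))
  · -- mixing case
    obtain ⟨ι, hιdef⟩ : ∃ ι, ι = i * ρ := ⟨_, rfl⟩
    have hιne : ι ≠ 1 := by
      intro h
      apply hρi
      rw [hιdef] at h
      calc ρ = i * (i * ρ) := by rw [← mul_assoc, hi2, one_mul]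
        _ = i := by rw [h, mul_one]
    have hι2 : ι * ι = 1 := by rw [hιdef, cρi.mul_mul_mul_comm, hi2, hρ2, one_mul]
    have M := mix hodd i ρ hi2 hρ2 cρi.symm hfi
    rw [← hιdef] at M
    have hfι : ∀ x, i x = x → ι x = x := fun x hx => by
      rw [hιdef, MulAut.mul_apply, hfi x hx, hx]
    have cρt := cρ t cφt
    have cιt : Commute t ι := by rw [hιdef]; exact cti.mul_right cρt.symm
    have ciι : Commute i ι := by rw [hιdef]; exact (Commute.refl i).mul_right cρi.symm
    have Q : ∀ u, (u = t ∨ u = i * t) → (∀ x, u x = x → ρ x = x) ∨ (∀ x, u x = x → ι x = x) := by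
      intro u hu
      obtain ⟨c1, c2, c3⟩ := cut u hu
      have cuρ := cρ u c2
      have cuι : Commute ι u := by rw [hιdef]; exact c3.mul_left cuρ
      by_contra hcon
      push Not at hcon
      obtain ⟨⟨x, hx1, hx2⟩, ⟨y, hy1, hy2⟩⟩ := hcon
      have ex1 := inv_of ρ x (sq_apply hρ2 x)
      have ey1 := inv_of ι y (sq_apply hι2 y)
      have ux : u (x⁻¹ * ρ x) = x⁻¹ * ρ x :=
        (fx u).mul_mem ((fx u).inv_mem hx1) (fx_inv cuρ.symm hx1)
      have uy : u (y⁻¹ * ι y) = y⁻¹ * ι y :=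
        (fx u).mul_mem ((fx u).inv_mem hy1) (fx_inv cuι.symm hy1)
      have nx : x⁻¹ * ρ x ≠ 1 := fun h => hx2 (inv_mul_eq_one.1 h).symm
      have ny : y⁻¹ * ι y ≠ 1 := fun h => hy2 (inv_mul_eq_one.1 h).symm
      generalize x⁻¹ * ρ x = k1 at *
      generalize y⁻¹ * ι y = k2 at *
      obtain ⟨m, κ, hκ, hm⟩ := H2 u (hut u hu) (k1 * k2) (by rw [map_mul, ux, uy])
      obtain ⟨N, hN⟩ := numeric cφz.symm hl hj m
      rw [← hidef, ← hρdef, ← hιdef] at hN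
      obtain ⟨κ', _, h'⟩ := conj_pow_aut (z ^ m * φ) ⊤ (by simp) trivial hm N
      rcases M k1 k2 ex1 ey1 _ hN κ' h' with h | h
      · exact nx h
      · exact ny h
    have hsgn : ∀ σ, Commute i σ → Commute t σ → Commute w σ →
        ((∀ x, t x = x → σ x = x) ∨ (∀ x, (i * t) x = x → σ x = x)) →
        (∀ x, i x = x → σ x = x) → ∀ r, σ r = r⁻¹ → (w * w'⁻¹) r = r := by
      intro σ c1 c2 c3 h1 h2 r hr
      have hi : ∀ r, σ r = r⁻¹ → i r = r⁻¹ := fun r hr =>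
        lemI hodd ⊤ i σ (by simp) (fun x _ => sq_apply hi2 x) c1 (fun x _ => h2 x) r trivial hr
      have hwinv : σ (w⁻¹ r) = (w⁻¹ r)⁻¹ := by
        rw [← MulAut.mul_apply, ← (c3.inv_left).eq, MulAut.mul_apply, hr, map_inv]
      have e6 : w * w'⁻¹ = w * t * w⁻¹ * t := by rw [hw']; simp [ht1, mul_assoc]
      rw [e6]
      rcases h1 with h1 | h1
      · have ht' : ∀ r, σ r = r⁻¹ → t r = r⁻¹ := fun r hr =>
          lemI hodd ⊤ t σ (by simp) (fun x _ => sq_apply ht x) c2 (fun x _ => h1 x) r trivial hr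
        simp only [MulAut.mul_apply, ht' r hr, map_inv, ht' _ hwinv, inv_inv]
        simp
      · have hit : ∀ r, σ r = r⁻¹ → (i * t) r = r⁻¹ := fun r hr =>
          lemI hodd ⊤ (i * t) σ (by simp) (fun x _ => sq_apply (by
            rw [cti.mul_mul_mul_comm, hi2, ht, one_mul]) x) (c1.mul_left c2) (fun x _ => h1 x)
            r trivial hr
        have ht' : ∀ r, σ r = r⁻¹ → t r = r := fun r hr => by
          have h7 := hit r hr
          rw [← hi r hr, MulAut.mul_apply] at h7
          exact i.injective h7
        simp only [MulAut.mul_apply, ht' r hr, ht' _ hwinv]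
        simp
    have fin : ((∀ x, t x = x → ρ x = x) ∨ (∀ x, (i * t) x = x → ρ x = x)) →
        ((∀ x, t x = x → ι x = x) ∨ (∀ x, (i * t) x = x → ι x = x)) → False := by
      intro g1 g2
      have cwι : Commute w ι := by
        rw [hιdef, hidef]; exact (cwz.pow_right _).mul_right (cρ w cφw).symm
      obtain ⟨k1, hk1, nk1⟩ := exists_inverted ρ hρ2 hρne
      obtain ⟨k2, hk2, nk2⟩ := exists_inverted ι hι2 hιne
      have v1 := hsgn ρ cρi.symm cρt.symm (cρ w cφw).symm g1 hfi k1 hk1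
      have v2 := hsgn ι ciι cιt cwι g2 hfι k2 hk2
      have v3 : (w * w'⁻¹) (k1 * k2) = k1 * k2 := by rw [map_mul, v1, v2]
      obtain ⟨x, y, κ, hκ⟩ := H3 (k1 * k2)
      have cvz : Commute (w * w'⁻¹) z := by
        have : Commute w' z := by rw [hz]; exact cww.symm.mul_right (.refl w')
        exact cwz.mul_left this.inv_left
      have cvφ : Commute (w * w'⁻¹) φ := (cφw.mul_right cφw'.inv_right).symm
      -- reduce to powers of z and φ
      have gen : ∀ (M N : ℕ) (n p q : ℤ) (ψ : MulAut K), Commute φ ψ → Commute (w * w'⁻¹) ψ →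
          Commute z ψ →
          (w ^ x * w' ^ y * φ) ^ M = z ^ n * ψ * (w * w'⁻¹) ^ p →
          ((z ^ n * ψ) ^ N = i ∨ (z ^ n * ψ) ^ N = ρ ∨ (z ^ n * ψ) ^ N = ι) → False := by
        intro M' N n p q ψ _ d2 d3 d4 hN
        obtain ⟨κ', _, h'⟩ := conj_pow_aut _ ⊤ (by simp) trivial hκ (M' * N)
        rw [pow_mul, d4, Commute.mul_pow ((cvz.symm.zpow_left _).mul_left d2.symm |>.zpow_right _),
          MulAut.mul_apply, ← zpow_natCast ((w * w'⁻¹) ^ p), ← zpow_mul, fx_pow v3] at h'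
        rcases M k1 k2 hk1 hk2 _ hN κ' h' with h | h
        · exact nk1 h
        · exact nk2 h
      obtain ⟨q, hq⟩ := Int.even_or_odd' (x + y)
      have exp : ∀ a b n p : ℤ, a = n + p → b = n - p →
          w ^ a * w' ^ b = z ^ n * (w * w'⁻¹) ^ p := by
        rintro a b n p rfl rfl
        rw [hz, cww.mul_zpow, (cww.inv_right).mul_zpow, zpow_add, sub_eq_add_neg, zpow_add, inv_zpow',
          mul_assoc, mul_assoc, ← mul_assoc (w ^ p), ← mul_assoc (w' ^ n),
          ((cww.zpow_left p).zpow_right n).eq]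
      rcases hq with hq | hq
      · obtain ⟨N, hN⟩ := numeric cφz.symm hl hj q
        rw [← hidef, ← hρdef, ← hιdef] at hN
        refine gen 1 N q (x - q) 0 φ (.refl _) cvφ cφz.symm ?_ hN
        rw [pow_one, exp x y q (x - q) (by ring) (by linarith), mul_assoc, (cvφ.zpow_left _).eq,
          mul_assoc]
      · have sqe : (w ^ x * w' ^ y * φ) ^ 2 = z ^ (x + y) * φ ^ 2 * (w * w'⁻¹) ^ (x - y) := by
          have c1 : Commute (w ^ x * w' ^ y) φ :=
            ((cφw.zpow_right x).mul_right (cφw'.zpow_right y)).symm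
          have c2 : Commute (w ^ x) (w' ^ y) := (cww.zpow_left x).zpow_right y
          rw [c1.mul_pow, c2.mul_pow, ← zpow_natCast, ← zpow_natCast, ← zpow_mul, ← zpow_mul,
            exp _ _ (x + y) (x - y) (by push_cast; ring) (by push_cast; ring), mul_assoc, mul_assoc,
            ((cvφ.zpow_left _).pow_right 2).eq]
        have dd : ∀ N : ℕ, ((z ^ (x + y) * φ ^ 2) ^ N = i ∨ (z ^ (x + y) * φ ^ 2) ^ N = ρ ∨
            (z ^ (x + y) * φ ^ 2) ^ N = ι) → False := fun N hN =>
          gen 2 N (x + y) (x - y) 0 (φ ^ 2) ((Commute.refl φ).pow_right 2) (cvφ.pow_right 2)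
            (cφz.symm.pow_right 2) sqe hN
        cases j with
        | zero =>
          apply dd (2 ^ l)
          left
          have : φ ^ 2 = 1 := by rw [← pow_orderOf_eq_one φ, hj]; norm_num
          rw [this, mul_one, hq, ← zpow_natCast, ← zpow_mul, hidef', add_mul, zpow_add, mul_comm,
            one_mul]
          push_cast
          rw [← mul_assoc, zpow_mul]
          have : z ^ ((2:ℤ) ^ l * 2) = 1 := by
            have := pow_orderOf_eq_one z
            rw [hl, ← zpow_natCast, pow_succ] at this
            push_cast at this
            exact this
          rw [this, one_zpow, one_mul]
        | succ j =>
          have hj' : orderOf (φ ^ 2) = 2 ^ (j + 1) := by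
            rw [orderOf_pow, hj, pow_succ 2 (j + 1)]
            simp
          obtain ⟨N, hN⟩ := numeric (cφz.symm.pow_right 2) hl hj' (x + y)
          apply dd N
          have : (φ ^ 2) ^ 2 ^ j = ρ := by rw [hρdef, ← pow_mul, ← pow_succ']
          rw [this, ← hidef, ← hιdef] at hN
          exact hN
    rcases Q t (.inl rfl) with h1 | h1 <;> rcases Q _ (.inr rfl) with h2 | h2
    · exact hρne (V ρ hρ2 cρi.symm cρt.symm hfi h1 h2)
    · exact fin (.inl h1) (.inr h2)
    · exact fin (.inr h2) (.inl h1)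
    · exact hιne (V ι hι2 ciι cιt hfι h1 h2)

theorem thmF (hodd : Odd (Nat.card K)) (φ w t w' z : MulAut K)
    (hφ2 : ∃ k, φ ^ 2 ^ k = 1) (hw2 : ∃ k, w ^ 2 ^ k = 1) (ht : t * t = 1)
    (cφw : Commute φ w) (cφt : Commute φ t) (hw' : w' = t * w * t⁻¹) (cww : Commute w w')
    (hz : z = w * w')
    (H2 : ∀ u, (u = w ∨ ∃ a b : ℤ, u = z ^ a * w ^ b * t) → ∀ k, u k = k →
      ∃ m : ℤ, ∃ κ, u κ = κ ∧ (z ^ m * φ) k = κ * k * κ⁻¹)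
    (H3 : ∀ k, ∃ x y : ℤ, ∃ κ, (w ^ x * w' ^ y * φ) k = κ * k * κ⁻¹)
    (H4 : ∀ a : ℤ, z ^ a * z ^ a = 1 → z ^ a ≠ 1 → ∀ k, (z ^ a) k = k → z k = k) :
    ∃ m : ℤ, φ = z ^ m := by
  obtain ⟨n, hn⟩ : ∃ n : ℤ, ∀ n' : ℤ, orderOf (φ * z ^ n) ≤ orderOf (φ * z ^ n') := by
    have := WellFounded.has_min (measure (fun n : ℤ => orderOf (φ * z ^ n))).wf Set.univ ⟨0, trivial⟩
    obtain ⟨n, _, hn⟩ := this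
    exact ⟨n, fun n' => not_lt.1 (hn n' trivial)⟩
  have ht1 : t⁻¹ = t := inv_eq_of_mul_eq_one_left ht
  have cφw' : Commute φ w' := by rw [hw', ht1]; exact (cφt.mul_right cφw).mul_right cφt
  have cφz : Commute φ z := by rw [hz]; exact cφw.mul_right cφw'
  have e1 : t * w = w' * t := by rw [hw']; simp
  have e2 : t * w' = w * t := by rw [hw', ht1, ← mul_assoc, ← mul_assoc, ht, one_mul]
  have ctz : Commute t z := by
    show t * z = z * t
    rw [hz, ← mul_assoc, e1, mul_assoc, e2, ← mul_assoc, cww.eq]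
  have cwz : Commute w z := by rw [hz]; exact (Commute.refl w).mul_right cww
  have hmain : φ * z ^ n = 1 := by
    refine thmF_min hodd (φ * z ^ n) w t w' z ?_ hw2 ht
      (cφw.mul_left (cwz.zpow_right n).symm) (cφt.mul_left (ctz.zpow_right n).symm) hw' cww hz
      ?_ ?_ H4 ?_
    · obtain ⟨a, ha⟩ := hφ2
      obtain ⟨b, hb⟩ := hw2
      have hb' : w' ^ 2 ^ b = 1 := by rw [hw', conj_pow, hb]; simp
      have hzb : z ^ 2 ^ b = 1 := by rw [hz, cww.mul_pow, hb, hb', one_mul]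
      refine ⟨a + b, ?_⟩
      rw [(cφz.zpow_right n).mul_pow, pow_add, pow_mul, ha, one_pow, one_mul, mul_comm, pow_mul,
        ← zpow_natCast (z ^ n), ← zpow_mul, mul_comm n, zpow_mul, zpow_natCast, hzb, one_zpow,
        one_pow]
    · intro u hu k hk
      obtain ⟨m, κ, h1, h2⟩ := H2 u hu k hk
      refine ⟨m - n, κ, h1, ?_⟩
      rw [(cφz.zpow_right n).eq, ← mul_assoc, ← zpow_add, sub_add_cancel, h2]
    · intro k
      obtain ⟨x, y, κ, h⟩ := H3 k
      refine ⟨x - n, y - n, κ, ?_⟩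
      rw [← h]
      have c1 : Commute (w ^ n) (w' ^ (y - n)) := (cww.zpow_left _).zpow_right _
      have : w ^ (x - n) * w' ^ (y - n) * z ^ n = w ^ x * w' ^ y := by
        rw [hz, cww.mul_zpow, mul_assoc, ← mul_assoc (w' ^ (y - n)), ← c1.eq, mul_assoc, ← zpow_add,
          ← mul_assoc, ← zpow_add]
        simp
      rw [(cφz.zpow_right n).eq, ← mul_assoc, this]
    · intro n'
      rw [mul_assoc, ← zpow_add]
      exact hn _
  exact ⟨-n, by rw [zpow_neg]; exact eq_inv_of_mul_eq_one_left hmain⟩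

/-- the Q-type variant -/
theorem thmQ (hodd : Odd (Nat.card K)) (φ w z : MulAut K)
    (hφ2 : φ * φ = 1) (cφw : Commute φ w) (hz : w * w = z) (hz2 : z * z = 1)
    (hf : ∀ x, z x = x → φ x = x)
    (H3 : ∀ k, ∃ n : ℤ, ∃ κ, (w ^ n * φ) k = κ * k * κ⁻¹) : φ = 1 ∨ φ = z := by
  by_contra hcon
  push Not at hcon
  obtain ⟨h1, h2⟩ := hcon
  have cφz : Commute φ z := by rw [← hz]; exact cφw.mul_right cφw
  have hι2 : (z * φ) * (z * φ) = 1 := by rw [cφz.mul_mul_mul_comm, hz2, hφ2, one_mul]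
  have hιne : z * φ ≠ 1 := by
    intro h
    apply h2
    calc φ = z * (z * φ) := by rw [← mul_assoc, hz2, one_mul]
      _ = z := by rw [h, mul_one]
  obtain ⟨k1, hk1, nk1⟩ := exists_inverted φ hφ2 h1
  obtain ⟨k2, hk2, nk2⟩ := exists_inverted (z * φ) hι2 hιne
  obtain ⟨n, κ, hκ⟩ := H3 (k1 * k2)
  have M := mix hodd z φ hz2 hφ2 cφz.symm hf k1 k2 hk1 hk2
  have hzq : ∀ q : ℤ, z ^ q = 1 ∨ z ^ q = z := by
    intro q
    obtain ⟨r, hr⟩ := Int.even_or_odd' q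
    rcases hr with rfl | rfl
    · left; rw [zpow_mul, zpow_ofNat, pow_two, hz2, one_zpow]
    · right; rw [zpow_add, zpow_mul, zpow_ofNat, pow_two, hz2, one_zpow]; simp
  have fin : ∀ σ, (σ = z ∨ σ = φ ∨ σ = z * φ) → ∀ κ', σ (k1 * k2) = κ' * (k1 * k2) * κ'⁻¹ → False :=
    fun σ hσ κ' h => (M σ hσ κ' h).elim nk1 nk2
  obtain ⟨q, hq⟩ := Int.even_or_odd' n
  rcases hq with rfl | rfl
  · rw [zpow_mul, zpow_ofNat, pow_two, hz] at hκ
    rcases hzq q with h | h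
    · rw [h, one_mul] at hκ; exact fin _ (by simp) _ hκ
    · rw [h] at hκ; exact fin _ (by simp) _ hκ
  · obtain ⟨κ', _, h'⟩ := conj_pow_aut _ ⊤ (by simp) trivial hκ 2
    have : (w ^ (2 * q + 1) * φ) ^ 2 = z := by
      rw [(cφw.symm.zpow_left _).mul_pow, pow_two φ, hφ2, mul_one, zpow_add, zpow_mul, zpow_ofNat,
        pow_two w, hz, zpow_one]
      have c : Commute (z ^ q) w := by rw [← hz]; exact ((Commute.refl w).mul_left (.refl w)).zpow_left q
      rw [c.mul_pow, pow_two w, hz, ← zpow_natCast, ← zpow_mul, mul_comm, zpow_mul, zpow_natCast,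
        pow_two, hz2, one_zpow, one_mul]
    rw [this] at h'
    exact fin _ (by simp) _ h'

end OddG

namespace Hzero

open Wreathed

/-- additive model of the odd part -/
abbrev V0 : Type := (ZMod 5 × ZMod 5) × (ZMod 3 × ZMod 3)

def c5 (a : ZMod 4) : ZMod 5 := 2 ^ a.val

def swp (τ : ZMod 2) (m : ZMod 5 × ZMod 5) : ZMod 5 × ZMod 5 := if τ = 0 then m else (m.2, m.1)

def actM (a b : ZMod 4) (τ : ZMod 2) (m : ZMod 5 × ZMod 5) : ZMod 5 × ZMod 5 :=
  (c5 a * (swp τ m).1, c5 b * (swp τ m).2)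

def Jp (k : ZMod 4) (d : ZMod 3 × ZMod 3) : ZMod 3 × ZMod 3 :=
  if k = 0 then d else if k = 1 then (-d.2, d.1) else if k = 2 then (-d.1, -d.2) else (d.2, -d.1)

def del (a b : ZMod 4) (τ : ZMod 2) : ZMod 4 := a + b + if τ = 0 then 0 else 2

def sa (s : W 2) : ZMod 4 := Multiplicative.toAdd s.left.1
def sb (s : W 2) : ZMod 4 := Multiplicative.toAdd s.left.2
def st (s : W 2) : ZMod 2 := Multiplicative.toAdd s.right

def mkW (a b : ZMod 4) (τ : ZMod 2) : W 2 :=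
  ⟨(Multiplicative.ofAdd a, Multiplicative.ofAdd b), Multiplicative.ofAdd τ⟩

lemma st_cases (τ : ZMod 2) : τ = 0 ∨ τ = 1 := by revert τ; decide

lemma W_ext (s : W 2) : s = mkW (sa s) (sb s) (st s) := rfl

lemma st_mul (s s' : W 2) : st (s * s') = st s + st s' := rfl

lemma act_zero (x : C 2 × C 2) : act 2 (Multiplicative.ofAdd 0) x = x := rfl

lemma act_one (x : C 2 × C 2) : act 2 (Multiplicative.ofAdd 1) x = (x.2, x.1) := rfl

lemma mk_mul (a b a' b' : ZMod 4) (τ τ' : ZMod 2) : mkW a b τ * mkW a' b' τ' =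
    mkW (a + if τ = 0 then a' else b') (b + if τ = 0 then b' else a') (τ + τ') := by
  rcases st_cases τ with rfl | rfl
  · rfl
  · rfl

lemma c5_add (a b : ZMod 4) : c5 (a + b) = c5 a * c5 b := by revert a b; decide

lemma Jp_add (a b : ZMod 4) (d : ZMod 3 × ZMod 3) : Jp (a + b) d = Jp a (Jp b d) := by
  revert a b d; decide

lemma Jp_lin (a : ZMod 4) (d d' : ZMod 3 × ZMod 3) : Jp a (d + d') = Jp a d + Jp a d' := by
  revert a d d'; decide

lemma actM_mul (a b a' b' : ZMod 4) (τ τ' : ZMod 2) (m : ZMod 5 × ZMod 5) :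
    actM (a + if τ = 0 then a' else b') (b + if τ = 0 then b' else a') (τ + τ') m =
      actM a b τ (actM a' b' τ' m) := by
  obtain ⟨x, y⟩ := m
  have h : (1 : ZMod 2) + 1 = 0 := by decide
  rcases st_cases τ with rfl | rfl <;> rcases st_cases τ' with rfl | rfl <;>
    simp [actM, swp, c5_add, h, mul_assoc]

lemma actM_lin (a b : ZMod 4) (τ : ZMod 2) (m m' : ZMod 5 × ZMod 5) :
    actM a b τ (m + m') = actM a b τ m + actM a b τ m' := by
  rcases st_cases τ with rfl | rfl <;>
    simp [actM, swp, mul_add]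

lemma del_mul (a b a' b' : ZMod 4) (τ τ' : ZMod 2) :
    del (a + if τ = 0 then a' else b') (b + if τ = 0 then b' else a') (τ + τ') =
      del a b τ + del a' b' τ' := by
  revert a b a' b' τ τ'; decide

def actV (s : W 2) (v : V0) : V0 :=
  (actM (sa s) (sb s) (st s) v.1, Jp (del (sa s) (sb s) (st s)) v.2)

lemma actV_mul (s s' : W 2) (v : V0) : actV (s * s') v = actV s (actV s' v) := by
  have h := mk_mul (sa s) (sb s) (sa s') (sb s') (st s) (st s')
  rw [← W_ext s, ← W_ext s'] at h
  have h1 : ∀ a b τ, sa (mkW a b τ) = a := fun _ _ _ => rfl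
  have h2 : ∀ a b τ, sb (mkW a b τ) = b := fun _ _ _ => rfl
  have h3 : ∀ a b τ, st (mkW a b τ) = τ := fun _ _ _ => rfl
  rw [h]
  simp only [actV, h1, h2, h3]
  rw [actM_mul, del_mul, Jp_add]

lemma actV_one (v : V0) : actV 1 v = v := by
  have : (1 : W 2) = mkW 0 0 0 := rfl
  obtain ⟨⟨x, y⟩, d⟩ := v
  rw [this]
  have h1 : c5 0 = 1 := by decide
  have h2 : del 0 0 0 = 0 := by decide
  show (actM 0 0 0 (x, y), Jp (del 0 0 0) d) = _
  simp [actM, swp, h1, h2, Jp]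

abbrev V : Type := Multiplicative V0

def actHom : W 2 →* MulAut V where
  toFun s :=
    { toFun := fun v => Multiplicative.ofAdd (actV s (Multiplicative.toAdd v))
      invFun := fun v => Multiplicative.ofAdd (actV s⁻¹ (Multiplicative.toAdd v))
      left_inv := fun v => by
        simp only [toAdd_ofAdd, ← actV_mul, inv_mul_cancel, actV_one, ofAdd_toAdd]
      right_inv := fun v => by
        simp only [toAdd_ofAdd, ← actV_mul, mul_inv_cancel, actV_one, ofAdd_toAdd]
      map_mul' := fun v v' => by
        rw [← ofAdd_add]
        congr 1
        exact Prod.ext (actM_lin _ _ _ _ _) (Jp_lin _ _ _) }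
  map_one' := by refine MulEquiv.ext fun v => ?_; exact congrArg Multiplicative.ofAdd (actV_one _)
  map_mul' s s' := by refine MulEquiv.ext fun v => ?_; exact congrArg Multiplicative.ofAdd (actV_mul _ _ _)

abbrev H : Type := V ⋊[actHom] (W 2)

def dbl (v : V0) : V0 := (2 * v.1, v.2)
def hlv (v : V0) : V0 := (3 * v.1, v.2)

lemma dbl_act (s : W 2) (v : V0) : dbl (actV s v) = actV s (dbl v) := by
  obtain ⟨⟨x, y⟩, d⟩ := v
  have : (2 : ZMod 5 × ZMod 5) = (2, 2) := rfl
  rcases st_cases (st s) with h | h <;>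
    simp [dbl, actV, actM, swp, h, mul_left_comm, this]

lemma hlv_dbl (v : V0) : hlv (dbl v) = v := by
  have : (3 : ZMod 5 × ZMod 5) * 2 = 1 := by decide
  simp [hlv, dbl, ← mul_assoc, this]

lemma dbl_hlv (v : V0) : dbl (hlv v) = v := by
  have : (2 : ZMod 5 × ZMod 5) * 3 = 1 := by decide
  simp [hlv, dbl, ← mul_assoc, this]

lemma dbl_add (v v' : V0) : dbl (v + v') = dbl v + dbl v' := by
  simp [dbl, mul_add]

/-- the automorphism of `H` -/
def phi : MulAut H where
  toFun x := ⟨Multiplicative.ofAdd (dbl (Multiplicative.toAdd x.left)), x.right⟩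
  invFun x := ⟨Multiplicative.ofAdd (hlv (Multiplicative.toAdd x.left)), x.right⟩
  left_inv x := by ext <;> simp [hlv_dbl]
  right_inv x := by ext <;> simp [dbl_hlv]
  map_mul' x y := by
    apply SemidirectProduct.ext
    · show Multiplicative.ofAdd (dbl (Multiplicative.toAdd x.left +
        actV x.right (Multiplicative.toAdd y.left))) = _
      rw [dbl_add, dbl_act]; rfl
    · rfl

instance : Finite (W 2) := Finite.of_equiv _ SemidirectProduct.equivProd.symm
instance : Finite H := Finite.of_equiv _ SemidirectProduct.equivProd.symm

lemma card_W : Nat.card (W 2) = 32 := by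
  rw [SemidirectProduct.card, Nat.card_prod]
  simp

lemma card_V : Nat.card V = 225 := by
  show Nat.card V0 = 225
  simp

lemma card_H : Nat.card H = 7200 := by
  rw [SemidirectProduct.card, card_W, card_V]

lemma conj_form (x : H) (u : V0) (h : W 2) (hc : h * x.right = x.right * h)
    (e : actV h (Multiplicative.toAdd x.left) + u =
      dbl (Multiplicative.toAdd x.left) + actV x.right u) : IsConj x (phi x) := by
  rw [isConj_iff]
  refine ⟨⟨Multiplicative.ofAdd u, h⟩, ?_⟩
  rw [mul_inv_eq_iff_eq_mul]
  apply SemidirectProduct.ext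
  · show Multiplicative.ofAdd (u + actV h (Multiplicative.toAdd x.left)) =
      Multiplicative.ofAdd (dbl (Multiplicative.toAdd x.left) + actV x.right u)
    rw [add_comm, e]
  · exact hc

lemma D_solve : ∀ k : ZMod 4, k ≠ 0 → ∀ d, ∃ u, Jp 2 d + u = d + Jp k u := by decide

lemma M_free : ∀ a b : ZMod 4, ∀ τ : ZMod 2, del a b τ = 0 → ¬ (a = 0 ∧ b = 0 ∧ τ = 0) →
    ∀ m, ∃ u, m + u = 2 * m + actM a b τ u := by decide

lemma M_eig : ∀ m, ∃ a b : ZMod 4, ∃ τ : ZMod 2, del a b τ = 0 ∧ actM a b τ m = 2 * m := by decide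

lemma actM_oo : ∀ m, actM 1 1 0 m = 2 * m := by decide

lemma Jp_zero (d) : Jp 0 d = d := rfl

lemma phi_cp : IsClassPreserving phi := by
  intro x
  obtain ⟨v, s⟩ := x
  obtain ⟨m, d⟩ := v
  by_cases hd : del (sa s) (sb s) (st s) = 0
  · by_cases h1 : sa s = 0 ∧ sb s = 0 ∧ st s = 0
    · obtain ⟨a, b, τ, e1, e2⟩ := M_eig m
      have hs : s = 1 := by rw [W_ext s, h1.1, h1.2.1, h1.2.2]; rfl
      subst hs
      refine conj_form _ 0 (mkW a b τ) (by simp) ?_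
      show ((actM a b τ m, Jp (del a b τ) d) : V0) + 0 = (2 * m, d) + actV 1 0
      rw [e1, e2, Jp_zero, actV_one]
    · obtain ⟨u, hu⟩ := M_free _ _ _ hd h1 m
      refine conj_form _ (u, 0) 1 (by simp) ?_
      show actV 1 ((m, d) : V0) + (u, 0) = (2 * m, d) +
        (actM (sa s) (sb s) (st s) u, Jp (del (sa s) (sb s) (st s)) 0)
      rw [actV_one, hd, Jp_zero]
      exact Prod.ext hu rfl
  · obtain ⟨u, hu⟩ := D_solve _ hd d
    refine conj_form _ (0, u) (mkW 1 1 0) ?_ ?_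
    · show mkW 1 1 0 * s = s * mkW 1 1 0
      rw [W_ext s, mk_mul, mk_mul]
      simp [add_comm]
    · show ((actM 1 1 0 m, Jp (del 1 1 0) d) : V0) + (0, u) = (2 * m, d) +
        (actM (sa s) (sb s) (st s) 0, Jp (del (sa s) (sb s) (st s)) u)
      have e0 : actM (sa s) (sb s) (st s) 0 = 0 := by
        rcases st_cases (st s) with h | h <;> simp [actM, swp, h]
      have e1 : actM 1 1 0 m = 2 * m := by revert m; decide
      have e2 : del 1 1 0 = 2 := by decide
      rw [e0, e1, e2]
      exact Prod.ext (by simp) hu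

/-- fixed points of `phi` -/
def E : Subgroup H := (phi.toMonoidHom).eqLocus (MonoidHom.id H)

lemma inner_out (g : H) : phi ≠ MulAut.conj g := by
  intro h
  have key : ∀ v : V0, actV g.right v = dbl v := by
    intro v
    have h1 : phi (SemidirectProduct.inl (Multiplicative.ofAdd v)) * g =
        g * SemidirectProduct.inl (Multiplicative.ofAdd v) := by
      rw [h]; simp
    have h2 := congrArg (fun x : H => Multiplicative.toAdd x.left) h1
    change dbl v + actV 1 (Multiplicative.toAdd g.left) =
      Multiplicative.toAdd g.left + actV g.right v at h2
    rw [actV_one, add_comm] at h2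
    exact (add_left_cancel h2).symm
  have k1 := key ((1, 0), 0)
  have k2 := key ((0, 1), 0)
  have k3 := key (0, (1, 0))
  simp only [actV] at k1 k2 k3
  generalize sa g.right = a at *
  generalize sb g.right = b at *
  generalize st g.right = τ at *
  revert a b τ
  decide

/-- every Sylow subgroup for a prime not dividing the index of `E` is conjugate into `E` -/
lemma sylow_conj_le {G : Type*} [Group G] [Finite G] {p : ℕ} [Fact p.Prime] (E : Subgroup G)
    (hE : ¬ p ∣ E.index) (P : Sylow p G) : ∃ g : G, ∀ u ∈ (P : Subgroup G), g⁻¹ * u * g ∈ E := by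
  let Q : Sylow p E := default
  have hp : IsPGroup p ((Q : Subgroup E).map E.subtype) := Q.2.map _
  have hidx : ¬ p ∣ ((Q : Subgroup E).map E.subtype).index := by
    rw [Subgroup.index_map_subtype]
    intro h
    rcases (Nat.Prime.dvd_mul Fact.out).1 h with h | h
    · exact Q.not_dvd_index h
    · exact hE h
  obtain ⟨g, hg⟩ := MulAction.exists_smul_eq G (hp.toSylow hidx) P
  refine ⟨g, fun u hu => ?_⟩
  rw [← hg, Sylow.coe_subgroup_smul, Subgroup.mem_pointwise_smul_iff_inv_smul_mem] at hu
  have hu' : g⁻¹ * u * g ∈ (Q : Subgroup E).map E.subtype := by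
    simpa [MulAut.smul_def] using hu
  obtain ⟨x, _, hx⟩ := Subgroup.mem_map.1 hu'
  rw [← hx]; exact x.2

lemma card_E : 288 ≤ Nat.card E := by
  let f : (ZMod 3 × ZMod 3) × W 2 → E := fun x =>
    ⟨⟨Multiplicative.ofAdd (0, x.1), x.2⟩, by
      show phi _ = _
      apply SemidirectProduct.ext
      · show Multiplicative.ofAdd (((2 : ZMod 5 × ZMod 5) * 0, x.1) : V0) = Multiplicative.ofAdd (0, x.1)
        simp
      · rfl⟩
  have hf : Function.Injective f := by
    rintro ⟨d, s⟩ ⟨d', s'⟩ h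
    have h1 : (Multiplicative.ofAdd ((0, d) : V0)) = Multiplicative.ofAdd ((0, d') : V0) :=
      congrArg (fun x : E => x.1.left) h
    have h2 : s = s' := congrArg (fun x : E => x.1.right) h
    have h3 := congrArg Prod.snd (Multiplicative.ofAdd.injective h1)
    exact Prod.ext h3 h2
  have := Nat.card_le_card_of_injective f hf
  rw [Nat.card_prod, card_W] at this
  simpa using this

lemma index_E : E.index ∣ 25 := by
  have h1 := E.card_mul_index
  have h2 := card_E
  rw [card_H] at h1
  -- the range of `W 2` and `D` gives 288 dividing the order
  have h3 : E.index ≤ 25 := by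
    by_contra h
    push Not at h
    nlinarith
  have h4 : 25 ∣ E.index := by
    have : Function.Injective (fun m : ZMod 5 × ZMod 5 =>
        (QuotientGroup.mk (s := E) (SemidirectProduct.inl (Multiplicative.ofAdd ((m, 0) : V0)) : H))) := by
      intro m m' h
      have h5 := QuotientGroup.eq.1 h
      rw [← map_inv, ← map_mul] at h5
      change phi _ = _ at h5
      have h6 := congrArg (fun x : H => (Multiplicative.toAdd x.left).1) h5
      change (2 : ZMod 5 × ZMod 5) * (-m + m') = -m + m' at h6
      rw [two_mul] at h6
      have h7 := add_eq_left.1 h6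
      exact (neg_add_eq_zero.1 h7)
    have h8 := Nat.card_le_card_of_injective _ this
    change _ ≤ E.index at h8
    have h9 : E.index = 25 := le_antisymm h3 (by simpa using h8)
    rw [h9]
  exact (Nat.dvd_antisymm h4 (by
    obtain ⟨c, hc⟩ := h4
    have : c ≠ 0 := by rintro rfl; simp [hc] at h1
    have : c = 1 := by omega
    rw [hc, this])) ▸ dvd_rfl

lemma phi_col : IsColeman phi := by
  intro p hp P
  have : Fact p.Prime := ⟨hp⟩
  by_cases h5 : p = 5
  · subst h5
    refine ⟨(SemidirectProduct.inr (mkW 1 1 0))⁻¹, ?_⟩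
    intro u hu
    obtain ⟨k, hk⟩ := P.2 ⟨u, hu⟩
    have hk' : u ^ 5 ^ k = 1 := congrArg Subtype.val hk
    have hs : u.right = 1 := by
      have e1 : u.right ^ 5 ^ k = 1 := by
        have := congrArg (SemidirectProduct.rightHom) hk'
        rwa [map_pow, map_one] at this
      have e2 : u.right ^ 32 = 1 := by rw [← card_W]; exact pow_card_eq_one'
      have := pow_gcd_eq_one.2 ⟨e1, e2⟩
      rw [Nat.Coprime.gcd_eq_one (Nat.Coprime.pow_left k (by norm_num)), pow_one] at this
      exact this
    obtain ⟨v, s⟩ := u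
    change s = 1 at hs
    subst hs
    have hv : v ^ 5 ^ k = 1 := by
      have : (SemidirectProduct.inl v : H) ^ 5 ^ k = 1 := hk'
      rw [← map_pow] at this
      exact (SemidirectProduct.inl_injective (by rw [this, map_one]))
    have hd : (Multiplicative.toAdd v).2 = 0 := by
      have e1 : (5 ^ k) • (Multiplicative.toAdd v).2 = 0 :=
        congrArg (fun x : V => (Multiplicative.toAdd x).2) hv
      have e2 : 3 • (Multiplicative.toAdd v).2 = 0 := by
        generalize (Multiplicative.toAdd v).2 = d; revert d; decide
      have e3 : addOrderOf (Multiplicative.toAdd v).2 ∣ Nat.gcd (5 ^ k) 3 :=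
        Nat.dvd_gcd (addOrderOf_dvd_of_nsmul_eq_zero e1) (addOrderOf_dvd_of_nsmul_eq_zero e2)
      rw [Nat.Coprime.gcd_eq_one (Nat.Coprime.pow_left k (by norm_num)), Nat.dvd_one] at e3
      exact AddMonoid.addOrderOf_eq_one_iff.1 e3
    rw [inv_inv, eq_mul_inv_iff_mul_eq]
    apply SemidirectProduct.ext
    · show Multiplicative.ofAdd (dbl (Multiplicative.toAdd v) + actV 1 0) =
        Multiplicative.ofAdd (0 + actV (mkW 1 1 0) (Multiplicative.toAdd v))
      rw [actV_one, add_zero, zero_add]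
      congr 1
      obtain ⟨m, d⟩ := v
      change d = 0 at hd
      subst hd
      show ((2 * m, 0) : V0) = (actM 1 1 0 m, Jp (del 1 1 0) 0)
      rw [actM_oo]; rfl
    · show 1 * mkW 1 1 0 = mkW 1 1 0 * 1
      simp
  · have hE : ¬ p ∣ E.index := by
      intro h
      have h1 : p ∣ 5 ^ 2 := h.trans index_E
      exact h5 ((Nat.prime_dvd_prime_iff_eq hp (by norm_num)).1 (hp.dvd_of_dvd_pow h1))
    obtain ⟨g, hg⟩ := sylow_conj_le E hE P
    refine ⟨g * (phi g)⁻¹, fun u hu => ?_⟩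
    have h1 : phi (g⁻¹ * u * g) = g⁻¹ * u * g := hg u hu
    rw [map_mul, map_mul, map_inv] at h1
    have h2 : phi u = phi g * (g⁻¹ * u * g) * (phi g)⁻¹ := by rw [← h1]; group
    rw [h2]; group

lemma wreathed : HasWreathedSylow2 H := by
  refine ⟨2, le_rfl, fun P => ?_⟩
  let f : W 2 →* H := SemidirectProduct.inr
  have hf : Function.Injective f := SemidirectProduct.inr_injective
  have hc : Nat.card f.range = 2 ^ (Nat.card H).factorization 2 := by
    rw [← Nat.card_congr (MonoidHom.ofInjective hf).toEquiv, card_W, card_H]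
    have : Nat.factorization 7200 2 = 5 := by
      rw [show 7200 = 2 ^ 5 * 225 by norm_num, Nat.factorization_mul (by norm_num) (by norm_num),
        Nat.prime_two.factorization_pow]
      simp [Nat.factorization_eq_zero_of_not_dvd (show ¬ 2 ∣ 225 by norm_num)]
    rw [this]
    norm_num
  have : Fact (Nat.Prime 2) := ⟨Nat.prime_two⟩
  exact ⟨(Sylow.equiv P (Sylow.ofCard f.range hc)).trans (MonoidHom.ofInjective hf).symm⟩

lemma not_odd : ¬ Odd (Nat.card ↥(outC H ⊓ outCol H)) := by
  intro h
  let q : ↥(outC H ⊓ outCol H) := ⟨QuotientGroup.mk' (innAut H) phi,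
    ⟨phi, phi_cp, rfl⟩, ⟨phi, phi_col, rfl⟩⟩
  have h1 : q ^ Nat.card ↥(outC H ⊓ outCol H) = 1 := pow_card_eq_one'
  have hphi : phi ^ 4 = 1 := by
    refine MulEquiv.ext fun x => ?_
    show phi (phi (phi (phi x))) = x
    apply SemidirectProduct.ext
    · show Multiplicative.ofAdd (dbl (dbl (dbl (dbl (Multiplicative.toAdd x.left))))) = x.left
      have : ∀ v : V0, dbl (dbl (dbl (dbl v))) = v := by
        rintro ⟨m, d⟩
        have : ∀ m : ZMod 5 × ZMod 5, 2 * (2 * (2 * (2 * m))) = m := by decide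
        simp [dbl, this]
      rw [this]; rfl
    · rfl
  have h2 : q ^ 4 = 1 := by
    apply Subtype.ext
    show (QuotientGroup.mk' (innAut H) phi) ^ 4 = 1
    rw [← map_pow, hphi, map_one]
  have h3 := pow_gcd_eq_one.2 ⟨h1, h2⟩
  have h5 : Nat.gcd (Nat.card ↥(outC H ⊓ outCol H)) 4 = 1 := by
    have := (Nat.coprime_two_right.2 h).pow_right 2
    exact this
  rw [h5, pow_one] at h3
  have h4 : QuotientGroup.mk' (innAut H) phi = 1 := congrArg Subtype.val h3
  obtain ⟨g, hg⟩ := (QuotientGroup.eq_one_iff _).1 h4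
  exact inner_out g hg.symm

/-- the bound on the order of a minimal counterexample -/
theorem bound {G : Type} [Group G] [Finite G]
    (hmin : ∀ (H : Type) [Group H] [Finite H], Nat.card H < Nat.card G →
      HasWreathedSylow2 H → Odd (Nat.card ↥(outC H ⊓ outCol H))) : Nat.card G ≤ 7200 := by
  by_contra h
  push Not at h
  exact not_odd (hmin H (by rw [card_H]; exact h) wreathed)

end Hzero

namespace WSn

/-- the data of a wreathed 2-group inside a group -/
structure WS {G : Type*} [Group G] (S : Subgroup G) (n : ℕ) (w w' t : G) : Prop where
  hn : 2 ≤ n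
  hw : w ∈ S
  ht : t ∈ S
  tt : t * t = 1
  tw : t * w = w' * t
  cww : Commute w w'
  form : ∀ s ∈ S, ∃ x y : ℤ, s = w ^ x * w' ^ y ∨ s = w ^ x * w' ^ y * t
  eq1 : ∀ x y : ℤ, w ^ x * w' ^ y = 1 ↔ (2 ^ n : ℤ) ∣ x ∧ (2 ^ n : ℤ) ∣ y
  net : ∀ x y : ℤ, w ^ x * w' ^ y * t ≠ 1

/-- general element of the base group -/
def El {G : Type*} [Group G] (w w' : G) (x y : ℤ) : G := w ^ x * w' ^ y

open Wreathed in
lemma W_exists {G : Type*} [Group G] (S : Subgroup G) (n : ℕ) (hn : 2 ≤ n) (e : S ≃* W n) :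
    ∃ w w' t : G, WS S n w w' t := by
  have hpow : ∀ x : ℤ, (Multiplicative.ofAdd (1 : ZMod (2^n))) ^ x = Multiplicative.ofAdd (x : ZMod (2^n)) := by
    intro x
    rw [← ofAdd_zsmul]; simp
  have hab : ∀ x y : ℤ, a n ^ x * b n ^ y = SemidirectProduct.inl
      (Multiplicative.ofAdd (x : ZMod (2^n)), Multiplicative.ofAdd (y : ZMod (2^n))) := by
    intro x y
    rw [a, b, ← map_zpow, ← map_zpow, ← map_mul]
    congr 1
    simp only [Prod.pow_mk, one_zpow, Prod.mk_mul_mk, mul_one, one_mul, hpow]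
  have key : ∀ x y : ℤ, a n ^ x * b n ^ y = 1 ↔ (2 ^ n : ℤ) ∣ x ∧ (2 ^ n : ℤ) ∣ y := by
    intro x y
    rw [hab]
    have : (1 : W n) = SemidirectProduct.inl 1 := by simp
    rw [this, SemidirectProduct.inl_inj, Prod.mk_eq_one, ofAdd_eq_one, ofAdd_eq_one,
      ZMod.intCast_zmod_eq_zero_iff_dvd, ZMod.intCast_zmod_eq_zero_iff_dvd]
    simp
  have htw : t n * a n = b n * t n := by
    apply SemidirectProduct.ext
    · rw [SemidirectProduct.mul_left, SemidirectProduct.mul_left]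
      have : (act n) (Multiplicative.ofAdd 1) (Multiplicative.ofAdd (1 : ZMod (2^n)), 1) =
        (1, Multiplicative.ofAdd (1 : ZMod (2^n))) := rfl
      simp [t, a, b, this]
    · rfl
  have htt : t n * t n = 1 := by
    rw [t, ← map_mul]
    have : (Multiplicative.ofAdd 1 : Multiplicative (ZMod 2)) * Multiplicative.ofAdd 1 = 1 := by decide
    rw [this, map_one]
  have hc : a n * b n = b n * a n := by
    rw [a, b, ← map_mul, ← map_mul, mul_comm]
  have hform : ∀ s : W n, ∃ x y : ℤ, s = a n ^ x * b n ^ y ∨ s = a n ^ x * b n ^ y * t n := by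
    intro s
    obtain ⟨x, hx⟩ := ZMod.intCast_surjective (Multiplicative.toAdd s.left.1)
    obtain ⟨y, hy⟩ := ZMod.intCast_surjective (Multiplicative.toAdd s.left.2)
    refine ⟨x, y, ?_⟩
    rw [hab, hx, hy]
    rcases two_cases s.right with h | h
    · left
      apply SemidirectProduct.ext
      · rfl
      · rw [h]; rfl
    · right
      apply SemidirectProduct.ext
      · simp [t]
      · rw [h]; rfl
  have hnet : ∀ x y : ℤ, a n ^ x * b n ^ y * t n ≠ 1 := by
    intro x y h
    rw [hab] at h
    have := congrArg SemidirectProduct.right h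
    simp [t] at this
  let f : W n →* G := S.subtype.comp e.symm.toMonoidHom
  have hf : Function.Injective f := fun p q h => e.symm.injective (Subtype.ext h)
  refine ⟨f (a n), f (b n), f (t n), hn, (e.symm (a n)).2, (e.symm (t n)).2, ?_, ?_, ?_, ?_, ?_, ?_⟩
  · rw [← map_mul, htt, map_one]
  · rw [← map_mul, htw, map_mul]
  · show _ * _ = _ * _
    rw [← map_mul, hc, map_mul]
  · intro s hs
    obtain ⟨x, y, h⟩ := hform (e ⟨s, hs⟩)
    have hs' : s = f (e ⟨s, hs⟩) := by simp [f]
    refine ⟨x, y, ?_⟩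
    rw [hs']
    rcases h with h | h
    · left; rw [h]; simp
    · right; rw [h]; simp
  · intro x y
    rw [← key, ← map_zpow, ← map_zpow, ← map_mul]
    exact map_eq_one_iff f hf
  · intro x y
    rw [← map_zpow, ← map_zpow, ← map_mul, ← map_mul]
    exact fun h => hnet x y ((map_eq_one_iff f hf).1 h)

section
variable {G : Type*} [Group G] {S : Subgroup G} {n : ℕ} {w w' t : G} (h : WS S n w w' t)
include h

lemma tinv : t⁻¹ = t := inv_eq_of_mul_eq_one_left h.tt

lemma tw' : t * w' = w * t := by
  have h1 := h.tw
  have h2 := h.tt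
  have : w' = t * w * t := by rw [h1, mul_assoc, h2, mul_one]
  rw [this, ← mul_assoc, ← mul_assoc, h2, one_mul]

lemma w'_eq : w' = t * w * t⁻¹ := by
  rw [h.tw]; group

lemma hw' : w' ∈ S := by
  rw [w'_eq h]; exact S.mul_mem (S.mul_mem h.ht h.hw) (S.inv_mem h.ht)

lemma El_mem (x y : ℤ) : El w w' x y ∈ S :=
  S.mul_mem (S.zpow_mem h.hw _) (S.zpow_mem (hw' h) _)

lemma El_mul (x y x' y' : ℤ) : El w w' x y * El w w' x' y' = El w w' (x + x') (y + y') := by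
  unfold El
  rw [zpow_add, zpow_add]
  exact Commute.mul_mul_mul_comm ((h.cww.symm.zpow_right _).zpow_left _) _ _

omit h in
lemma El_zero : El w w' 0 0 = 1 := by simp [El]

lemma El_inv (x y : ℤ) : (El w w' x y)⁻¹ = El w w' (-x) (-y) := by
  rw [inv_eq_iff_mul_eq_one, El_mul h]; simp [El]

lemma El_zpow (x y k : ℤ) : (El w w' x y) ^ k = El w w' (k * x) (k * y) := by
  unfold El
  rw [((h.cww.zpow_right _).zpow_left _).mul_zpow, ← zpow_mul, ← zpow_mul, mul_comm, mul_comm y]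

lemma t_El (x y : ℤ) : t * El w w' x y = El w w' y x * t := by
  unfold El
  have h1 : ∀ x : ℤ, t * w ^ x = w' ^ x * t := fun x => (SemiconjBy.zpow_right (h.tw : SemiconjBy t w w') x)
  have h2 : ∀ x : ℤ, t * w' ^ x = w ^ x * t := fun x => (SemiconjBy.zpow_right (tw' h : SemiconjBy t w' w) x)
  rw [← mul_assoc, h1, mul_assoc, h2, ← mul_assoc, ((h.cww.symm.zpow_right _).zpow_left _).eq]

lemma El_eq_one (x y : ℤ) : El w w' x y = 1 ↔ (2 ^ n : ℤ) ∣ x ∧ (2 ^ n : ℤ) ∣ y := h.eq1 x y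

lemma El_inj (x y x' y' : ℤ) : El w w' x y = El w w' x' y' ↔ (2 ^ n : ℤ) ∣ x - x' ∧ (2 ^ n : ℤ) ∣ y - y' := by
  rw [← El_eq_one h, ← mul_inv_eq_one, El_inv h, El_mul h, sub_eq_add_neg, sub_eq_add_neg]

lemma El_ne (x y x' y' : ℤ) : El w w' x y * t ≠ El w w' x' y' := by
  intro hh
  apply h.net (-x' + x) (-y' + y)
  show El w w' _ _ * t = 1
  rw [← El_mul h, mul_assoc, hh, ← El_inv h, inv_mul_cancel]

lemma El_comm (x y x' y' : ℤ) : Commute (El w w' x y) (El w w' x' y') := by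
  show _ * _ = _ * _
  rw [El_mul h, El_mul h, add_comm, add_comm y]

lemma z_comm (x : ℤ) {s : G} (hs : s ∈ S) : Commute (El w w' x x) s := by
  obtain ⟨a, b, hs | hs⟩ := h.form s hs
  · rw [hs]; exact El_comm h _ _ _ _
  · rw [hs]; exact (El_comm h _ _ _ _).mul_right (t_El h x x).symm

/-- elements commuting with a noncentral element of the base lie in the base -/
lemma cent_base {x y : ℤ} (hxy : ¬ (2 ^ n : ℤ) ∣ x - y) {s : G} (hs : s ∈ S)
    (hc : Commute s (El w w' x y)) : ∃ a b, s = El w w' a b := by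
  obtain ⟨a, b, hs | hs⟩ := h.form s hs
  · exact ⟨a, b, hs⟩
  · exfalso
    rw [hs] at hc
    have h1 : El w w' a b * t * El w w' x y = El w w' x y * (El w w' a b * t) := hc
    rw [mul_assoc, t_El h, ← mul_assoc, ← mul_assoc, El_mul h, El_mul h] at h1
    have := ((El_inj h _ _ _ _).1 (mul_right_cancel h1)).1
    apply hxy
    obtain ⟨c, hc⟩ := this
    exact ⟨-c, by linarith⟩

lemma comm_t_iff (a b : ℤ) {x y : ℤ} (hc : Commute (El w w' a b) (El w w' x y * t)) : (2 ^ n : ℤ) ∣ a - b := by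
  have h1 : El w w' a b * (El w w' x y * t) = (El w w' x y * t) * El w w' a b := hc
  rw [mul_assoc, t_El h, ← mul_assoc, ← mul_assoc, El_mul h, El_mul h] at h1
  have := ((El_inj h _ _ _ _).1 (mul_right_cancel h1)).1
  obtain ⟨c, hc⟩ := this
  exact ⟨c, by linarith⟩

lemma El_diag {a b : ℤ} (hd : (2 ^ n : ℤ) ∣ a - b) : El w w' a b = El w w' b b := by
  rw [El_inj h]; simpa using hd

lemma cent_t {x y : ℤ} {s : G} (hs : s ∈ S) (hc : Commute s (El w w' x y * t)) :
    ∃ m, s = El w w' m m ∨ s = El w w' m m * (El w w' x y * t) := by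
  obtain ⟨a, b, hs | hs⟩ := h.form s hs
  · refine ⟨b, Or.inl ?_⟩
    rw [hs] at hc ⊢
    exact El_diag h (comm_t_iff h a b hc)
  · have h2 : s = El w w' (a - x) (b - y) * (El w w' x y * t) := by
      rw [hs, ← mul_assoc, El_mul h]; unfold El; simp
    refine ⟨b - y, Or.inr ?_⟩
    have h3 : Commute (El w w' (a - x) (b - y)) (El w w' x y * t) := by
      have : El w w' (a - x) (b - y) = s * (El w w' x y * t)⁻¹ := by rw [h2]; group
      rw [this]
      exact hc.mul_left (Commute.inv_left (Commute.refl _))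
    rw [h2, El_diag h (comm_t_iff h _ _ h3)]

lemma form' {s : G} (hs : s ∈ S) : (∃ x y : ℤ, s = El w w' x y) ∨ ∃ x y : ℤ, s = El w w' x y * t := by
  obtain ⟨x, y, h1 | h1⟩ := h.form s hs
  · exact Or.inl ⟨x, y, h1⟩
  · exact Or.inr ⟨x, y, h1⟩

/-- elements centralizing S inside S -/
lemma center_form {s : G} (hs : s ∈ S) (hc : ∀ u ∈ S, Commute s u) : ∃ m, s = El w w' m m := by
  have h1 : Commute s (El w w' 1 0) := hc _ (El_mem h _ _)
  have h2 : ¬ (2 ^ n : ℤ) ∣ 1 - 0 := by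
    intro h3
    have := Int.le_of_dvd (by norm_num) h3
    have h4 : (1:ℤ) < 2 ^ n := one_lt_pow₀ (by norm_num) (by have := h.hn; omega)
    omega
  obtain ⟨a, b, rfl⟩ := cent_base h h2 hs h1
  refine ⟨b, El_diag h (comm_t_iff h a b (x := 0) (y := 0) ?_)⟩
  rw [El_zero, one_mul]; exact hc _ h.ht

end
end WSn

namespace WSn
open Subgroup

section basic
variable {G : Type*} [Group G]

lemma mem_of_coprime (H : Subgroup G) {x : G} {a b : ℕ} (hab : Nat.Coprime a b) (ha : x ^ a ∈ H)
    (hb : x ^ b ∈ H) : x ∈ H := by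
  have h := Nat.gcd_eq_gcd_ab a b
  rw [hab.gcd_eq_one] at h
  have : x = (x ^ a) ^ (Nat.gcdA a b) * (x ^ b) ^ (Nat.gcdB a b) := by
    rw [← zpow_natCast, ← zpow_natCast, ← zpow_mul, ← zpow_mul, ← zpow_add, ← h]; simp
  rw [this]
  exact H.mul_mem (H.zpow_mem ha _) (H.zpow_mem hb _)

lemma mem_of_odd_pow2 (H : Subgroup G) {x : G} (hx : Odd (orderOf x)) {k : ℕ} (h : x ^ 2 ^ k ∈ H) : x ∈ H :=
  mem_of_coprime H (a := 2 ^ k) (b := orderOf x) ((Nat.coprime_two_left.2 hx).pow_left k) h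
    (by rw [pow_orderOf_eq_one]; exact H.one_mem)

/-- splitting exponents -/
lemma split2 (x : G) [Finite G] : ∃ k m : ℕ, Odd m ∧ (x ^ 2 ^ k) ^ m = 1 ∧ (x ^ m) ^ 2 ^ k = 1 := by
  obtain ⟨k, m, hm, h⟩ := Nat.exists_eq_two_pow_mul_odd (n := orderOf x) (orderOf_pos x).ne'
  refine ⟨k, m, hm, ?_, ?_⟩
  · rw [← pow_mul, ← h, pow_orderOf_eq_one]
  · rw [← pow_mul, mul_comm, ← h, pow_orderOf_eq_one]

lemma odd_of_pow {x : G} {m : ℕ} (hm : Odd m) (h : x ^ m = 1) : Odd (orderOf x) :=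
  Odd.of_dvd_nat hm (orderOf_dvd_of_pow_eq_one h)

lemma numq {n : ℕ} {d : ℤ} (hn : 1 ≤ n) (hd : ¬ (2 ^ n : ℤ) ∣ d) : ∃ q : ℤ, (2 ^ n : ℤ) ∣ q * d - 2 ^ (n - 1) := by
  have h1 : Int.gcd d (2 ^ n) ∣ 2 ^ n := by
    have := Int.gcd_dvd_natAbs_right d (2 ^ n)
    simpa [Int.natAbs_pow] using this
  obtain ⟨j, hj, hg⟩ := (Nat.dvd_prime_pow Nat.prime_two).1 h1
  have hjn : j ≠ n := by
    rintro rfl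
    apply hd
    have := Int.gcd_dvd_left d (2 ^ j)
    rw [hg] at this
    simpa using this
  have h2 : Int.gcd d (2 ^ n) ∣ 2 ^ (n - 1) := by
    rw [hg]
    exact pow_dvd_pow 2 (by omega)
  obtain ⟨x, y, h⟩ := Int.gcd_dvd_iff.1 h2
  push_cast at h
  exact ⟨x, -y, by rw [h]; ring⟩

/-- an odd order element normalizing an abelian 2-group and fixing involutions centralizes it -/
lemma odd_fix {u : G} (hu : Odd (orderOf u)) (T : Subgroup G) (hab : ∀ a ∈ T, ∀ b ∈ T, a * b = b * a)
    (hnorm : ∀ a ∈ T, u * a * u⁻¹ ∈ T)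
    (hinv : ∀ a ∈ T, a * a = 1 → u * a * u⁻¹ = a) :
    ∀ k : ℕ, ∀ a ∈ T, a ^ 2 ^ k = 1 → u * a * u⁻¹ = a := by
  intro k
  induction k with
  | zero => intro a ha h; rw [pow_zero, pow_one] at h; subst h; group
  | succ k ih =>
    intro a ha h
    have h1 := ih (a * a) (T.mul_mem ha ha) (by rw [← pow_two, ← pow_mul, ← pow_succ']; exact h)
    set δ := u * a * u⁻¹ * a⁻¹ with hδ
    have hδT : δ ∈ T := T.mul_mem (hnorm a ha) (T.inv_mem ha)
    have h2 : δ * δ = 1 := by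
      have hc := hab _ (T.inv_mem ha) _ (hnorm a ha)
      calc δ * δ = u * a * u⁻¹ * (a⁻¹ * (u * a * u⁻¹)) * a⁻¹ := by rw [hδ]; group
        _ = (u * (a * a) * u⁻¹) * a⁻¹ * a⁻¹ := by rw [hc]; group
        _ = 1 := by rw [h1]; group
    have h3 := hinv δ hδT h2
    have h4 : u * a * u⁻¹ = δ * a := by rw [hδ]; group
    have h5 : ∀ j : ℕ, u ^ j * a * (u ^ j)⁻¹ = δ ^ j * a := by
      intro j
      induction j with
      | zero => simp
      | succ j ihj =>
        calc u ^ (j+1) * a * (u ^ (j+1))⁻¹ = u * (u ^ j * a * (u ^ j)⁻¹) * u⁻¹ := by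
              rw [pow_succ']; group
          _ = (u * δ * u⁻¹) ^ j * (u * a * u⁻¹) := by rw [ihj, conj_pow]; group
          _ = _ := by rw [h3, h4, ← mul_assoc, ← pow_succ]
    have h6 := h5 (orderOf u)
    rw [pow_orderOf_eq_one] at h6
    have h7 : δ ^ orderOf u = 1 := by
      have : 1 * a = δ ^ orderOf u * a := by rw [← h6]; simp
      exact (mul_right_cancel this).symm
    obtain ⟨l, hl⟩ := hu
    rw [hl, pow_succ, pow_mul, pow_two, h2, one_pow, one_mul] at h7
    rw [h4, h7, one_mul]

end basic

section step1
variable {G : Type*} [Group G] {S : Subgroup G} {n : ℕ} {w w' t : G} (h : WS S n w w' t)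
include h

lemma exists_r (N : Subgroup G) [hN : N.Normal] (hNS : N ≤ S) (hnc : ¬ N ≤ centralizer (S : Set G)) :
    ∃ x y, El w w' x y ∈ N ∧ ¬ (2 ^ n : ℤ) ∣ x - y := by
  by_cases hA : ∃ x y, El w w' x y * t ∈ N
  · obtain ⟨x, y, hs⟩ := hA
    refine ⟨1, -1, ?_, ?_⟩
    · have h1 : El w w' 1 0 * (El w w' x y * t) * (El w w' 1 0)⁻¹ * (El w w' x y * t)⁻¹ ∈ N :=
        N.mul_mem (hN.conj_mem _ hs _) (N.inv_mem hs)
      have h2 : El w w' 1 0 * (El w w' x y * t) * (El w w' 1 0)⁻¹ = El w w' 1 (-1) * (El w w' x y * t) := by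
        rw [mul_assoc, mul_assoc, El_inv h, t_El h]
        simp only [← mul_assoc, El_mul h]
        congr 2 <;> ring
      rw [h2, mul_inv_cancel_right] at h1
      exact h1
    · intro hd
      have h1 := Int.le_of_dvd (by norm_num) hd
      have h4 : (2:ℤ) ^ 2 ≤ 2 ^ n := pow_le_pow_right₀ (by norm_num) h.hn
      norm_num at h1 h4
      omega
  · by_contra hcon
    push Not at hcon hA
    apply hnc
    intro s hs
    rw [mem_centralizer_iff]
    intro u hu
    rcases form' h (hNS hs) with ⟨x, y, rfl⟩ | ⟨x, y, rfl⟩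
    · rw [El_diag h (hcon x y hs)]
      exact (z_comm h _ hu).symm
    · exact absurd hs (hA x y)

lemma exists_c (N : Subgroup G) [hN : N.Normal] {x y : ℤ} (hr : El w w' x y ∈ N) (hd : ¬ (2 ^ n : ℤ) ∣ x - y) :
    El w w' (2 ^ (n-1)) (2 ^ (n-1)) ∈ N ∧ ∃ m, El w w' (m + 2 ^ (n-1)) m ∈ N := by
  obtain ⟨q, hq⟩ := numq (by have := h.hn; omega) hd
  have hn2 : (2:ℤ) ^ n = 2 * 2 ^ (n-1) := by
    rw [← pow_succ']; congr 1; have := h.hn; omega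
  constructor
  · have h1 : t * El w w' x y * t⁻¹ ∈ N := hN.conj_mem _ hr _
    rw [t_El h, mul_inv_cancel_right] at h1
    have h2 : El w w' x y * (El w w' y x)⁻¹ ∈ N := N.mul_mem hr (N.inv_mem h1)
    have h3 := N.zpow_mem h2 q
    rw [El_inv h, El_mul h, El_zpow h] at h3
    have : El w w' (q * (x + -y)) (q * (y + -x)) = El w w' (2 ^ (n-1)) (2 ^ (n-1)) := by
      rw [El_inj h]
      constructor
      · convert hq using 1; ring
      · obtain ⟨c, hc⟩ := hq
        exact ⟨-c - 1, by rw [hn2] at hc ⊢; linarith⟩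
    rwa [this] at h3
  · refine ⟨q * y, ?_⟩
    have h3 := N.zpow_mem hr q
    rw [El_zpow h] at h3
    have : El w w' (q * x) (q * y) = El w w' (q * y + 2 ^ (n-1)) (q * y) := by
      rw [El_inj h]
      refine ⟨?_, by simp⟩
      obtain ⟨c, hc⟩ := hq
      exact ⟨c, by linarith⟩
    rwa [this] at h3

lemma half_cases {a : ℤ} (ha : (2 ^ n : ℤ) ∣ 2 * a) : (2 ^ n : ℤ) ∣ a ∨ (2 ^ n : ℤ) ∣ a - 2 ^ (n-1) := by
  have hn2 : (2:ℤ) ^ n = 2 * 2 ^ (n-1) := by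
    rw [← pow_succ']; congr 1; have := h.hn; omega
  rw [hn2] at ha ⊢
  obtain ⟨b, rfl⟩ := (mul_dvd_mul_iff_left (by norm_num)).1 ha
  rcases Int.even_or_odd b with ⟨c, hc⟩ | ⟨c, hc⟩
  · left; exact ⟨c, by rw [hc]; ring⟩
  · right; exact ⟨c, by rw [hc]; ring⟩

/-- involutions of the base -/
lemma invol_base {a b : ℤ} (hab : El w w' a b * El w w' a b = 1) :
    El w w' a b = 1 ∨ El w w' a b = El w w' (2 ^ (n-1)) (2 ^ (n-1)) ∨
      El w w' a b = El w w' (2 ^ (n-1)) 0 ∨ El w w' a b = El w w' 0 (2 ^ (n-1)) := by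
  rw [El_mul h, El_eq_one h, ← two_mul, ← two_mul] at hab
  rw [El_eq_one h, El_inj h, El_inj h, El_inj h, sub_zero, sub_zero]
  rcases half_cases h hab.1 with h1 | h1 <;> rcases half_cases h hab.2 with h2 | h2
  · exact Or.inl ⟨h1, h2⟩
  · exact Or.inr (Or.inr (Or.inr ⟨h1, h2⟩))
  · exact Or.inr (Or.inr (Or.inl ⟨h1, h2⟩))
  · exact Or.inr (Or.inl ⟨h1, h2⟩)

end step1

/-- the odd core of the centralizer -/
structure IsK {G : Type*} [Group G] (N K : Subgroup G) : Prop where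
  normal : K.Normal
  odd : Odd (Nat.card K)
  le : K ≤ centralizer (N : Set G)
  all : ∀ x ∈ centralizer (N : Set G), Odd (orderOf x) → x ∈ K
  two : ∀ x ∈ centralizer (N : Set G), ∃ k : ℕ, x ^ 2 ^ k ∈ K

lemma not_central_all {G : Type*} [Group G] [Finite G] (S : Sylow 2 G) (N : Subgroup G) [hN : N.Normal]
    (hnc : ¬ N ≤ centralizer ((S : Subgroup G) : Set G)) (Q : Sylow 2 G) :
    ¬ N ≤ centralizer ((Q : Subgroup G) : Set G) := by
  intro hle
  apply hnc
  obtain ⟨g, hg⟩ := MulAction.exists_smul_eq G S Q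
  intro x hx
  rw [mem_centralizer_iff]
  intro s hs
  have h1 : g * s * g⁻¹ ∈ (Q : Subgroup G) := by
    rw [← hg]
    exact Subgroup.smul_mem_pointwise_smul s (MulAut.conj g) _ hs
  have h2 := mem_centralizer_iff.1 (hle (hN.conj_mem x hx g)) _ h1
  have h3 : g * (s * x) * g⁻¹ = g * (x * s) * g⁻¹ := by
    calc _ = g * s * g⁻¹ * (g * x * g⁻¹) := by group
      _ = _ := h2
      _ = _ := by group
  simpa using h3

theorem exists_K {G : Type*} [Group G] [Finite G] (n : ℕ) (hn : 2 ≤ n)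
    (hW : ∀ P : Sylow 2 G, Nonempty ((P : Subgroup G) ≃* Wreathed.W n))
    (S : Sylow 2 G) (N : Subgroup G) [hN : N.Normal] (hN2 : IsPGroup 2 N)
    (hnc : ¬ N ≤ centralizer ((S : Subgroup G) : Set G)) : ∃ K : Subgroup G, IsK N K := by
  set C := centralizer (N : Set G) with hC
  obtain ⟨T⟩ : Nonempty (Sylow 2 C) := inferInstance
  obtain ⟨Q, hQ⟩ := T.exists_comap_subtype_eq
  obtain ⟨e⟩ := hW Q
  obtain ⟨w, w', t, h⟩ := W_exists (Q : Subgroup G) n hn e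
  obtain ⟨x, y, hr, hd⟩ := exists_r h N (hN2.le_sylow_of_normal Q) (not_central_all S N hnc Q)
  obtain ⟨hcN, -⟩ := exists_c h N hr hd
  have hcomm : ∀ a ∈ C, ∀ b ∈ N, b * a = a * b := fun a ha b hb => mem_centralizer_iff.1 ha b hb
  have hT : ∀ a : C, a ∈ (T : Subgroup C) → ∃ p q, (a : G) = El w w' p q := by
    intro a ha
    rw [← hQ] at ha
    exact cent_base h hd ha (hcomm a a.2 _ hr).symm
  have hTab : ∀ a ∈ (T : Subgroup C), ∀ b ∈ (T : Subgroup C), a * b = b * a := by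
    intro a ha b hb
    obtain ⟨p, q, h1⟩ := hT a ha
    obtain ⟨p', q', h2⟩ := hT b hb
    apply Subtype.ext
    show (a : G) * b = b * a
    rw [h1, h2]
    exact El_comm h _ _ _ _
  have hcond : normalizer (T : Set C) ≤ centralizer (T : Set C) := by
    intro g hg
    obtain ⟨k, m, hm, h1, h2⟩ := split2 g
    refine mem_of_coprime _ (a := 2 ^ k) (b := m) ((Nat.coprime_two_left.2 hm).pow_left k) ?_ ?_
    · set u := g ^ 2 ^ k with hu
      have hun : u ∈ normalizer (T : Set C) := pow_mem hg _
      have huo : Odd (orderOf u) := odd_of_pow hm h1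
      have hnorm : ∀ a ∈ (T : Subgroup C), u * a * u⁻¹ ∈ (T : Subgroup C) := fun a ha =>
        (mem_normalizer_iff.1 hun a).1 ha
      have hinv : ∀ a ∈ (T : Subgroup C), a * a = 1 → u * a * u⁻¹ = a := by
        intro a ha haa
        by_contra hne
        set b := u * a * u⁻¹ with hb
        have hbT := hnorm a ha
        set d := u * b * u⁻¹ with hd'
        have hdT := hnorm b hbT
        have inv4 : ∀ a ∈ (T : Subgroup C), a * a = 1 → (a = 1 ∨ (a : G) = El w w' (2 ^ (n-1)) (2 ^ (n-1)) ∨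
            (a : G) = El w w' (2 ^ (n-1)) 0 ∨ (a : G) = El w w' 0 (2 ^ (n-1))) := by
          intro a ha haa
          obtain ⟨p, q, h1⟩ := hT a ha
          have := invol_base h (a := p) (b := q) (by rw [← h1]; exact congrArg Subtype.val haa)
          rw [← h1] at this
          rcases this with h3 | h3
          · left; exact Subtype.ext h3
          · right; exact h3
        have hbb : b * b = 1 := by
          calc b * b = u * (a * a) * u⁻¹ := by rw [hb]; group
            _ = 1 := by rw [haa]; group
        have hdd : d * d = 1 := by
          calc d * d = u * (b * b) * u⁻¹ := by rw [hd']; group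
            _ = 1 := by rw [hbb]; group
        have ha1 : a ≠ 1 := by rintro rfl; apply hne; rw [hb]; group
        have hb1 : b ≠ 1 := fun h3 => ha1 (conj_eq_one_iff.1 h3)
        have hd1 : d ≠ 1 := fun h3 => hb1 (conj_eq_one_iff.1 h3)
        have hfix : ∀ a : C, (a : G) = El w w' (2 ^ (n-1)) (2 ^ (n-1)) → u * a * u⁻¹ = a := by
          intro a ha
          apply Subtype.ext
          show (u : G) * a * (u : G)⁻¹ = a
          rw [ha, ← hcomm u u.2 _ hcN]; group
        have hac : (a : G) ≠ El w w' (2 ^ (n-1)) (2 ^ (n-1)) := fun h3 => hne (hfix a h3)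
        have hinj : ∀ p q : C, u * p * u⁻¹ = u * q * u⁻¹ → p = q := fun p q hpq => by simpa using hpq
        have hbc : (b : G) ≠ El w w' (2 ^ (n-1)) (2 ^ (n-1)) := fun h3 => by
          exact hne (hinj _ _ (hfix b h3))
        have hdc : (d : G) ≠ El w w' (2 ^ (n-1)) (2 ^ (n-1)) := fun h3 => by
          exact hne (hinj _ _ (hinj _ _ (hfix d h3)))
        have hdb : d ≠ b := fun h3 => hne (hinj _ _ h3)
        have hda : d = a := by
          have hab : (b : G) ≠ a := fun h3 => hne (Subtype.ext h3)
          have hdb' : (d : G) ≠ b := fun h3 => hdb (Subtype.ext h3)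
          rcases inv4 a ha haa with h3 | h3 | h3 | h3
          · exact absurd h3 ha1
          · exact absurd h3 hac
          all_goals
            rcases inv4 b hbT hbb with h4 | h4 | h4 | h4
            · exact absurd h4 hb1
            · exact absurd h4 hbc
            all_goals
              rcases inv4 d hdT hdd with h5 | h5 | h5 | h5
              · exact absurd h5 hd1
              · exact absurd h5 hdc
              all_goals first
                | exact absurd (h4.trans h3.symm) hab
                | exact absurd (h5.trans h4.symm) hdb'
                | exact Subtype.ext (h5.trans h3.symm)
        have hcm : u ^ 2 ^ 1 ∈ centralizer {a} := by
          rw [mem_centralizer_singleton_iff]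
          have : u * (u * a * u⁻¹) * u⁻¹ = a := hda
          calc u ^ 2 ^ 1 * a = (u * (u * a * u⁻¹) * u⁻¹) * u ^ 2 ^ 1 := by rw [pow_one, pow_two]; group
            _ = _ := by rw [this]
        have hcm2 := mem_of_odd_pow2 _ huo hcm
        rw [mem_centralizer_singleton_iff] at hcm2
        apply hne
        rw [hb, hcm2]; group
      rw [mem_centralizer_iff]
      intro a ha
      obtain ⟨j, hj⟩ := T.isPGroup' ⟨a, ha⟩
      have := odd_fix huo (T : Subgroup C) hTab hnorm hinv j a ha (congrArg Subtype.val hj)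
      calc a * u = (u * a * u⁻¹) * u := by rw [this]
        _ = u * a := by group
    · have hm1 : g ^ m ∈ (T : Subgroup C) := by
        have hp : IsPGroup 2 (zpowers (g ^ m)) := by
          obtain ⟨j, -, hj⟩ := (Nat.dvd_prime_pow Nat.prime_two).1 (orderOf_dvd_of_pow_eq_one h2)
          exact IsPGroup.of_card (n := j) (by rw [Nat.card_zpowers, hj])
        have h3 : g ^ m ∈ zpowers (g ^ m) ⊓ normalizer (T : Set C) :=
          ⟨mem_zpowers _, pow_mem hg _⟩
        have h4 := hp.inf_normalizer_sylow T
        rw [h4] at h3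
        exact h3.2
      rw [mem_centralizer_iff]
      intro a ha
      exact hTab a ha _ hm1
  let τ := MonoidHom.transferSylow T hcond
  have hodd : Odd (Nat.card τ.ker) := by
    rw [← Nat.not_even_iff_odd, even_iff_two_dvd]
    exact MonoidHom.not_dvd_card_ker_transferSylow T hcond
  have hτ2 : ∀ c : C, ∃ k : ℕ, c ^ 2 ^ k ∈ τ.ker := by
    intro c
    obtain ⟨k, hk⟩ := T.isPGroup' (τ c)
    exact ⟨k, by rw [MonoidHom.mem_ker, map_pow]; exact hk⟩
  have hall : ∀ x (hx : x ∈ C), Odd (orderOf x) → x ∈ τ.ker.map C.subtype := by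
    intro x hx hxo
    refine ⟨⟨x, hx⟩, ?_, rfl⟩
    obtain ⟨k, hk⟩ := hτ2 ⟨x, hx⟩
    exact mem_of_odd_pow2 _ (by rwa [← orderOf_mk x hx] at hxo) hk
  have hcard : Odd (Nat.card (τ.ker.map C.subtype)) := by
    rw [Nat.card_congr (equivMapOfInjective _ _ C.subtype_injective).toEquiv.symm]
    exact hodd
  have hle : τ.ker.map C.subtype ≤ C := by
    rintro _ ⟨c, -, rfl⟩; exact c.2
  refine ⟨τ.ker.map C.subtype, ⟨⟨fun x hx g => ?_⟩, hcard, hle, hall, ?_⟩⟩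
  · apply hall
    · have hCn : C.Normal := by rw [hC]; infer_instance
      exact hCn.conj_mem _ (hle hx) g
    · have : orderOf (g * x * g⁻¹) = orderOf x := orderOf_injective (MulAut.conj g).toMonoidHom (MulAut.conj g).injective x
      rw [this]
      have := OddG.odd_orderOf hcard ⟨x, hx⟩
      rwa [orderOf_mk] at this
  · intro x hx
    obtain ⟨k, hk⟩ := hτ2 ⟨x, hx⟩
    exact ⟨k, ⟨_, hk, rfl⟩⟩

end WSn

namespace OddG
set_option linter.unusedSectionVars false
variable {K : Type*} [Group K] [Finite K]

/-- inverted elements -/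
def Iv (i : MulAut K) : Set K := {k | i k = k⁻¹}

lemma card_IC (hodd : Odd (Nat.card K)) (i : MulAut K) : (Iv i).ncard * Nat.card (fx i) ≤ Nat.card K := by
  rw [← Nat.card_coe_set_eq, ← Nat.card_prod]
  refine Nat.card_le_card_of_injective (fun p : Iv i × fx i => (p.1 : K) * p.2) ?_
  rintro ⟨⟨x, hx⟩, ⟨c, hc⟩⟩ ⟨⟨y, hy⟩, ⟨d, hd⟩⟩ h
  simp only at h
  have hx' : i x = x⁻¹ := hx
  have hy' : i y = y⁻¹ := hy
  have hc' : i c = c := hc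
  have hd' : i d = d := hd
  have h2 := congrArg i h
  rw [map_mul, map_mul, hx', hy', hc', hd'] at h2
  have h3 : x * x = y * y := by
    calc x * x = (x * c) * (x⁻¹ * c)⁻¹ := by group
      _ = (y * d) * (y⁻¹ * d)⁻¹ := by rw [h, h2]
      _ = y * y := by group
  have h4 : x = y := by rw [← sq_rt hodd x, h3, sq_rt hodd]
  subst h4
  have := mul_left_cancel h
  subst this
  rfl

lemma surj_IC (hodd : Odd (Nat.card K)) (i : MulAut K) (hi : i * i = 1) (k : K) :
    ∃ x ∈ Iv i, ∃ c ∈ fx i, k = x * c := by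
  have h0 := sq_apply hi k
  refine ⟨rt (k * (i k)⁻¹), ?_, (rt (k * (i k)⁻¹))⁻¹ * k, ?_, by group⟩
  · show i _ = _
    rw [rt_map, map_mul, map_inv, h0, ← rt_inv]; congr 1; group
  · rw [mem_fx]
    have h1 := rt_sq hodd (k * (i k)⁻¹)
    have h2 : i (rt (k * (i k)⁻¹)) = (rt (k * (i k)⁻¹))⁻¹ := by
      rw [rt_map, map_mul, map_inv, h0, ← rt_inv]; congr 1; group
    generalize rt (k * (i k)⁻¹) = s at *
    rw [map_mul, map_inv, h2, inv_inv]
    have : i k = (s * s)⁻¹ * k := by rw [h1]; group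
    rw [this]; group

lemma fixOrInv (hodd : Odd (Nat.card K)) (i b : MulAut K) (hi : i * i = 1) (hb : b * b = 1) (hc : Commute b i) :
    (∃ x, i x = x⁻¹ ∧ b x = x ∧ x ≠ 1) ∨ ∀ x, i x = x⁻¹ → b x = x⁻¹ := by
  by_cases h : ∃ x, i x = x⁻¹ ∧ b x = x ∧ x ≠ 1
  · exact Or.inl h
  · right
    push Not at h
    intro x hx
    refine lemI hodd ⊤ b i (by simp) (fun x _ => sq_apply hb x) hc ?_ x trivial hx
    intro y _ hy
    have h1 := inv_of i y (sq_apply hi y)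
    have h2 : b (i y) = i y := by
      rw [← MulAut.mul_apply, hc.eq, MulAut.mul_apply, hy]
    have := h _ h1 (by rw [map_mul, map_inv, h2, hy])
    exact (inv_mul_eq_one.1 this).symm

lemma orb (hodd : Odd (Nat.card K)) (g : MulAut K) (l : ℕ) {x : K} (hx : (g ^ 2 ^ l) x = x⁻¹) (h1 : x ≠ 1) :
    Set.InjOn (fun j : ℕ => (g ^ j) x) (Set.Iio (2 ^ (l + 1))) := by
  have hit : ∀ j : ℕ, (⇑g)^[j] x = (g ^ j) x := fun j => by
    induction j with
    | zero => rfl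
    | succ j ih => rw [Function.iterate_succ_apply', ih, pow_succ']; rfl
  have : Fact (Nat.Prime 2) := ⟨Nat.prime_two⟩
  have hm : Function.minimalPeriod g x = 2 ^ (l + 1) := by
    apply Function.minimalPeriod_eq_prime_pow
    · intro h
      have h2 : (⇑g)^[2 ^ l] x = x := h
      rw [hit, hx] at h2
      exact h1 (sq_eq_one hodd h2)
    · show (⇑g)^[2 ^ (l + 1)] x = x
      rw [hit, pow_succ, pow_mul, pow_two, MulAut.mul_apply, hx, map_inv, hx, inv_inv]
  have := Function.iterate_injOn_Iio_minimalPeriod (f := g) (x := x)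
  rw [hm] at this
  intro a ha b hb hab
  apply this ha hb
  simp only [hit]
  exact hab

/-- the orbit as a finset -/
noncomputable def Orb (g : MulAut K) (m : ℕ) (x : K) : Finset K := by
  classical exact (Finset.range m).image (fun j => (g ^ j) x)

lemma mem_Orb {g : MulAut K} {m : ℕ} {x y : K} : y ∈ Orb g m x ↔ ∃ j < m, (g ^ j) x = y := by
  classical
  simp [Orb]

lemma card_Orb (hodd : Odd (Nat.card K)) (g : MulAut K) (l : ℕ) {x : K} (hx : (g ^ 2 ^ l) x = x⁻¹) (h1 : x ≠ 1) :
    (Orb g (2 ^ (l + 1)) x).card = 2 ^ (l + 1) := by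
  classical
  unfold Orb
  have := orb hodd g l hx h1
  rw [Finset.card_image_of_injOn, Finset.card_range]
  simpa using this

lemma one_notin_Orb {g : MulAut K} {m : ℕ} {x : K} (h1 : x ≠ 1) : (1 : K) ∉ Orb g m x := by
  rw [mem_Orb]
  rintro ⟨j, -, hj⟩
  exact h1 (by simpa using hj)

lemma card_set_orb (hodd : Odd (Nat.card K)) (g : MulAut K) (l : ℕ) (X : Set K) (hX1 : 1 ∈ X)
    (hXg : ∀ x ∈ X, g x ∈ X) {x : K} (hxX : x ∈ X)
    (hx : (g ^ 2 ^ l) x = x⁻¹) (h1 : x ≠ 1) : 2 ^ (l + 1) + 1 ≤ X.ncard := by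
  classical
  have hpow : ∀ j : ℕ, (g ^ j) x ∈ X := by
    intro j
    induction j with
    | zero => exact hxX
    | succ j ih => rw [pow_succ']; exact hXg _ ih
  have h2 : (insert 1 (Orb g (2 ^ (l + 1)) x)).card = 2 ^ (l + 1) + 1 := by
    rw [Finset.card_insert_of_notMem (one_notin_Orb h1), card_Orb hodd g l hx h1]
  rw [← h2, ← Set.ncard_coe_finset]
  apply Set.ncard_le_ncard _ (Set.toFinite _)
  intro y hy
  rw [Finset.mem_coe, Finset.mem_insert, mem_Orb] at hy
  rcases hy with rfl | ⟨j, -, rfl⟩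
  · exact hX1
  · exact hpow j

lemma card_set_orb2 (hodd : Odd (Nat.card K)) (g : MulAut K) (l : ℕ) (X : Set K) (hX1 : 1 ∈ X)
    (hXg : ∀ x ∈ X, g x ∈ X) (hX : ∀ x ∈ X, (g ^ 2 ^ l) x = x⁻¹) (hcard : X.ncard ≤ 2 ^ (l + 2)) {x : K} (hxX : x ∈ X)
    (h1 : x ≠ 1) : ∀ y ∈ X, y ≠ 1 → ∃ j < 2 ^ (l + 1), y = (g ^ j) x := by
  classical
  intro y hy hy1
  by_contra hcon
  push Not at hcon
  have hpow : ∀ x ∈ X, ∀ j : ℕ, (g ^ j) x ∈ X := by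
    intro x hx j
    induction j with
    | zero => exact hx
    | succ j ih => rw [pow_succ']; exact hXg _ ih
  have hdis : Disjoint (Orb g (2 ^ (l + 1)) x) (Orb g (2 ^ (l + 1)) y) := by
    rw [Finset.disjoint_left]
    intro u hu hu'
    rw [mem_Orb] at hu hu'
    obtain ⟨a, ha, rfl⟩ := hu
    obtain ⟨b, hb, hab⟩ := hu'
    have h8 : (g ^ 2 ^ (l + 1)) y = y := by
      rw [pow_succ, pow_mul, pow_two, MulAut.mul_apply, hX y hy, map_inv, hX y hy, inv_inv]
    have h9 : ∀ q : ℕ, ((g ^ 2 ^ (l + 1)) ^ q) x = x := by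
      intro q
      induction q with
      | zero => rfl
      | succ q ih =>
        rw [pow_succ, MulAut.mul_apply]
        have : (g ^ 2 ^ (l + 1)) x = x := by
          rw [pow_succ, pow_mul, pow_two, MulAut.mul_apply, hX x hxX, map_inv, hX x hxX, inv_inv]
        rw [this, ih]
    apply hcon ((2 ^ (l + 1) - b + a) % 2 ^ (l + 1)) (Nat.mod_lt _ (by positivity))
    have h10 : (g ^ (2 ^ (l + 1) - b + a)) x = (g ^ ((2 ^ (l + 1) - b + a) % 2 ^ (l + 1))) x := by
      conv_lhs => rw [← Nat.mod_add_div (2 ^ (l + 1) - b + a) (2 ^ (l + 1)), pow_add, pow_mul, MulAut.mul_apply, h9]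
    rw [← h10]
    rw [pow_add, MulAut.mul_apply, ← hab, ← MulAut.mul_apply, ← pow_add, Nat.sub_add_cancel hb.le, h8]
  have h2 : (insert 1 (Orb g (2 ^ (l + 1)) x ∪ Orb g (2 ^ (l + 1)) y)).card = 2 ^ (l + 2) + 1 := by
    rw [Finset.card_insert_of_notMem, Finset.card_union_of_disjoint hdis, card_Orb hodd g l (hX x hxX) h1,
      card_Orb hodd g l (hX y hy) hy1]
    · ring
    · rw [Finset.mem_union]; rintro (h | h)
      · exact one_notin_Orb h1 h
      · exact one_notin_Orb hy1 h
  have h3 : (insert 1 (Orb g (2 ^ (l + 1)) x ∪ Orb g (2 ^ (l + 1)) y)).card ≤ X.ncard := by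
    rw [← Set.ncard_coe_finset]
    apply Set.ncard_le_ncard _ (Set.toFinite _)
    intro u hu
    rw [Finset.mem_coe, Finset.mem_insert, Finset.mem_union, mem_Orb, mem_Orb] at hu
    rcases hu with rfl | ⟨j, -, rfl⟩ | ⟨j, -, rfl⟩
    · exact hX1
    · exact hpow x hxX j
    · exact hpow y hy j
  omega

/-- automorphisms preserving a group of prime order act by powers -/
lemma prime_pow {p : ℕ} [Fact p.Prime] (J : Subgroup K) (hJ : Nat.card J = p) {c : K} (hc : c ∈ J) (h1 : c ≠ 1)
    {d : K} (hd : d ∈ J) : ∃ a : ℤ, d = c ^ a := by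
  have hc1 : (⟨c, hc⟩ : J) ≠ 1 := fun h => h1 (congrArg Subtype.val h)
  obtain ⟨a, ha⟩ := mem_zpowers_of_prime_card (g := (⟨c, hc⟩ : J)) (g' := ⟨d, hd⟩) hJ hc1
  exact ⟨a, (congrArg Subtype.val ha).symm⟩

lemma prime_comm {p : ℕ} [Fact p.Prime] (J : Subgroup K) (hJ : Nat.card J = p) (f g : MulAut K)
    (hf : ∀ x ∈ J, f x ∈ J) (hg : ∀ x ∈ J, g x ∈ J) {c : K} (hc : c ∈ J) : f (g c) = g (f c) := by
  by_cases h1 : c = 1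
  · subst h1; simp
  obtain ⟨a, ha⟩ := prime_pow J hJ hc h1 (hf c hc)
  obtain ⟨b, hb⟩ := prime_pow J hJ hc h1 (hg c hc)
  rw [ha, hb, map_zpow, map_zpow, ha, hb, ← zpow_mul, ← zpow_mul, mul_comm]

lemma tw_comm {p : ℕ} [Fact p.Prime] (J : Subgroup K) (hJ : Nat.card J = p) {w t w' : MulAut K} (ht : t * t = 1)
    (hw' : w' = t * w * t⁻¹) (hwJ : ∀ x ∈ J, w x ∈ J) (htJ : ∀ x ∈ J, t x ∈ J)
    {c : K} (hc : c ∈ J) : w' c = w c := by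
  have : t⁻¹ = t := inv_eq_of_mul_eq_one_left ht
  rw [hw', this, MulAut.mul_apply, MulAut.mul_apply, prime_comm J hJ w t hwJ htJ hc, sq_apply ht]

lemma fx_ge5 (hodd : Odd (Nat.card K)) (i w t w' : MulAut K) (ht : t * t = 1) (hw' : w' = t * w * t⁻¹)
    (ci : Commute i w) (ct : Commute i t) {k : K} (hk : i k = k) (hne : w (w' k) ≠ k) : 5 ≤ Nat.card (fx i) := by
  have h1 : Odd (Nat.card (fx i)) := Odd.of_dvd_nat hodd (Subgroup.card_subgroup_dvd_card _)
  have hk1 : k ≠ 1 := by rintro rfl; simp at hne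
  have h2 : Nat.card (fx i) ≠ 1 := by
    intro h
    rw [Subgroup.card_eq_one] at h
    have : k ∈ fx i := hk
    rw [h] at this
    exact hk1 (Subgroup.mem_bot.1 this)
  have h3 : Nat.card (fx i) ≠ 3 := by
    intro h
    have : Fact (Nat.Prime 3) := ⟨Nat.prime_three⟩
    have hwJ : ∀ x ∈ fx i, w x ∈ fx i := fun x hx => fx_inv ci hx
    have htJ : ∀ x ∈ fx i, t x ∈ fx i := fun x hx => fx_inv ct hx
    rw [tw_comm (fx i) h ht hw' hwJ htJ hk] at hne
    obtain ⟨a, ha⟩ := prime_pow (fx i) h hk hk1 (hwJ k hk)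
    rw [ha, map_zpow, ha, ← zpow_mul] at hne
    have h3 : k ^ (3 : ℤ) = 1 := by
      have := pow_card_eq_one' (G := fx i) (x := ⟨k, hk⟩)
      rw [h] at this
      have h5 : k ^ 3 = 1 := congrArg Subtype.val this
      exact_mod_cast h5
    have hmod : ∀ q m : ℤ, k ^ (m + 3 * q) = k ^ m := by
      intro q m; rw [zpow_add, zpow_mul, h3, one_zpow, mul_one]
    obtain ⟨q, hq⟩ : ∃ q, a = 3 * q ∨ a = 1 + 3 * q ∨ a = 2 + 3 * q := ⟨a / 3, by omega⟩
    rcases hq with hq | hq | hq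
    · rw [hq, zpow_mul, h3, one_zpow] at ha
      exact hk1 (by simpa using ha)
    · apply hne
      rw [hq, show (1 + 3 * q) * (1 + 3 * q) = 1 + 3 * (2 * q + 3 * q * q) by ring, hmod, zpow_one]
    · apply hne
      rw [hq, show (2 + 3 * q) * (2 + 3 * q) = 1 + 3 * (1 + 4 * q + 3 * q * q) by ring, hmod, zpow_one]
  obtain ⟨m, hm⟩ := h1
  omega

/-- injection from pairs for the case of a four group -/
lemma four_card (hodd : Odd (Nat.card K)) (i b : MulAut K) :
    {x | i x = x⁻¹ ∧ b x = x}.ncard * {x | i x = x⁻¹ ∧ b x = x⁻¹}.ncard ≤ (Iv i).ncard := by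
  rw [← Nat.card_coe_set_eq, ← Nat.card_coe_set_eq, ← Nat.card_coe_set_eq, ← Nat.card_prod]
  refine Nat.card_le_card_of_injective
    (fun p : {x | i x = x⁻¹ ∧ b x = x} × {x | i x = x⁻¹ ∧ b x = x⁻¹} =>
      (⟨(p.1 : K) * p.2 * p.1, ?_⟩ : Iv i)) ?_
  · obtain ⟨⟨x, hx, -⟩, ⟨y, hy, -⟩⟩ := p
    show i (x * y * x) = (x * y * x)⁻¹
    rw [map_mul, map_mul, hx, hy]; group
  · rintro ⟨⟨x, hx, hx2⟩, ⟨y, hy, hy2⟩⟩ ⟨⟨x', hx', hx2'⟩, ⟨y', hy', hy2'⟩⟩ h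
    have h : x * y * x = x' * y' * x' := congrArg Subtype.val h
    have h2 := congrArg b h
    simp only [map_mul, hx2, hy2, hx2', hy2'] at h2
    have h3 : (x * y * x⁻¹) * (x * y * x⁻¹) = (x' * y' * x'⁻¹) * (x' * y' * x'⁻¹) := by
      calc _ = (x * y * x) * (x * y⁻¹ * x)⁻¹ := by group
        _ = _ := by rw [h, h2]; group
    have h4 : x * y * x⁻¹ = x' * y' * x'⁻¹ := by rw [← sq_rt hodd (x * y * x⁻¹), h3, sq_rt hodd]
    have h5 : x * x = x' * x' := by
      calc _ = (x * y * x⁻¹)⁻¹ * (x * y * x) := by group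
        _ = _ := by rw [h, h4]; group
    have h6 : x = x' := by rw [← sq_rt hodd x, h5, sq_rt hodd]
    subst h6
    have h7 : y = y' := by simpa using h
    subst h7
    rfl

lemma exists_fix5 (C : Subgroup K) (hC : Nat.card C = 5) (X : Set K) (hX : X.ncard = 9)
    (hXC : ∀ c ∈ C, ∀ x ∈ X, c * x * c⁻¹ ∈ X) : ∃ x ∈ X, x ≠ 1 ∧ ∀ c ∈ C, c * x * c⁻¹ = x := by
  let _ : MulAction C X :=
    { smul := fun c x => ⟨c * x * (c : K)⁻¹, hXC c c.2 x x.2⟩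
      one_smul := fun x => Subtype.ext (by show (1 : K) * x * (1 : K)⁻¹ = x; simp)
      mul_smul := fun c d x => Subtype.ext (by
        show (c * d : K) * x * (c * d : K)⁻¹ = c * (d * x * (d : K)⁻¹) * (c : K)⁻¹
        group) }
  have : Fact (Nat.Prime 5) := ⟨by norm_num⟩
  have hp : IsPGroup 5 C := IsPGroup.of_card (n := 1) (by rw [hC]; norm_num)
  have h1 := hp.card_modEq_card_fixedPoints X
  rw [Nat.card_coe_set_eq, hX] at h1
  by_contra hcon
  push Not at hcon
  have h2 : Nat.card (MulAction.fixedPoints C X) ≤ 1 := by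
    rw [Finite.card_le_one_iff_subsingleton]
    constructor
    have : ∀ a : MulAction.fixedPoints C X, ((a : X) : K) = 1 := by
      rintro ⟨⟨a, ha⟩, hfix⟩
      by_contra hne
      obtain ⟨c, hc, hcx⟩ := hcon a ha hne
      exact hcx (congrArg Subtype.val (hfix ⟨c, hc⟩))
    intro a b
    exact Subtype.ext (Subtype.ext ((this a).trans (this b).symm))
  have h3 : Nat.card (MulAction.fixedPoints C X) = 0 ∨ Nat.card (MulAction.fixedPoints C X) = 1 := by omega
  rcases h3 with h3 | h3 <;> rw [h3] at h1 <;> revert h1 <;> decide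

end OddG

namespace OddG
set_option linter.unusedSectionVars false
variable {K : Type*} [Group K] [Finite K]

lemma core_e1 (hodd : Odd (Nat.card K)) (hcard : Nat.card K ≤ 56) (w t w' z : MulAut K)
    (ht : t * t = 1) (hw' : w' = t * w * t⁻¹) (cww : Commute w w') (hz : z = w * w')
    (hz4 : z ^ 4 = 1) (hi : z ^ 2 ≠ 1) (he : w ^ 4 = 1)
    (czt : Commute z t) {k0 : K} (hk0 : (z ^ 2) k0 = k0) (hk1 : z k0 ≠ k0) : False := by
  have czw : Commute z w := by rw [hz]; exact (Commute.refl w).mul_left cww.symm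
  have hii : z ^ 2 * z ^ 2 = 1 := by rw [← pow_add]; exact hz4
  have hbb : w ^ 2 * w ^ 2 = 1 := by rw [← pow_add]; exact he
  have hc : Commute (w ^ 2) (z ^ 2) := (czw.symm.pow_pow 2 2)
  have hbb' : w ^ 2 * w' ^ 2 = z ^ 2 := by rw [hz, cww.mul_pow]
  have hb't : w' ^ 2 * t = t * w ^ 2 := by
    rw [hw', conj_pow]; group
  have hit : ∀ x, (z ^ 2) (t x) = t ((z ^ 2) x) := fun x => DFunLike.congr_fun ((czt.pow_left 2).eq) x
  have hib : ∀ x, (z ^ 2) x = (w ^ 2) ((w' ^ 2) x) := fun x => by rw [← hbb']; rfl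
  have hb'tx : ∀ x, (w' ^ 2) (t x) = t ((w ^ 2) x) := fun x => DFunLike.congr_fun hb't x
  have hzz : ∀ x, (z ^ 2) (z x) = z ((z ^ 2) x) := fun x =>
    DFunLike.congr_fun (((Commute.refl z).pow_left 2).eq) x
  have hbz : ∀ x, (w ^ 2) (z x) = z ((w ^ 2) x) := fun x =>
    DFunLike.congr_fun ((czw.symm.pow_left 2).eq) x
  obtain ⟨x, hx, hx1⟩ : ∃ x, ((z ^ 2) x = x⁻¹ ∧ (w ^ 2) x = x) ∧ x ≠ 1 := by
    rcases fixOrInv hodd (z ^ 2) (w ^ 2) hii hbb hc with ⟨x, h1, h2, h3⟩ | hall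
    · exact ⟨x, ⟨h1, h2⟩, h3⟩
    · exfalso
      obtain ⟨x, hx, hx1⟩ := exists_inverted (z ^ 2) hii hi
      have h1 : (z ^ 2) (t x) = (t x)⁻¹ := by rw [hit, hx, map_inv]
      have h2 := hall _ h1
      have h3 := hb'tx (t x)
      rw [h2, map_inv, sq_apply ht] at h3
      have h4 := hib x
      rw [h3, map_inv, hall x hx, hx, inv_inv] at h4
      exact hx1 (sq_eq_one hodd h4)
  have htx : (z ^ 2) (t x) = (t x)⁻¹ ∧ (w ^ 2) (t x) = (t x)⁻¹ := by
    have h1 : (z ^ 2) (t x) = (t x)⁻¹ := by rw [hit, hx.1, map_inv]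
    refine ⟨h1, ?_⟩
    have h2 := hib (t x)
    rw [hb'tx, hx.2, h1] at h2
    exact h2.symm
  have htx1 : t x ≠ 1 := fun h => hx1 (by simpa using h)
  have c1 := card_set_orb hodd z 1 {x | (z ^ 2) x = x⁻¹ ∧ (w ^ 2) x = x} (by simp)
    (fun y hy => ⟨by rw [hzz, hy.1, map_inv], by rw [hbz, hy.2]⟩) hx (by rw [pow_one]; exact hx.1) hx1
  have c2 := card_set_orb hodd z 1 {x | (z ^ 2) x = x⁻¹ ∧ (w ^ 2) x = x⁻¹} (by simp)
    (fun y hy => ⟨by rw [hzz, hy.1, map_inv], by rw [hbz, hy.2, map_inv]⟩) htx (by rw [pow_one]; exact htx.1) htx1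
  have c3 := four_card hodd (z ^ 2) (w ^ 2)
  have c4 := card_IC hodd (z ^ 2)
  have c5 := fx_ge5 hodd (z ^ 2) w t w' ht hw' (czw.pow_left 2) (czt.pow_left 2) hk0
    (by rw [← MulAut.mul_apply, ← hz]; exact hk1)
  have c6 := Nat.mul_le_mul c1 c2
  have c7 := Nat.mul_le_mul (c6.trans c3) c5
  norm_num at c7
  omega

lemma oct {s : ℕ} (h : s < 8) (h0 : s ≠ 0) : ∃ N m : ℕ, s * N = 4 * (2 * m + 1) := by
  interval_cases s
  · exact absurd rfl h0
  · exact ⟨4, 0, rfl⟩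
  · exact ⟨2, 0, rfl⟩
  · exact ⟨4, 1, rfl⟩
  · exact ⟨1, 0, rfl⟩
  · exact ⟨4, 2, rfl⟩
  · exact ⟨2, 1, rfl⟩
  · exact ⟨4, 3, rfl⟩

lemma core_ei (hodd : Odd (Nat.card K)) (hcard : Nat.card K ≤ 56) (φ w t w' z : MulAut K)
    (ht : t * t = 1) (cφw : Commute φ w) (cφt : Commute φ t)
    (hw' : w' = t * w * t⁻¹) (cww : Commute w w') (hz : z = w * w')
    (H2 : ∀ u, (u = w ∨ ∃ a b : ℤ, u = z ^ a * w ^ b * t) → ∀ k, u k = k →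
      ∃ m : ℤ, ∃ κ, u κ = κ ∧ (z ^ m * φ) k = κ * k * κ⁻¹)
    (H3 : ∀ k, ∃ x y : ℤ, ∃ κ, (w ^ x * w' ^ y * φ) k = κ * k * κ⁻¹)
    (hz4 : z ^ 4 = 1) (hi : z ^ 2 ≠ 1) (he : w ^ 4 = z ^ 2)
    (czt : Commute z t) {k0 : K} (hk0 : (z ^ 2) k0 = k0) (hk1 : z k0 ≠ k0) : ∃ m : ℤ, φ = z ^ m := by
  have czw : Commute z w := by rw [hz]; exact (Commute.refl w).mul_left cww.symm
  have hii : z ^ 2 * z ^ 2 = 1 := by rw [← pow_add]; exact hz4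
  have cφw' : Commute φ w' := by rw [hw']; exact (cφt.mul_right cφw).mul_right cφt.inv_right
  have cφz : Commute φ z := by rw [hz]; exact cφw.mul_right cφw'
  have czw' : Commute z w' := by rw [hz]; exact cww.mul_left (Commute.refl _)
  have app : ∀ {f g : MulAut K}, Commute f g → ∀ x, f (g x) = g (f x) := fun hc x => DFunLike.congr_fun hc.eq x
  have hIpres : ∀ f : MulAut K, Commute z f → ∀ x, (z ^ 2) x = x⁻¹ → (z ^ 2) (f x) = (f x)⁻¹ := by
    intro f hf x hx
    rw [app (hf.pow_left 2), hx, map_inv]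
  have hCpres : ∀ f : MulAut K, Commute z f → ∀ x ∈ fx (z ^ 2), f x ∈ fx (z ^ 2) := by
    intro f hf x hx
    exact fx_inv (hf.pow_left 2) hx
  obtain ⟨x0, hx0, hx01⟩ := exists_inverted (z ^ 2) hii hi
  have hwinv : ∀ x ∈ Iv (z ^ 2), (w ^ 2 ^ 2) x = x⁻¹ := by
    intro x hx
    have : w ^ 2 ^ 2 = z ^ 2 := he
    rw [this]; exact hx
  have c1 := card_set_orb hodd w 2 (Iv (z ^ 2)) (by simp [Iv]) (hIpres w czw) hx0 (hwinv x0 hx0) hx01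
  have c5 := fx_ge5 hodd (z ^ 2) w t w' ht hw' (czw.pow_left 2) (czt.pow_left 2) hk0
    (by rw [← MulAut.mul_apply, ← hz]; exact hk1)
  have c4 := card_IC hodd (z ^ 2)
  norm_num at c1
  have hC5 : Nat.card (fx (z ^ 2)) = 5 := by
    have h1 : Odd (Nat.card (fx (z ^ 2))) := Odd.of_dvd_nat hodd (Subgroup.card_subgroup_dvd_card _)
    have h2 := Nat.mul_le_mul_right (Nat.card (fx (z ^ 2))) c1
    obtain ⟨m, hm⟩ := h1
    omega
  have : Fact (Nat.Prime 5) := ⟨by norm_num⟩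
  have htrans : ∀ x ∈ Iv (z ^ 2), x ≠ 1 → ∀ y ∈ Iv (z ^ 2), y ≠ 1 → ∃ j < 8, y = (w ^ j) x := by
    intro x hx hx1 y hy hy1
    have := card_set_orb2 hodd w 2 (Iv (z ^ 2)) (by simp [Iv]) (hIpres w czw) hwinv
      (by rw [hC5] at c4; norm_num; omega) hx hx1 y hy hy1
    simpa using this
  have hI9 : (Iv (z ^ 2)).ncard = 9 := by
    classical
    apply le_antisymm _ c1
    have h2 : (insert 1 (Orb w (2 ^ (2 + 1)) x0)).card = 9 := by
      rw [Finset.card_insert_of_notMem (one_notin_Orb hx01), card_Orb hodd w 2 (hwinv x0 hx0) hx01]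
      norm_num
    rw [← h2, ← Set.ncard_coe_finset]
    apply Set.ncard_le_ncard _ (Set.toFinite _)
    intro y hy
    rw [Finset.mem_coe, Finset.mem_insert, mem_Orb]
    by_cases hy1 : y = 1
    · exact Or.inl hy1
    · obtain ⟨j, hj, hyj⟩ := htrans x0 hx0 hx01 y hy hy1
      exact Or.inr ⟨j, by norm_num; exact hj, hyj.symm⟩
  have hcen : ∀ c ∈ fx (z ^ 2), ∀ y ∈ Iv (z ^ 2), c * y = y * c := by
    obtain ⟨x1, hx1, hx11, hfix⟩ := exists_fix5 (fx (z ^ 2)) hC5 (Iv (z ^ 2)) hI9 (by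
      intro c hc x hx
      have hc' : (z ^ 2) c = c := hc
      have hx' : (z ^ 2) x = x⁻¹ := hx
      show (z ^ 2) _ = _
      rw [map_mul, map_mul, map_inv, hc', hx']; group)
    intro c hc y hy
    by_cases hy1 : y = 1
    · subst hy1; simp
    obtain ⟨j, -, rfl⟩ := htrans x1 hx1 hx11 y hy hy1
    have h1 := hfix ((w ^ j)⁻¹ c) (hCpres _ (czw.pow_right j).inv_right c hc)
    have h2 := congrArg (w ^ j) h1
    rw [map_mul, map_mul, map_inv, MulAut.apply_inv_self] at h2
    exact mul_inv_eq_iff_eq_mul.1 h2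
  have hcenK : ∀ c ∈ fx (z ^ 2), ∀ k, c * k = k * c := by
    intro c hc k
    obtain ⟨y, hy, d, hd, rfl⟩ := surj_IC hodd (z ^ 2) hii k
    have h1 : c * d = d * c := by
      by_cases hc1 : c = 1
      · subst hc1; simp
      · obtain ⟨a, rfl⟩ := prime_pow (fx (z ^ 2)) hC5 hc hc1 hd
        exact ((Commute.refl c).zpow_right a).eq
    rw [← mul_assoc, hcen c hc y hy, mul_assoc, h1, mul_assoc]
  have hK45 : Nat.card K = 45 := by
    rw [hI9, hC5] at c4
    apply le_antisymm _ c4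
    have : Nat.card K ≤ Nat.card (Iv (z ^ 2) × fx (z ^ 2)) := by
      refine Nat.card_le_card_of_surjective (fun p : Iv (z ^ 2) × fx (z ^ 2) => (p.1 : K) * p.2) ?_
      intro k
      obtain ⟨y, hy, d, hd, rfl⟩ := surj_IC hodd (z ^ 2) hii k
      exact ⟨⟨⟨y, hy⟩, ⟨d, hd⟩⟩, rfl⟩
    rwa [Nat.card_prod, Nat.card_coe_set_eq, hI9, hC5] at this
  have hC5e : ∀ c ∈ fx (z ^ 2), c ^ 5 = 1 := by
    intro c hc
    have := pow_card_eq_one' (G := fx (z ^ 2)) (x := ⟨c, hc⟩)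
    rw [hC5] at this
    exact congrArg Subtype.val this
  have hI9e : ∀ x ∈ Iv (z ^ 2), x ^ 9 = 1 := by
    intro x hx
    by_contra hne
    have hx' : (z ^ 2) x = x⁻¹ := hx
    have hy : x ^ 9 ∈ Iv (z ^ 2) := by
      show (z ^ 2) _ = _
      rw [map_pow, hx', inv_pow]
    have hy5 : (x ^ 9) ^ 5 = 1 := by
      rw [← pow_mul, show 9 * 5 = Nat.card K by rw [hK45]]; exact pow_card_eq_one'
    have hall : ∀ u ∈ Iv (z ^ 2), u ^ 5 = 1 := by
      intro u hu
      by_cases hu1 : u = 1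
      · subst hu1; simp
      obtain ⟨j, -, rfl⟩ := htrans _ hy hne u hu hu1
      rw [← map_pow, hy5, map_one]
    obtain ⟨g, hg⟩ := exists_prime_orderOf_dvd_card' (G := K) 3 (hp := ⟨Nat.prime_three⟩) (by rw [hK45]; norm_num)
    obtain ⟨u, hu, d, hd, rfl⟩ := surj_IC hodd (z ^ 2) hii g
    have h5 : (u * d) ^ 5 = 1 := by
      rw [Commute.mul_pow (hcen d hd u hu).symm, hall u hu, hC5e d hd, one_mul]
    have := orderOf_dvd_of_pow_eq_one h5
    rw [hg] at this
    revert this; decide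
  obtain ⟨c0, hc0, hc01⟩ : ∃ c ∈ fx (z ^ 2), c ≠ 1 := ⟨k0, hk0, by rintro rfl; simp at hk1⟩
  obtain ⟨X, Y, κ, hτ⟩ := H3 (x0 * c0)
  set τ := w ^ X * w' ^ Y * φ with hτd
  have cτz : Commute z τ := ((czw.zpow_right X).mul_right (czw'.zpow_right Y)).mul_right cφz.symm
  have cτw : Commute τ w :=
    (((Commute.refl w).zpow_left X).mul_left (cww.symm.zpow_left Y)).mul_left cφw
  have hxc : Commute x0 c0 := (hcen c0 hc0 x0 hx0).symm
  have hx9 := hI9e x0 hx0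
  have hc5 := hC5e c0 hc0
  have hτpow : ∀ N : ℕ, τ ((x0 * c0) ^ N) = κ * (x0 * c0) ^ N * κ⁻¹ := by
    intro N; rw [map_pow, hτ, conj_pow]
  have hτc : τ c0 = c0 := by
    have h1 := hτpow 36
    have h2 : (x0 * c0) ^ 36 = c0 := by
      rw [hxc.mul_pow, show 36 = 9 * 4 by norm_num, pow_mul, hx9, one_pow, one_mul,
        show 9 * 4 = 5 * 7 + 1 by norm_num, pow_succ, pow_mul, hc5, one_pow, one_mul]
    rw [h2] at h1
    rw [h1, ← hcenK c0 hc0]; group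
  have hτx : τ x0 = κ * x0 * κ⁻¹ := by
    have h1 := hτpow 10
    have h2 : (x0 * c0) ^ 10 = x0 := by
      rw [hxc.mul_pow, show 10 = 5 * 2 by norm_num, pow_mul c0, hc5, one_pow, mul_one,
        show 5 * 2 = 9 + 1 by norm_num, pow_succ, hx9, one_mul]
    rwa [h2] at h1
  have hodd4 : ∀ m : ℕ, w ^ (4 * (2 * m + 1)) = z ^ 2 := by
    intro m
    rw [pow_mul, he, pow_succ, pow_mul, pow_two (z ^ 2), hii, one_pow, one_mul]
  have hτx1 : τ x0 = x0 := by
    obtain ⟨s, hs, hsx⟩ := htrans x0 hx0 hx01 (τ x0) (hIpres τ cτz x0 hx0) (fun h => hx01 (by simpa using h))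
    by_cases hs0 : s = 0
    · rw [hsx, hs0]; rfl
    exfalso
    have hN : ∀ N : ℕ, (τ ^ N) x0 = (w ^ (s * N)) x0 := by
      intro N
      induction N with
      | zero => rfl
      | succ N ih =>
        rw [pow_succ', MulAut.mul_apply, ih, app (cτw.pow_right _), hsx, mul_add, pow_add, mul_one,
          MulAut.mul_apply]
    obtain ⟨N, m, hNm⟩ := oct hs hs0
    obtain ⟨κ', -, h1⟩ := conj_pow_aut τ ⊤ (by simp) (Subgroup.mem_top κ) hτx N
    rw [hN, hNm, hodd4, hx0] at h1
    exact hx01 (conj_inv hodd h1)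
  have hext : ∀ f g : MulAut K, Commute f w → Commute g w → f x0 = g x0 →
      (∀ c ∈ fx (z ^ 2), f c = g c) → f = g := by
    intro f g hf hg h1 h2
    ext k
    obtain ⟨u, hu, d, hd, rfl⟩ := surj_IC hodd (z ^ 2) hii k
    rw [map_mul, map_mul, h2 d hd]
    congr 1
    by_cases hu1 : u = 1
    · subst hu1; simp
    obtain ⟨j, -, rfl⟩ := htrans _ hx0 hx01 u hu hu1
    rw [app (hf.pow_right j), app (hg.pow_right j), h1]
  have hτ1 : τ = 1 := by
    refine hext τ 1 cτw (Commute.one_left w) hτx1 ?_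
    intro c hc
    obtain ⟨a, rfl⟩ := prime_pow (fx (z ^ 2)) hC5 hc0 hc01 hc
    rw [map_zpow, hτc]; rfl
  have hwC : ∀ c ∈ fx (z ^ 2), w' c = w c := fun c hc =>
    tw_comm (fx (z ^ 2)) hC5 ht hw' (hCpres w czw) (hCpres t czt) hc
  have hv : ∃ ε : ℤ, w' = w * z ^ (2 * ε) := by
    obtain ⟨j, hj, hjx⟩ := htrans x0 hx0 hx01 (w' x0) (hIpres w' czw' x0 hx0) (fun h => hx01 (by simpa using h))
    have h8 : w ^ 8 = 1 := by rw [show 8 = 4 * 2 by norm_num, pow_mul, he, ← pow_mul]; exact hz4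
    have h1 : (w ^ (2 + 2 * j)) x0 = (w ^ 4) x0 := by
      have h2 : z ^ 2 = w ^ 2 * (w' * w') := by rw [hz, cww.mul_pow, pow_two w']
      rw [he, h2, MulAut.mul_apply, MulAut.mul_apply, hjx, app (cww.symm.pow_right j), hjx,
        ← MulAut.mul_apply, ← MulAut.mul_apply, ← pow_add, ← pow_add]
      congr 2; ring
    have h3 : (w ^ ((2 + 2 * j) % 8)) x0 = (w ^ 4) x0 := by
      rw [← h1]
      congr 1
      conv_rhs => rw [← Nat.mod_add_div (2 + 2 * j) 8, pow_add, pow_mul, h8, one_pow, mul_one]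
    have h4 := orb hodd w 2 (hwinv x0 hx0) hx01 (show (2 + 2 * j) % 8 ∈ Set.Iio (2 ^ (2 + 1)) from
      Nat.mod_lt _ (by norm_num)) (show 4 ∈ Set.Iio (2 ^ (2 + 1)) by norm_num) h3
    have h5 : j = 1 ∨ j = 5 := by omega
    rcases h5 with rfl | rfl
    · refine ⟨0, ?_⟩
      rw [mul_zero, zpow_zero, mul_one]
      exact hext _ _ cww.symm (Commute.refl w) (by rw [hjx, pow_one]) hwC
    · refine ⟨1, ?_⟩
      have hz2 : z ^ (2 * 1 : ℤ) = z ^ 2 := by norm_cast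
      rw [hz2]
      refine hext _ _ cww.symm ((Commute.refl w).mul_left (czw.pow_left 2)) ?_ ?_
      · rw [hjx, ← he, ← pow_succ']
      · intro c hc
        have hc' : (z ^ 2) c = c := hc
        rw [hwC c hc, MulAut.mul_apply, hc']
  obtain ⟨ε, hv⟩ := hv
  have czz : ∀ a : ℤ, Commute w (z ^ a) := fun a => (czw.zpow_left a).symm
  have hw2 : w ^ (2 : ℤ) = z ^ (1 - 2 * ε) := by
    have : z = w ^ (2 : ℤ) * z ^ (2 * ε) := by
      conv_lhs => rw [hz, hv]
      rw [← mul_assoc]; congr 1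
    rw [sub_eq_add_neg, zpow_add, zpow_one, zpow_neg, eq_mul_inv_iff_mul_eq]; exact this.symm
  have hφ : φ = (w ^ (X + Y) * z ^ (2 * ε * Y))⁻¹ := by
    have h1 : w ^ X * w' ^ Y = w ^ (X + Y) * z ^ (2 * ε * Y) := by
      rw [hv, (czz _).mul_zpow, ← mul_assoc, ← zpow_add, ← zpow_mul]
    rw [← h1]
    exact eq_inv_of_mul_eq_one_right hτ1
  rcases Int.even_or_odd' (X + Y) with ⟨p, hp | hp⟩
  · refine ⟨-((1 - 2 * ε) * p + 2 * ε * Y), ?_⟩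
    rw [hφ, hp, zpow_mul, hw2, ← zpow_mul, ← zpow_add, zpow_neg]
  · exfalso
    have hφ2 : φ = (w * z ^ ((1 - 2 * ε) * p + 2 * ε * Y))⁻¹ := by
      rw [hφ, hp, add_comm, zpow_add, zpow_one, zpow_mul, hw2, ← zpow_mul, mul_assoc, ← zpow_add]
    obtain ⟨u, hu, k, hk, hku, hk1⟩ : ∃ u, (u = w ∨ ∃ a b : ℤ, u = z ^ a * w ^ b * t) ∧
        ∃ k, (z ^ 2) k = k⁻¹ ∧ u k = k ∧ k ≠ 1 := by
      rcases fixOrInv hodd (z ^ 2) t hii ht (czt.symm.pow_right 2) with ⟨k, h1, h2, h3⟩ | hall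
      · exact ⟨t, Or.inr ⟨0, 0, by simp⟩, k, h1, h2, h3⟩
      · refine ⟨z ^ 2 * t, Or.inr ⟨2, 0, by norm_cast⟩, x0, hx0, ?_, hx01⟩
        rw [MulAut.mul_apply, hall x0 hx0, map_inv, hx0, inv_inv]
    obtain ⟨m, κ1, -, h1⟩ := H2 u hu k hku
    obtain ⟨κ', -, h2⟩ := conj_pow_aut (z ^ m * φ) ⊤ (by simp) (Subgroup.mem_top κ1) h1 4
    have h4 : (z ^ m * φ) ^ 4 = z ^ 2 := by
      have hz4' : ∀ a : ℤ, (z ^ a) ^ 4 = 1 := fun a => by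
        rw [← zpow_natCast, ← zpow_mul, mul_comm, zpow_mul, zpow_natCast, hz4, one_zpow]
      rw [((cφz.symm).zpow_left m).mul_pow, hz4', one_mul, hφ2, inv_pow, (czz _).mul_pow, hz4', mul_one, he]
      exact inv_eq_of_mul_eq_one_left hii
    rw [h4, hk] at h2
    exact hk1 (conj_inv hodd h2)

/-- the automorphism version of Case I -/
theorem caseI_aut (hodd : Odd (Nat.card K)) (n : ℕ) (hn : 2 ≤ n) (hcard : 2 ^ (2 * n + 1) * Nat.card K ≤ 7200)
    (φ w t w' z : MulAut K)
    (hφ2 : ∃ k, φ ^ 2 ^ k = 1) (hw2 : ∃ k, w ^ 2 ^ k = 1)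
    (ht : t * t = 1) (cφw : Commute φ w) (cφt : Commute φ t)
    (hw' : w' = t * w * t⁻¹) (cww : Commute w w') (hz : z = w * w')
    (H2 : ∀ u, (u = w ∨ ∃ a b : ℤ, u = z ^ a * w ^ b * t) → ∀ k, u k = k →
      ∃ m : ℤ, ∃ κ, u κ = κ ∧ (z ^ m * φ) k = κ * k * κ⁻¹)
    (H3 : ∀ k, ∃ x y : ℤ, ∃ κ, (w ^ x * w' ^ y * φ) k = κ * k * κ⁻¹)
    (hz1 : z ^ 2 ^ (n - 1) = 1) (he : ∃ m : ℤ, z ^ m * w ^ 2 ^ (n - 1) = 1) : ∃ m : ℤ, φ = z ^ m := by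
  by_cases H4 : ∀ a : ℤ, z ^ a * z ^ a = 1 → z ^ a ≠ 1 → ∀ k, (z ^ a) k = k → z k = k
  · exact thmF hodd φ w t w' z hφ2 hw2 ht cφw cφt hw' cww hz H2 H3 H4
  push Not at H4
  obtain ⟨a, ha1, ha2, k, hk, hkz⟩ := H4
  have htinv : t⁻¹ = t := inv_eq_of_mul_eq_one_left ht
  have czw : Commute z w := by rw [hz]; exact (Commute.refl w).mul_left cww.symm
  have hw't : w' * t = t * w := by rw [hw']; group
  have hwt : w * t = t * w' := by
    rw [hw', htinv, ← mul_assoc, ← mul_assoc, ht, one_mul]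
  have czt : Commute z t := by
    show z * t = t * z
    rw [hz, mul_assoc, hw't, ← mul_assoc, hwt, mul_assoc, ← cww.eq]
  -- the order of z on K
  have hzne : z ≠ 1 := by rintro rfl; simp at hkz
  obtain ⟨f, hf⟩ := pow2_order hz1 hzne
  have hza := (cyc_invol hf a ha1).resolve_left ha2
  rw [hza] at hk
  have hf0 : f ≠ 0 := by
    rintro rfl
    rw [pow_zero, pow_one] at hk
    exact hkz hk
  have hfn : f + 1 ≤ n - 1 := by
    have h1 := orderOf_dvd_of_pow_eq_one hz1
    rw [hf] at h1
    exact (Nat.pow_dvd_pow_iff_le_right (by norm_num)).1 h1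
  have hii : z ^ 2 ^ f * z ^ 2 ^ f = 1 := by
    rw [← pow_add, ← two_mul, ← pow_succ', ← hf, pow_orderOf_eq_one]
  have hi : z ^ 2 ^ f ≠ 1 := by rw [← hza]; exact ha2
  obtain ⟨x, hx, hx1⟩ := exists_inverted (z ^ 2 ^ f) hii hi
  have c1 := card_set_orb hodd z f (Iv (z ^ 2 ^ f)) (by simp [Iv]) (by
    intro y hy
    have hy' : (z ^ 2 ^ f) y = y⁻¹ := hy
    show (z ^ 2 ^ f) (z y) = (z y)⁻¹
    rw [← map_inv, ← hy', ← MulAut.mul_apply, ← MulAut.mul_apply, ← pow_succ, ← pow_succ']) hx hx hx1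
  have c5 := fx_ge5 hodd (z ^ 2 ^ f) w t w' ht hw' (czw.pow_left _) (czt.pow_left _) hk
    (by rw [← MulAut.mul_apply, ← hz]; exact hkz)
  have c4 := card_IC hodd (z ^ 2 ^ f)
  have hf4 : 4 ≤ 2 ^ (f + 1) := by
    calc 4 = 2 ^ 2 := by norm_num
      _ ≤ 2 ^ (f + 1) := Nat.pow_le_pow_right (by norm_num) (by omega)
  have c6 : 5 * 5 ≤ Nat.card K := (Nat.mul_le_mul (by omega) c5).trans c4
  have hn3 : n = 3 := by
    by_contra hne
    have h4 : 4 ≤ n := by omega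
    have h5 : 2 ^ 9 ≤ 2 ^ (2 * n + 1) := Nat.pow_le_pow_right (by norm_num) (by omega)
    have := (Nat.mul_le_mul h5 c6).trans hcard
    norm_num at this
  subst hn3
  have hf1 : f = 1 := by omega
  subst hf1
  have hK : Nat.card K ≤ 56 := by
    norm_num at hcard
    omega
  norm_num at he hz1 hf hk hi
  obtain ⟨m, hm⟩ := he
  have hw4 : w ^ 4 = z ^ (-m) := by
    rw [zpow_neg]; exact eq_inv_of_mul_eq_one_right hm
  have hw'4 : w' ^ 4 = w ^ 4 := by
    rw [hw', conj_pow, hw4, ← (czt.zpow_left (-m)).eq]; group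
  have hww : z ^ (-m) * z ^ (-m) = 1 := by
    rw [← hw4]
    conv_lhs => rw [← hw'4]
    rw [hw'4]
    calc w ^ 4 * w ^ 4 = w ^ 4 * w' ^ 4 := by rw [hw'4]
      _ = 1 := by rw [← cww.mul_pow, ← hz, hz1]
  rcases cyc_invol (l := 1) hf (-m) hww with h | h
  · exact (core_e1 hodd hK w t w' z ht hw' cww hz hz1 hi (hw4.trans h) czt hk hkz).elim
  · exact core_ei hodd hK φ w t w' z ht cφw cφt hw' cww hz H2 H3 hz1 hi (hw4.trans h) czt hk hkz
end OddG

namespace WSn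
open Subgroup
set_option linter.unusedSectionVars false

/-- restriction of an automorphism to an invariant subgroup -/
noncomputable def resAut {G : Type*} [Group G] [Finite G] (φ : MulAut G) (K : Subgroup G)
    (h : ∀ k ∈ K, φ k ∈ K) : MulAut K :=
  MulEquiv.ofBijective (MonoidHom.mk' (fun k : K => (⟨φ k, h k k.2⟩ : K)) (by
    intro a b; ext; simp))
    (Finite.injective_iff_bijective.1 (by
      intro a b hab
      have := congrArg Subtype.val hab
      exact Subtype.ext (φ.injective this)))

lemma resAut_apply {G : Type*} [Group G] [Finite G] (φ : MulAut G) (K : Subgroup G)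
    (h : ∀ k ∈ K, φ k ∈ K) (k : K) : ((resAut φ K h k : K) : G) = φ k := rfl

lemma resAut_pow {G : Type*} [Group G] [Finite G] (φ : MulAut G) (K : Subgroup G)
    (h : ∀ k ∈ K, φ k ∈ K) (N : ℕ) (k : K) : (((resAut φ K h ^ N) k : K) : G) = (φ ^ N) k := by
  induction N generalizing k with
  | zero => rfl
  | succ N ih => rw [pow_succ, pow_succ, MulAut.mul_apply, MulAut.mul_apply, ih, resAut_apply]

structure Ctx {G : Type*} [Group G] (S : Subgroup G) (n : ℕ) (w w' t : G) (K : Subgroup G) (φ : MulAut G) : Prop where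
  ws : WS S n w w' t
  S2 : IsPGroup 2 S
  Kn : K.Normal
  Kodd : Odd (Nat.card K)
  φS : ∀ u ∈ S, φ u = u
  φc : ∀ x, ∃ g, φ x = g * x * g⁻¹
  φ2 : ∃ k, φ ^ 2 ^ k = 1
  φK : ∀ k ∈ K, φ k ∈ K

section
variable {G : Type*} [Group G] [Finite G] {S : Subgroup G} {n : ℕ} {w w' t : G} {K : Subgroup G} {φ : MulAut G}

lemma K_inter (hK : Odd (Nat.card K)) (hS : IsPGroup 2 S) {x : G} (h1 : x ∈ K) (h2 : x ∈ S) : x = 1 := by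
  obtain ⟨k, hk⟩ := hS ⟨x, h2⟩
  have hk' : x ^ 2 ^ k = 1 := congrArg Subtype.val hk
  have ho : Odd (orderOf x) := by
    have := OddG.odd_orderOf hK ⟨x, h1⟩
    rwa [Subgroup.orderOf_mk] at this
  have := mem_of_odd_pow2 (⊥ : Subgroup G) ho (k := k) (by rw [hk']; exact one_mem _)
  simpa using this

lemma comm_of_pow {κ u : G} (hK : Odd (Nat.card K)) (hS : IsPGroup 2 S) (hu : u ∈ S)
    (h : Commute κ (u ^ Nat.card K)) : Commute κ u := by
  obtain ⟨k, hk⟩ := hS ⟨u, hu⟩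
  have hk' : u ^ 2 ^ k = 1 := congrArg Subtype.val hk
  have := mem_of_coprime (centralizer {κ}) (x := u) (a := Nat.card K) (b := 2 ^ k)
    ((Nat.coprime_two_right.2 hK).pow_right k)
    (mem_centralizer_singleton_iff.2 h.symm.eq)
    (by rw [hk']; exact one_mem _)
  exact (mem_centralizer_singleton_iff.1 this : Commute u κ).symm

lemma pow_cardK {k : G} (hk : k ∈ K) : k ^ Nat.card K = 1 := by
  have := pow_card_eq_one' (G := K) (x := ⟨k, hk⟩)
  exact congrArg Subtype.val this

lemma rel_aux (h : Ctx S n w w' t K φ) {u k κ s : G} (hu : u ∈ S) (hk : k ∈ K) (hc : Commute k u)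
    (hκ : κ ∈ K) (hs : s ∈ S) (hg : φ (k * u) = (κ * s) * (k * u) * (κ * s)⁻¹) :
    Commute s u ∧ Commute κ u ∧ φ k = κ * (s * k * s⁻¹) * κ⁻¹ := by
  have hKn := h.Kn
  rw [map_mul, h.φS u hu] at hg
  have hcs : Commute s u := by
    have h1 : u * (s * u * s⁻¹)⁻¹ = (φ k)⁻¹ * (κ * (s * k * s⁻¹) * κ⁻¹ * (κ * ((s * u * s⁻¹) * κ⁻¹ * (s * u * s⁻¹)⁻¹))) := by
      have : u = (φ k)⁻¹ * (κ * s * (k * u) * (κ * s)⁻¹) := by rw [← hg]; group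
      calc u * (s * u * s⁻¹)⁻¹ = (φ k)⁻¹ * (κ * s * (k * u) * (κ * s)⁻¹) * (s * u * s⁻¹)⁻¹ := by rw [← this]
        _ = _ := by group
    have h2 : u * (s * u * s⁻¹)⁻¹ ∈ K := by
      rw [h1]
      refine K.mul_mem (K.inv_mem (h.φK k hk)) (K.mul_mem (K.mul_mem (K.mul_mem hκ (hKn.conj_mem _ hk _)) (K.inv_mem hκ)) (K.mul_mem hκ (hKn.conj_mem _ (K.inv_mem hκ) _)))
    have h3 : u * (s * u * s⁻¹)⁻¹ ∈ S := S.mul_mem hu (S.inv_mem (S.mul_mem (S.mul_mem hs hu) (S.inv_mem hs)))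
    have h4 := K_inter h.Kodd h.S2 h2 h3
    have h5 : u = s * u * s⁻¹ := mul_inv_eq_one.1 h4
    show s * u = u * s
    conv_rhs => rw [h5]
    group
  have hsu : s * u = u * s := hcs
  have hku : Commute (s * k * s⁻¹) u := (hcs.mul_left hc).mul_left hcs.inv_left
  have hφku : Commute (φ k) u := by
    have := hc.map φ
    rwa [h.φS u hu] at this
  have hg2 : φ k * u = κ * ((s * k * s⁻¹) * u) * κ⁻¹ := by
    rw [hg, mul_inv_rev]
    have : s * (k * u) * s⁻¹ = s * k * s⁻¹ * u := by
      rw [mul_assoc (s * k), hcs.inv_left.eq]; group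
    rw [← this]; group
  have hcκ : Commute κ u := by
    apply comm_of_pow h.Kodd h.S2 hu
    have h1 := congrArg (· ^ Nat.card K) hg2
    simp only [conj_pow] at h1
    rw [hφku.mul_pow, hku.mul_pow, pow_cardK (h.φK k hk), pow_cardK (hKn.conj_mem _ hk _), one_mul] at h1
    exact (eq_mul_inv_iff_mul_eq.1 h1).symm
  refine ⟨hcs, hcκ, ?_⟩
  apply mul_right_cancel (b := u)
  rw [hg2, mul_assoc _ κ⁻¹ u, hcκ.inv_left.eq]; group

lemma rel (h : Ctx S n w w' t K φ) (htop : ∀ g : G, ∃ κ ∈ K, ∃ s ∈ S, g = κ * s) {u k : G} (hu : u ∈ S) (hk : k ∈ K)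
    (hc : Commute k u) : ∃ κ ∈ K, ∃ s ∈ S, Commute s u ∧ Commute κ u ∧ φ k = κ * (s * k * s⁻¹) * κ⁻¹ := by
  obtain ⟨g, hg⟩ := h.φc (k * u)
  obtain ⟨κ, hκ, s, hs, rfl⟩ := htop g
  exact ⟨κ, hκ, s, hs, rel_aux h hu hk hc hκ hs hg⟩

theorem caseI (h : Ctx S n w w' t K φ) (htop : ∀ g : G, ∃ κ ∈ K, ∃ s ∈ S, g = κ * s)
    (hcard : 2 ^ (2 * n + 1) * Nat.card K ≤ 7200) (N : Subgroup G) [hN : N.Normal]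
    (hKN : K ≤ centralizer (N : Set G)) {x y : ℤ} (hr : El w w' x y ∈ N) (hd : ¬ (2 ^ n : ℤ) ∣ x - y) :
    φ ∈ innAut G := by
  have hws := h.ws
  have hKn := h.Kn
  have hφN : ∀ u ∈ N, ∀ k ∈ K, Commute k u := fun u hu k hk => (mem_centralizer_iff.1 (hKN hk) u hu).symm
  have key : ∀ {k κ a b : G}, a * b = 1 → φ k = κ * (b * k * b⁻¹) * κ⁻¹ →
      a * φ k * a⁻¹ = (a * κ * a⁻¹) * k * (a * κ * a⁻¹)⁻¹ := by
    intro k κ a b hab hk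
    have : a = b⁻¹ := eq_inv_of_mul_eq_one_left hab
    subst this
    rw [hk]; group
  let c : G →* MulAut K := MulAut.conjNormal
  have hcv : ∀ (g : G) (k : K), ((c g k : K) : G) = g * k * g⁻¹ := fun g k => MulAut.conjNormal_apply g k
  let f := resAut φ K h.φK
  have hfv : ∀ k : K, ((f k : K) : G) = φ k := fun k => rfl
  have hcomm : ∀ u ∈ S, Commute f (c u) := by
    intro u hu
    ext k
    rw [MulAut.mul_apply, MulAut.mul_apply, hfv, hcv, hcv, hfv, map_mul, map_mul, map_inv, h.φS u hu]
  have hzc : c w * c w' = c (El w w' 1 1) := by rw [← map_mul]; simp [El]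
  have hzm : ∀ m : ℤ, c (El w w' 1 1) ^ m = c (El w w' m m) := by
    intro m; rw [← map_zpow, El_zpow hws]; simp
  have hfix : ∀ (g : G) (k : K), c g k = k ↔ Commute (k : G) g := by
    intro g k
    rw [Subtype.ext_iff, hcv, mul_inv_eq_iff_eq_mul]
    exact ⟨fun hh => hh.symm, fun hh => hh.symm⟩
  have h20 : ∀ u ∈ S, (∀ s ∈ S, Commute s u → ∃ m : ℤ, ∃ j : ℤ, s = El w w' m m * u ^ j) →
      ∀ k, c u k = k → ∃ m : ℤ, ∃ κ, c u κ = κ ∧ (c (El w w' 1 1) ^ m * f) k = κ * k * κ⁻¹ := by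
    intro u hu hcen k hk
    rw [hfix] at hk
    obtain ⟨κ, hκ, s, hs, hsu, hκu, hk2⟩ := rel h htop hu k.2 hk
    obtain ⟨m, j, rfl⟩ := hcen s hs hsu
    have h3 : El w w' m m * u ^ j * k * (El w w' m m * u ^ j)⁻¹ = El w w' m m * k * (El w w' m m)⁻¹ := by
      rw [mul_inv_rev, mul_assoc (El w w' m m), ← (hk.zpow_right j).eq]; group
    rw [h3] at hk2
    have hmm : El w w' (-m) (-m) * El w w' m m = 1 := by rw [El_mul hws]; simp [El]
    have hzu : Commute (El w w' (-m) (-m)) u := z_comm hws (-m) hu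
    refine ⟨-m, ⟨El w w' (-m) (-m) * κ * (El w w' (-m) (-m))⁻¹, hKn.conj_mem _ hκ _⟩, ?_, ?_⟩
    · rw [hfix]
      exact (hzu.mul_left hκu).mul_left hzu.inv_left
    · ext
      rw [hzm, MulAut.mul_apply, hcv, hfv]
      exact key hmm hk2
  have hmain := OddG.caseI_aut (K := K) h.Kodd n hws.hn hcard f (c w) (c t) (c w') (c (El w w' 1 1))
    (by
      obtain ⟨k, hk⟩ := h.φ2
      refine ⟨k, ?_⟩
      ext x
      rw [resAut_pow, hk]; rfl)
    (by
      obtain ⟨k, hk⟩ := h.S2 ⟨w, hws.hw⟩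
      have hk' : w ^ 2 ^ k = 1 := congrArg Subtype.val hk
      exact ⟨k, by rw [← map_pow, hk', map_one]⟩)
    (by rw [← map_mul, hws.tt, map_one]) (hcomm w hws.hw) (hcomm t hws.ht)
    (by rw [← map_mul, ← map_inv, ← map_mul, ← w'_eq hws]) (hws.cww.map c) hzc.symm
    (by
      rintro u (rfl | ⟨a, b, rfl⟩)
      · apply h20 w hws.hw
        intro s hs hsw
        have hw1 : w = El w w' 1 0 := by simp [El]
        obtain ⟨a, b, rfl⟩ := cent_base hws (x := 1) (y := 0) (by
          intro h3
          have := Int.le_of_dvd (by norm_num) h3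
          have h4 : (1:ℤ) < 2 ^ n := one_lt_pow₀ (by norm_num) (by have := hws.hn; omega)
          omega) hs (by rw [← hw1]; exact hsw)
        refine ⟨b, a - b, ?_⟩
        have : w ^ (a - b) = El w w' (a - b) 0 := by simp [El]
        rw [this, El_mul hws]; congr 1 <;> ring
      · have h1 : c (El w w' 1 1) ^ a * c w ^ b * c t = c (El w w' (a + b) a * t) := by
          rw [hzm, ← map_zpow, ← map_mul, ← map_mul]
          have : w ^ b = El w w' b 0 := by simp [El]
          rw [this, El_mul hws, add_zero]
        rw [h1]
        apply h20 _ (S.mul_mem (El_mem hws _ _) hws.ht)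
        intro s hs hsw
        obtain ⟨m, h1 | h1⟩ := cent_t hws hs hsw
        · exact ⟨m, 0, by rw [h1]; simp⟩
        · exact ⟨m, 1, by rw [h1]; simp⟩)
    (by
      intro k
      obtain ⟨κ, hκ, s, hs, hsu, hκu, hk2⟩ := rel h htop (El_mem hws x y) k.2 (hφN _ hr k k.2)
      obtain ⟨a, b, rfl⟩ := cent_base hws hd hs hsu
      have hmm : El w w' (-a) (-b) * El w w' a b = 1 := by rw [El_mul hws]; simp [El]
      refine ⟨-a, -b, ⟨El w w' (-a) (-b) * κ * (El w w' (-a) (-b))⁻¹, hKn.conj_mem _ hκ _⟩, ?_⟩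
      ext
      rw [← map_zpow, ← map_zpow, ← map_mul, MulAut.mul_apply, hcv, hfv]
      exact key hmm hk2)
    (by
      rw [← zpow_natCast, hzm]
      ext k
      have := (hfix (El w w' (2 ^ (n-1)) (2 ^ (n-1))) k).2 (hφN _ (exists_c hws N hr hd).1 k k.2)
      push_cast
      rw [this]; rfl)
    (by
      obtain ⟨m, hm⟩ := (exists_c hws N hr hd).2
      refine ⟨m, ?_⟩
      rw [hzm, ← map_pow, ← map_mul]
      have : w ^ 2 ^ (n-1) = El w w' (2 ^ (n-1)) 0 := by
        rw [El, zpow_zero, mul_one, ← zpow_natCast]; push_cast; rfl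
      rw [this, El_mul hws, add_zero]
      ext k
      rw [(hfix _ k).2 (hφN _ hm k k.2)]; rfl)
  obtain ⟨m, hm⟩ := hmain
  refine ⟨El w w' m m, ?_⟩
  ext g
  obtain ⟨κ, hκ, s, hs, rfl⟩ := htop g
  have h1 : φ κ = El w w' m m * κ * (El w w' m m)⁻¹ := by
    have := hfv ⟨κ, hκ⟩
    rw [hm, hzm, hcv] at this
    exact this.symm
  rw [MulAut.conj_apply, map_mul, h1, h.φS s hs, mul_assoc _ (El w w' m m)⁻¹ s,
    (z_comm hws m hs).inv_left.eq]
  group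
end
end WSn

namespace WSn
open Subgroup
set_option linter.unusedSectionVars false

lemma avg {G Q : Type*} [Group G] [Finite G] [Group Q] (α β : G →* Q) (L0 : Subgroup G)
    (hL : ∀ l ∈ L0, α l = β l) (D : Subgroup Q) (hab : ∀ a ∈ D, ∀ b ∈ D, a * b = b * a)
    (hnorm : ∀ g, ∀ d ∈ D, β g * d * (β g)⁻¹ ∈ D) (hδ : ∀ g, α g * (β g)⁻¹ ∈ D) (s : ℕ)
    (h2 : ∀ d ∈ D, d ^ 2 ^ s = 1) (hodd : Odd L0.index) : ∃ b ∈ D, ∀ g, α g = b * β g * b⁻¹ := by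
  classical
  let _ : CommGroup D := { (inferInstance : Group D) with mul_comm := fun a b => Subtype.ext (hab a a.2 b b.2) }
  let δ : G → D := fun g => ⟨α g * (β g)⁻¹, hδ g⟩
  let cj : G → D →* D := fun g => MonoidHom.mk' (fun d => ⟨β g * d * (β g)⁻¹, hnorm g d d.2⟩) (by
    intro a b
    ext
    show β g * (a * b) * (β g)⁻¹ = β g * a * (β g)⁻¹ * (β g * b * (β g)⁻¹)
    group)
  have hδm : ∀ g x, δ (g * x) = δ g * cj g (δ x) := by
    intro g x
    ext
    show α (g * x) * (β (g * x))⁻¹ = α g * (β g)⁻¹ * (β g * (α x * (β x)⁻¹) * (β g)⁻¹)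
    rw [map_mul, map_mul]; group
  have hδl : ∀ x y : G, (QuotientGroup.leftRel L0) x y → δ x = δ y := by
    intro x y hxy
    rw [QuotientGroup.leftRel_apply] at hxy
    ext
    show α x * (β x)⁻¹ = α y * (β y)⁻¹
    have h1 := hL _ hxy
    rw [map_mul, map_mul, map_inv, map_inv] at h1
    have : α y = α x * ((β x)⁻¹ * β y) := by rw [← h1]; group
    rw [this]; group
  let δq : G ⧸ L0 → D := Quotient.lift δ hδl
  let _ : Fintype (G ⧸ L0) := Fintype.ofFinite _
  have hcard : Fintype.card (G ⧸ L0) = L0.index := by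
    rw [Subgroup.index, Nat.card_eq_fintype_card]
  let b : D := ∏ q, δq q
  have hb : ∀ g, b = δ g ^ L0.index * cj g b := by
    intro g
    have h1 : b = ∏ q : G ⧸ L0, δq (g • q) := (Equiv.prod_comp (MulAction.toPerm g) δq).symm
    have h3 : ∀ q : G ⧸ L0, δq (g • q) = δ g * cj g (δq q) := by
      intro q
      obtain ⟨x, rfl⟩ := QuotientGroup.mk_surjective q
      exact hδm g x
    conv_lhs => rw [h1]
    simp_rw [h3]
    rw [Finset.prod_mul_distrib, Finset.prod_const, Finset.card_univ, hcard, ← map_prod]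
  obtain ⟨r, hr⟩ : ∃ r : ℕ, L0.index * r ≡ 1 [MOD 2 ^ s] := by
    have hc : Nat.Coprime L0.index (2 ^ s) := (Nat.coprime_two_right.2 hodd).pow_right s
    obtain ⟨r, -, hr⟩ := Nat.exists_mul_mod_eq_of_coprime 1 hc (by positivity)
    exact ⟨r, hr⟩
  refine ⟨(b ^ r : D), (b ^ r).2, ?_⟩
  intro g
  have h4 : δ g * cj g (b ^ r) = b ^ r := by
    have h5 : δ g ^ (L0.index * r) = δ g := by
      have h6 : δ g ^ 2 ^ s = 1 := Subtype.ext (h2 _ (δ g).2)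
      rw [← pow_mod_orderOf]
      conv_rhs => rw [← pow_one (δ g), ← pow_mod_orderOf]
      congr 1
      exact hr.of_dvd (orderOf_dvd_of_pow_eq_one h6)
    conv_rhs => rw [hb g]
    rw [mul_pow, ← pow_mul, h5, map_pow]
  have h5 := congrArg Subtype.val h4
  have h6 : α g * (β g)⁻¹ * (β g * ((b ^ r : D) : Q) * (β g)⁻¹) = ((b ^ r : D) : Q) := h5
  generalize ((b ^ r : D) : Q) = c at h6 ⊢
  have h7 : α g * c * (β g)⁻¹ = c := by
    calc α g * c * (β g)⁻¹ = α g * (β g)⁻¹ * (β g * c * (β g)⁻¹) := by group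
      _ = c := h6
  rw [← mul_inv_eq_iff_eq_mul, inv_inv]
  exact mul_inv_eq_iff_eq_mul.1 h7

section
variable {G : Type*} [Group G] [Finite G]

lemma le_KS (S : Sylow 2 G) (K X : Subgroup G) [hK : K.Normal] [hX : X.Normal]
    (h : ∀ x ∈ X, ∃ k : ℕ, x ^ 2 ^ k ∈ K) : ∀ x ∈ X, ∃ κ ∈ K, ∃ s ∈ S, x = κ * s := by
  have h1 : (X.map (QuotientGroup.mk' K)).Normal := hX.map _ (QuotientGroup.mk'_surjective K)
  have h2 : IsPGroup 2 (X.map (QuotientGroup.mk' K)) := by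
    rintro ⟨_, x, hx, rfl⟩
    obtain ⟨k, hk⟩ := h x hx
    refine ⟨k, Subtype.ext ?_⟩
    show (QuotientGroup.mk' K x) ^ 2 ^ k = 1
    rw [← map_pow]
    exact (QuotientGroup.eq_one_iff _).2 hk
  intro x hx
  have h3 := h2.le_sylow_of_normal (S.mapSurjective (QuotientGroup.mk'_surjective K)) (mem_map_of_mem _ hx)
  obtain ⟨s, hs, hsx⟩ := h3
  refine ⟨x * s⁻¹, ?_, s, hs, by group⟩
  have : QuotientGroup.mk' K (x * s⁻¹) = 1 := by rw [map_mul, map_inv, hsx, mul_inv_cancel]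
  exact (QuotientGroup.eq_one_iff _).1 this

lemma odd_or_top (S : Sylow 2 G) (N K : Subgroup G) (hK : IsK N K) :
    (∀ g : G, ∃ κ ∈ K, ∃ s ∈ (S : Subgroup G), g = κ * s) ∨ ∃ d : G, Odd (orderOf d) ∧ d ∉ centralizer (N : Set G) := by
  by_cases h : ∃ d : G, Odd (orderOf d) ∧ d ∉ centralizer (N : Set G)
  · exact Or.inr h
  left
  push Not at h
  have hn := hK.normal
  intro g
  refine le_KS S K ⊤ ?_ g (mem_top g)
  intro x _
  obtain ⟨k, m, hm, h1, -⟩ := split2 x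
  have ho := odd_of_pow hm h1
  exact ⟨k, hK.all _ (h _ ho) ho⟩

end
end WSn

namespace WSn
open Subgroup
set_option linter.unusedSectionVars false

def Cyc (σ : Equiv.Perm (Fin 3)) : Prop := σ ≠ 1 ∧ Equiv.Perm.sign σ = 1

instance (σ : Equiv.Perm (Fin 3)) : Decidable (Cyc σ) := by unfold Cyc; infer_instance

lemma Cyc.cube : ∀ {σ : Equiv.Perm (Fin 3)}, Cyc σ → σ ^ 3 = 1 := by decide
lemma Cyc.cent : ∀ {σ : Equiv.Perm (Fin 3)}, Cyc σ → ∀ τ : Equiv.Perm (Fin 3), τ * σ = σ * τ → ∃ i : Fin 3, τ = σ ^ (i : ℕ) := by decide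
lemma Cyc.conj : ∀ {σ : Equiv.Perm (Fin 3)}, Cyc σ → ∀ τ : Equiv.Perm (Fin 3), Cyc (τ * σ * τ⁻¹) := by decide
lemma Cyc.sq : ∀ {σ : Equiv.Perm (Fin 3)}, Cyc σ → Cyc (σ ^ 2) := by decide
set_option maxRecDepth 20000 in
lemma Cyc.noncomm : ∀ {σ : Equiv.Perm (Fin 3)}, Cyc σ → ∀ τ : Equiv.Perm (Fin 3), τ ≠ 1 → ¬ Cyc τ →
  Cyc (σ * τ * σ⁻¹ * τ⁻¹) := by decide

lemma Cyc.pow {σ : Equiv.Perm (Fin 3)} (h : Cyc σ) {m : ℕ} (hm : ¬ 3 ∣ m) : Cyc (σ ^ m) := by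
  have h1 : σ ^ m = σ ^ (m % 3) := by
    conv_lhs => rw [← Nat.mod_add_div m 3, pow_add, pow_mul, h.cube, one_pow, mul_one]
  have h2 : m % 3 = 1 ∨ m % 3 = 2 := by omega
  rw [h1]
  rcases h2 with h2 | h2 <;> rw [h2]
  · rwa [pow_one]
  · exact h.sq

structure U {G : Type*} [Group G] (K L : Subgroup G) (θ : G →* Equiv.Perm (Fin 3)) : Prop where
  Kn : K.Normal
  Kodd : Odd (Nat.card K)
  Ln : L.Normal
  KL : K ≤ L
  LB : ∀ l ∈ L, θ l = 1
  comm : ∀ a b, θ a = 1 → θ b = 1 → a * b * a⁻¹ * b⁻¹ ∈ L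
  two : ∀ b, θ b = 1 → ∃ j : ℕ, b ^ 2 ^ j ∈ L
  fpf : ∀ n x, Cyc (θ n) → θ x = 1 → n * x * n⁻¹ * x⁻¹ ∈ L → x ∈ L
  ex : ∃ g, Cyc (θ g)

section
variable {G : Type*} [Group G] [Finite G] {K L : Subgroup G} {θ : G →* Equiv.Perm (Fin 3)}

lemma U.cent (hU : U K L θ) {n g : G} (hn : Cyc (θ n)) (h : g * n * g⁻¹ * n⁻¹ ∈ L) :
    ∃ i : ℕ, ∃ l ∈ L, g = n ^ i * l := by
  have hL := hU.Ln
  have h1 : θ g * θ n = θ n * θ g := by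
    have := hU.LB _ h
    rw [map_mul, map_mul, map_mul, map_inv, map_inv, mul_inv_eq_one, mul_inv_eq_iff_eq_mul] at this
    exact this
  obtain ⟨i, hi⟩ := hn.cent _ h1
  refine ⟨i, (n ^ (i : ℕ))⁻¹ * g, ?_, by group⟩
  apply hU.fpf n _ hn
  · rw [map_mul, map_inv, map_pow, hi, inv_mul_cancel]
  · have h2 : n * ((n ^ (i : ℕ))⁻¹ * g) * n⁻¹ * ((n ^ (i : ℕ))⁻¹ * g)⁻¹
        = ((n ^ (i : ℕ))⁻¹) * (g * n * g⁻¹ * n⁻¹)⁻¹ * ((n ^ (i : ℕ))⁻¹)⁻¹ := by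
      have h3 : n * (n ^ (i : ℕ))⁻¹ = (n ^ (i : ℕ))⁻¹ * n := ((Commute.refl n).pow_right _).inv_right.eq
      rw [← mul_assoc, h3]; group
    rw [h2]
    exact hL.conj_mem _ (L.inv_mem h) _

lemma U.three {g : G} (hg : Cyc (θ g)) : ∃ m a : ℕ, (g ^ m) ^ 3 ^ a = 1 ∧ Cyc (θ (g ^ m)) := by
  obtain ⟨a, m, hm, h⟩ := Nat.exists_eq_pow_mul_and_not_dvd (orderOf_pos g).ne' 3 (by norm_num)
  refine ⟨m, a, ?_, ?_⟩
  · rw [← pow_mul, mul_comm, ← h, pow_orderOf_eq_one]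
  · rw [map_pow]; exact hg.pow hm

lemma U.norm (hU : U K L θ) {n b : G} (hn : Cyc (θ n)) (hb : θ b = 1) (H : Subgroup G)
    (hHB : ∀ h ∈ H, θ h = 1) (hHn : ∀ h ∈ H, n⁻¹ * h * n ∈ H) {h1 l1 : G} (hh : h1 ∈ H) (hl : l1 ∈ L)
    (he : b⁻¹ * (n⁻¹ * b * n) = h1 * l1) : ∃ l ∈ L, ∃ h ∈ H, b = l * h := by
  have hL := hU.Ln
  let π : G →* G ⧸ L := QuotientGroup.mk' L
  have hπ : ∀ x, π x = 1 ↔ x ∈ L := fun x => QuotientGroup.eq_one_iff x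
  have hc : ∀ x y, θ x = 1 → θ y = 1 → π x * π y = π y * π x := by
    intro x y hx hy
    have := (hπ _).2 (hU.comm x y hx hy)
    rw [map_mul, map_mul, map_mul, map_inv, map_inv, mul_inv_eq_one, mul_inv_eq_iff_eq_mul] at this
    exact this
  have hb1 : θ (n⁻¹ * b * n) = 1 := by rw [map_mul, map_mul, hb, map_inv]; group
  have hb2 : θ (n⁻¹ * (n⁻¹ * b * n) * n) = 1 := by rw [map_mul, map_mul, hb1, map_inv]; group
  have hn3 : θ (n ^ 3) = 1 := by rw [map_pow, hn.cube]
  have e1 : π (n⁻¹ * b * n) = π b * π h1 := by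
    have := congrArg π he
    rw [map_mul, map_inv, map_mul π h1, (hπ l1).2 hl, mul_one] at this
    rw [← this]; group
  have e2 : π (n⁻¹ * (n⁻¹ * b * n) * n) = π b * π h1 * π (n⁻¹ * h1 * n) := by
    rw [map_mul, map_mul, e1, ← e1]
    have : π n⁻¹ * (π b * π h1) * π n = (π (n⁻¹ * b * n)) * π (n⁻¹ * h1 * n) := by
      simp only [map_mul, map_inv]; group
    rw [e1, this, e1]
  have hx : b * (n⁻¹ * b * n) * (n⁻¹ * (n⁻¹ * b * n) * n) ∈ L := by
    apply hU.fpf n _ hn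
    · rw [map_mul, map_mul, hb, hb1, hb2]; rfl
    · rw [← hπ, map_mul, map_inv, mul_inv_eq_one]
      have h3 : n * (b * (n⁻¹ * b * n) * (n⁻¹ * (n⁻¹ * b * n) * n)) * n⁻¹
          = n ^ 3 * (n⁻¹ * (n⁻¹ * b * n) * n) * (n ^ 3)⁻¹ * (b * (n⁻¹ * b * n)) := by group
      rw [h3, map_mul, map_mul, map_mul, map_inv, hc _ _ hn3 hb2, mul_inv_cancel_right, map_mul π (b * _)]
      exact hc _ _ hb2 (by rw [map_mul, hb, hb1]; rfl)
  rw [← hπ, map_mul, map_mul, e1, e2] at hx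
  have hh2 := hHn h1 hh
  have c1 := hc b h1 hb (hHB _ hh)
  have c2 := hc b _ hb (hHB _ hh2)
  have hb3 : π b ^ 3 ∈ H.map π := by
    have : π b ^ 3 = (π (h1 * h1 * (n⁻¹ * h1 * n)))⁻¹ := by
      rw [eq_inv_iff_mul_eq_one, ← hx, map_mul, map_mul]
      generalize π (n⁻¹ * h1 * n) = c at *
      generalize π b = B at *
      generalize π h1 = D at *
      calc B ^ 3 * (D * D * c) = B * B * (B * D) * D * c := by rw [pow_three]; simp only [mul_assoc]
        _ = B * B * (D * B) * D * c := by rw [c1]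
        _ = B * (B * D) * (B * D * c) := by simp only [mul_assoc]
    rw [this]
    exact Subgroup.inv_mem _ (mem_map_of_mem _ (H.mul_mem (H.mul_mem hh hh) hh2))
  obtain ⟨j, hj⟩ := hU.two b hb
  have hb4 : π b ∈ H.map π := by
    refine mem_of_coprime _ (a := 3) (b := 2 ^ j) (Nat.Coprime.pow_right j (by norm_num)) hb3 ?_
    rw [← map_pow, (hπ _).2 hj]; exact one_mem _
  obtain ⟨h, hhH, hhb⟩ := hb4
  refine ⟨b * h⁻¹, ?_, h, hhH, by group⟩
  rw [← hπ, map_mul, map_inv, ← hhb]; exact mul_inv_cancel _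

lemma sylow_smul_mem {p : ℕ} (P : Sylow p G) {g x : G} (hx : x ∈ (P : Subgroup G)) :
    g * x * g⁻¹ ∈ ((g • P : Sylow p G) : Subgroup G) :=
  Subgroup.smul_mem_pointwise_smul x (MulAut.conj g) _ hx

lemma zpowers_pgroup {p j : ℕ} {k : G} (hk : k ^ p ^ j = 1) : IsPGroup p (zpowers k) := by
  rintro ⟨x, i, rfl⟩
  refine ⟨j, Subtype.ext ?_⟩
  show (k ^ i) ^ p ^ j = 1
  rw [← zpow_natCast, zpow_comm, zpow_natCast, hk, one_zpow]

theorem U.perp (hU : U K L θ) (φ : MulAut G) (hφ1 : ∀ g, φ g * g⁻¹ ∈ K) (hφc : ∀ x, ∃ g, φ x = g * x * g⁻¹)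
    (hCol : IsColeman φ) {p : ℕ} (hp : p.Prime) {k : G} (hk : k ∈ K) (hkp : k ^ p = 1) :
    ∃ n : G, ∃ a : ℕ, n ^ 3 ^ a = 1 ∧ ∃ i : ℕ, ∃ l ∈ L, φ k = (n ^ i * l) * k * (n ^ i * l)⁻¹ := by
  have hKn := hU.Kn
  have hφθ : ∀ g, θ (φ g) = θ g := by
    intro g
    have := hU.LB _ (hU.KL (hφ1 g))
    rw [map_mul, map_inv, mul_inv_eq_one] at this
    exact this
  obtain ⟨g0, hg0⟩ := hU.ex
  by_cases hp3 : p = 3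
  · subst hp3
    obtain ⟨m, a, hn3, hnc⟩ := U.three hg0
    obtain ⟨P, hP⟩ := (zpowers_pgroup (p := 3) (j := 1) (k := k) (by simpa using hkp)).exists_le_sylow
    obtain ⟨P0, hP0⟩ := (zpowers_pgroup hn3).exists_le_sylow
    have hf : Fact (Nat.Prime 3) := ⟨hp⟩
    obtain ⟨g, rfl⟩ := MulAction.exists_smul_eq G P0 P
    obtain ⟨y, hy⟩ := hCol 3 hp (g • P0)
    have hnP := sylow_smul_mem P0 (g := g) (hP0 (mem_zpowers (g0 ^ m)))
    have hcyc : Cyc (θ (g * g0 ^ m * g⁻¹)) := by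
      rw [map_mul, map_mul, map_inv]; exact hnc.conj _
    obtain ⟨i, l, hl, hyl⟩ := hU.cent (n := g * g0 ^ m * g⁻¹) (g := y⁻¹) hcyc (by
      have := hφ1 (g * g0 ^ m * g⁻¹)
      rw [hy _ hnP] at this
      rw [inv_inv]
      exact hU.KL this)
    refine ⟨g * g0 ^ m * g⁻¹, a, by rw [conj_pow, hn3]; group, i, l, hl, ?_⟩
    rw [← hyl, inv_inv]
    exact hy k (hP (mem_zpowers k))
  have hf : Fact (Nat.Prime p) := ⟨hp⟩
  obtain ⟨P, hP⟩ := (zpowers_pgroup (p := p) (j := 1) (k := (⟨k, hk⟩ : K)) (by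
    ext; simpa using hkp)).exists_le_sylow
  have hPk : k ∈ (P : Subgroup K).map K.subtype := ⟨⟨k, hk⟩, hP (mem_zpowers _), rfl⟩
  have hfr := Sylow.normalizer_sup_eq_top P
  obtain ⟨Q, hQ⟩ := (P.isPGroup'.map K.subtype).exists_le_sylow
  obtain ⟨y, hy⟩ := hCol p hp Q
  set R := (P : Subgroup K).map K.subtype with hR
  by_cases hd : ∃ d ∈ centralizer (R : Set G), Cyc (θ d)
  · obtain ⟨d, hd, hdc⟩ := hd
    obtain ⟨m, a, hn3, hnc⟩ := U.three hdc
    set e := d ^ m with he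
    have hek : Commute k e :=
      mem_centralizer_iff.1 (Subgroup.pow_mem _ hd m : e ∈ centralizer (R : Set G)) k hPk
    obtain ⟨g, hg⟩ := hφc (k * e)
    have hcop : Nat.Coprime p (3 ^ a) := Nat.Coprime.pow_right a ((Nat.coprime_primes hp Nat.prime_three).2 hp3)
    have hφk : φ k = g * k * g⁻¹ := by
      obtain ⟨M, hM1, hM2⟩ := Nat.chineseRemainder hcop 1 0
      have h1 : (k * e) ^ M = k := by
        rw [hek.mul_pow]
        have h2 : e ^ M = 1 := by
          obtain ⟨c, hc⟩ := (Nat.modEq_zero_iff_dvd.1 hM2)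
          rw [hc, pow_mul, hn3, one_pow]
        have h3 : k ^ M = k := by
          conv_rhs => rw [← pow_one k]
          exact pow_eq_pow_iff_modEq.2 (hM1.of_dvd (orderOf_dvd_of_pow_eq_one hkp))
        rw [h2, h3, mul_one]
      calc φ k = φ ((k * e) ^ M) := by rw [h1]
        _ = g * (k * e) ^ M * g⁻¹ := by rw [map_pow, hg, conj_pow]
        _ = _ := by rw [h1]
    have hφe : φ e = g * e * g⁻¹ := by
      rw [map_mul, hφk] at hg
      have : g * k * g⁻¹ * φ e = g * k * g⁻¹ * (g * e * g⁻¹) := by rw [hg]; group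
      exact mul_left_cancel this
    obtain ⟨i, l, hl, hyl⟩ := hU.cent (n := e) (g := g) hnc (by
      have := hφ1 e
      rw [hφe] at this
      exact hU.KL this)
    exact ⟨e, a, hn3, i, l, hl, by rw [← hyl]; exact hφk⟩
  push Not at hd
  -- a 3-element in the normalizer of R
  obtain ⟨g1, hg1, κ1, hκ1, hgκ⟩ := mem_sup_of_normal_right.1 (hfr ▸ mem_top g0 : g0 ∈ normalizer (R : Set G) ⊔ K)
  have hg1c : Cyc (θ g1) := by
    rw [← hgκ, map_mul, hU.LB _ (hU.KL hκ1), mul_one] at hg0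
    exact hg0
  obtain ⟨m, a, hn3, hnc⟩ := U.three hg1c
  have hnR : g1 ^ m ∈ normalizer (R : Set G) := Subgroup.pow_mem _ hg1 m
  generalize g1 ^ m = n at hn3 hnc hnR
  have hRn : ∀ u ∈ R, n * u * n⁻¹ ∈ R := fun u hu => (mem_normalizer_iff.1 hnR u).1 hu
  have hRn' : ∀ u ∈ R, n⁻¹ * u * n ∈ R := fun u hu => by
    have := (mem_normalizer_iff.1 (Subgroup.inv_mem _ hnR) u).1 hu
    simpa using this
  have hHn : ∀ h ∈ centralizer (R : Set G), n⁻¹ * h * n ∈ centralizer (R : Set G) := by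
    intro h hh
    rw [mem_centralizer_iff]
    intro u hu
    have := mem_centralizer_iff.1 hh _ (hRn u hu)
    calc u * (n⁻¹ * h * n) = n⁻¹ * ((n * u * n⁻¹) * h) * n := by group
      _ = n⁻¹ * (h * (n * u * n⁻¹)) * n := by rw [this]
      _ = _ := by group
  have hHn' : ∀ h ∈ centralizer (R : Set G), n * h * n⁻¹ ∈ centralizer (R : Set G) := by
    intro h hh
    rw [mem_centralizer_iff]
    intro u hu
    have := mem_centralizer_iff.1 hh _ (hRn' u hu)
    calc u * (n * h * n⁻¹) = n * ((n⁻¹ * u * n) * h) * n⁻¹ := by group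
      _ = n * (h * (n⁻¹ * u * n)) * n⁻¹ := by rw [this]
      _ = _ := by group
  have hHB : ∀ h ∈ centralizer (R : Set G), θ h = 1 := by
    intro h hh
    by_contra hne
    have h1 := hnc.noncomm _ hne (hd h hh)
    have h2 := hd (n * h * n⁻¹ * h⁻¹) (mul_mem (hHn' h hh) (inv_mem hh))
    rw [map_mul, map_mul, map_mul, map_inv, map_inv] at h2
    exact h2 h1
  -- y
  have hyR : ∀ u ∈ R, φ u = y⁻¹ * u * y := fun u hu => hy u (hQ hu)
  have hcen : y * (φ n)⁻¹ * y⁻¹ * n ∈ centralizer (R : Set G) := by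
    rw [mem_centralizer_iff]
    intro u hu
    have h1 := hyR _ (hRn u hu)
    rw [map_mul, map_mul, map_inv, hyR u hu] at h1
    have h2 : n * u * n⁻¹ = y * (φ n * (y⁻¹ * u * y) * (φ n)⁻¹) * y⁻¹ := by rw [h1]; group
    have h3 : n * u = y * (φ n * (y⁻¹ * u * y) * (φ n)⁻¹) * y⁻¹ * n := by rw [← h2]; group
    calc u * (y * (φ n)⁻¹ * y⁻¹ * n) = y * (φ n)⁻¹ * y⁻¹ * (y * (φ n * (y⁻¹ * u * y) * (φ n)⁻¹) * y⁻¹ * n) := by group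
      _ = y * (φ n)⁻¹ * y⁻¹ * n * u := by rw [← h3]; simp only [mul_assoc]
  have hθy : θ y⁻¹ * θ n = θ n * θ y⁻¹ := by
    have h1 := hHB _ hcen
    rw [map_mul, map_mul, map_mul, map_inv θ (φ n), hφθ, map_inv] at h1
    have h2 : θ n = θ y * θ n * (θ y)⁻¹ := (eq_inv_of_mul_eq_one_right h1).trans (by group)
    rw [map_inv]
    calc (θ y)⁻¹ * θ n = (θ y)⁻¹ * (θ y * θ n * (θ y)⁻¹) := by rw [← h2]
      _ = _ := by group
  obtain ⟨i, hi⟩ := hnc.cent _ hθy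
  obtain ⟨κ, hκ, hφn⟩ : ∃ κ ∈ K, φ n = κ * n := ⟨φ n * n⁻¹, hφ1 n, by group⟩
  obtain ⟨l, hl, h, hh, hb⟩ := hU.norm (n := n) (b := (n ^ (i:ℕ))⁻¹ * y⁻¹) hnc
    (by rw [map_mul, hi, map_inv, map_pow, inv_mul_cancel]) (centralizer (R : Set G)) hHB hHn hcen
    (l1 := (n⁻¹ * y) * κ * (n⁻¹ * y)⁻¹) (hU.KL (hKn.conj_mem _ hκ _))
    (by
      have hc : n ^ (i:ℕ) * n⁻¹ = n⁻¹ * n ^ (i:ℕ) := ((Commute.refl n).pow_left _).inv_right.eq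
      calc ((n ^ (i:ℕ))⁻¹ * y⁻¹)⁻¹ * (n⁻¹ * ((n ^ (i:ℕ))⁻¹ * y⁻¹) * n)
          = y * (n ^ (i:ℕ) * n⁻¹) * (n ^ (i:ℕ))⁻¹ * y⁻¹ * n := by group
        _ = y * n⁻¹ * y⁻¹ * n := by rw [hc]; group
        _ = _ := by rw [hφn]; group)
  refine ⟨n, a, hn3, i, l, hl, ?_⟩
  have hy' : y⁻¹ = n ^ (i:ℕ) * l * h := by
    rw [mul_assoc, ← hb]; group
  rw [hyR k hPk]
  conv_lhs => rw [← inv_inv y]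
  rw [hy']
  have hhk : h * k = k * h := (mem_centralizer_iff.1 hh k hPk).symm
  calc _ = n ^ (i:ℕ) * l * (h * k) * h⁻¹ * (n ^ (i:ℕ) * l)⁻¹ := by group
    _ = _ := by rw [hhk]; group
end
end WSn

namespace WSn
open Subgroup
set_option linter.unusedSectionVars false

section
variable {G : Type*} [Group G] [Finite G] {S : Subgroup G} {n : ℕ} {w w' t : G} {K L : Subgroup G} {φ : MulAut G}
  {θ : G →* Equiv.Perm (Fin 3)}

lemma fin_triv (hodd : Odd (Nat.card K)) (h1 : ∀ k ∈ K, φ k = k) (h2 : ∀ g, φ g * g⁻¹ ∈ K)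
    (h3 : ∃ k, φ ^ 2 ^ k = 1) : φ = 1 := by
  ext g
  have key : ∀ N : ℕ, (φ ^ N) g = (φ g * g⁻¹) ^ N * g := by
    intro N
    induction N with
    | zero => simp
    | succ N ih =>
      rw [pow_succ', MulAut.mul_apply, ih, map_mul, h1 _ (Subgroup.pow_mem _ (h2 g) N), pow_succ]; group
  obtain ⟨k, hk⟩ := h3
  have h4 := key (2 ^ k)
  rw [hk] at h4
  have h5 : (φ g * g⁻¹) ^ 2 ^ k = 1 := by
    have : (1 : MulAut G) g = g := rfl
    rw [this] at h4
    exact (right_eq_mul.1 h4)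
  have ho : Odd (orderOf (φ g * g⁻¹)) := by
    have := OddG.odd_orderOf hodd ⟨_, h2 g⟩
    rwa [Subgroup.orderOf_mk] at this
  have := mem_of_odd_pow2 (⊥ : Subgroup G) ho (k := k) (by rw [h5]; exact one_mem _)
  have h6 : φ g * g⁻¹ = 1 := by simpa using this
  exact mul_inv_eq_one.1 h6

lemma conj_inv_apply' (ζ : G) (φ : MulAut G) (x : G) : ((MulAut.conj ζ)⁻¹ * φ) x = ζ⁻¹ * φ x * ζ := by
  rw [MulAut.mul_apply, ← map_inv, MulAut.conj_apply, inv_inv]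

lemma twist_comm (ζ : G) (φ : MulAut G) (h : φ ζ = ζ) : Commute (MulAut.conj ζ)⁻¹ φ := by
  ext x
  rw [conj_inv_apply', MulAut.mul_apply, ← map_inv, MulAut.conj_apply, map_mul, map_mul, map_inv, map_inv, h, map_inv, h, inv_inv]

lemma Ctx.twist (h : Ctx S n w w' t K φ) (m : ℤ) : Ctx S n w w' t K ((MulAut.conj (El w w' m m))⁻¹ * φ) := by
  have hz : El w w' m m ∈ S := El_mem h.ws m m
  refine ⟨h.ws, h.S2, h.Kn, h.Kodd, ?_, ?_, ?_, ?_⟩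
  · intro u hu
    rw [conj_inv_apply', h.φS u hu, (z_comm h.ws m hu).inv_left.eq]; group
  · intro x
    obtain ⟨g, hg⟩ := h.φc x
    exact ⟨(El w w' m m)⁻¹ * g, by rw [conj_inv_apply', hg]; group⟩
  · obtain ⟨k, hk⟩ := h.φ2
    obtain ⟨j, hj⟩ := h.S2 ⟨_, hz⟩
    have hj' : (El w w' m m) ^ 2 ^ j = 1 := congrArg Subtype.val hj
    refine ⟨j + k, ?_⟩
    rw [(twist_comm _ φ (h.φS _ hz)).mul_pow, inv_pow, ← map_pow, pow_add, pow_mul, hj', one_pow, map_one, inv_one,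
      one_mul, mul_comm, pow_mul, hk, one_pow]
  · intro k hk
    rw [conj_inv_apply']
    have := h.Kn.conj_mem _ (h.φK k hk) (El w w' m m)⁻¹
    rwa [inv_inv] at this

lemma twist_col (ζ : G) (h : IsColeman φ) : IsColeman ((MulAut.conj ζ)⁻¹ * φ) := by
  intro p hp P
  obtain ⟨y, hy⟩ := h p hp P
  exact ⟨y * ζ, fun u hu => by rw [conj_inv_apply', hy u hu]; group⟩

lemma twist_inn (ζ : G) (h : (MulAut.conj ζ)⁻¹ * φ ∈ innAut G) : φ ∈ innAut G := by
  have : φ = MulAut.conj ζ * ((MulAut.conj ζ)⁻¹ * φ) := by group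
  rw [this]
  exact Subgroup.mul_mem _ ⟨ζ, rfl⟩ h

lemma modK (S : Sylow 2 G) (h : Ctx (S : Subgroup G) n w w' t K φ) (N : Subgroup G) [hN : N.Normal] (hNS : N ≤ S)
    (hK : IsK N K)
    (hab : ∀ a ∈ S, a ∈ centralizer (N : Set G) → ∀ b ∈ S, b ∈ centralizer (N : Set G) → a * b = b * a) :
    ∃ m : ℤ, ∀ g, ((MulAut.conj (El w w' m m))⁻¹ * φ) g * g⁻¹ ∈ K := by
  have hKn := h.Kn
  have hCn : (centralizer (N : Set G)).Normal := inferInstance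
  have hf : Fact (Nat.Prime 2) := ⟨Nat.prime_two⟩
  let π : G →* G ⧸ K := QuotientGroup.mk' K
  have hπ : ∀ x, π x = 1 ↔ x ∈ K := fun x => QuotientGroup.eq_one_iff x
  have hrep : ∀ d ∈ (centralizer (N : Set G)).map π, ∃ s ∈ S, s ∈ centralizer (N : Set G) ∧ d = π s := by
    rintro _ ⟨x, hx, rfl⟩
    obtain ⟨κ, hκ, s, hs, rfl⟩ := le_KS S K (centralizer (N : Set G)) hK.two x hx
    refine ⟨s, hs, (Subgroup.mul_mem_cancel_left _ (hK.le hκ)).1 hx, ?_⟩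
    rw [map_mul, (hπ κ).2 hκ, one_mul]
  obtain ⟨e, he⟩ := (IsPGroup.iff_card).1 S.isPGroup'
  obtain ⟨b, hb, hbg⟩ := avg (π.comp φ.toMonoidHom) π S (by
      intro l hl
      show π (φ l) = π l
      rw [h.φS l hl]) ((centralizer (N : Set G)).map π) (by
      intro a ha b hb
      obtain ⟨s, hs, hsc, rfl⟩ := hrep a ha
      obtain ⟨s', hs', hsc', rfl⟩ := hrep b hb
      rw [← map_mul, hab s hs hsc s' hs' hsc', map_mul]) (by
      rintro g _ ⟨x, hx, rfl⟩
      exact ⟨g * x * g⁻¹, hCn.conj_mem x hx g, by simp⟩) (by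
      intro g
      refine ⟨φ g * g⁻¹, ?_, by simp⟩
      show φ g * g⁻¹ ∈ centralizer (N : Set G)
      rw [mem_centralizer_iff]
      intro u hu
      have h1 : g⁻¹ * u * g ∈ N := by
        have := hN.conj_mem u hu g⁻¹
        rwa [inv_inv] at this
      have h2 := h.φS _ (hNS h1)
      rw [map_mul, map_mul, map_inv, h.φS u (hNS hu)] at h2
      calc u * (φ g * g⁻¹) = φ g * ((φ g)⁻¹ * u * φ g) * g⁻¹ := by group
        _ = _ := by rw [h2]; group) e (by
      intro d hd
      obtain ⟨s, hs, -, rfl⟩ := hrep d hd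
      have : s ^ 2 ^ e = 1 := by
        have h1 := pow_cardK (K := (S : Subgroup G)) hs
        rwa [he] at h1
      rw [← map_pow, this, map_one]) (by
      have := S.not_dvd_index
      exact Nat.not_even_iff_odd.1 (fun hh => this hh.two_dvd))
  obtain ⟨s, hs, -, rfl⟩ := hrep b hb
  have hbg' : ∀ g, π (φ g) = π s * π g * (π s)⁻¹ := hbg
  obtain ⟨m, hm⟩ := center_form h.ws hs (by
    intro u hu
    have h1 := hbg' u
    rw [h.φS u hu] at h1
    have h2 : s * u * s⁻¹ * u⁻¹ ∈ K := by
      rw [← hπ, map_mul, map_mul, map_mul, map_inv, map_inv, ← h1, mul_inv_cancel]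
    have h3 := K_inter h.Kodd h.S2 h2 (mul_mem (mul_mem (mul_mem hs hu) (inv_mem hs)) (inv_mem hu))
    exact (mul_inv_eq_iff_eq_mul.1 (mul_inv_eq_one.1 h3)))
  refine ⟨m, fun g => ?_⟩
  rw [conj_inv_apply', ← hm, ← hπ, map_mul, map_mul, map_mul, hbg', map_inv, map_inv]
  group

lemma prime_inv {ρ : MulAut G} {x : G} (hx : x ≠ 1) (hρ : ρ x = x⁻¹) :
    ∃ p : ℕ, p.Prime ∧ ∃ i : ℕ, (x ^ i) ^ p = 1 ∧ x ^ i ≠ 1 ∧ ρ (x ^ i) = (x ^ i)⁻¹ := by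
  have h1 : orderOf x ≠ 1 := fun h => hx (orderOf_eq_one_iff.1 h)
  obtain ⟨p, hp, i, hi⟩ := Nat.exists_prime_and_dvd h1
  refine ⟨p, hp, i, ?_, ?_, by rw [map_pow, hρ, inv_pow]⟩
  · rw [← pow_mul, mul_comm, ← hi, pow_orderOf_eq_one]
  · intro h
    have h2 := orderOf_dvd_of_pow_eq_one h
    have h3 := orderOf_pos x
    rw [hi] at h2 h3
    have h4 := Nat.le_of_dvd (Nat.pos_of_mul_pos_left h3) h2
    have h5 := hp.two_le
    have h6 : 0 < i := Nat.pos_of_mul_pos_left h3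
    nlinarith

lemma U.inv_one (hU : U K L θ) (Z : G → Prop) (hZ : ∀ l ∈ L, ∃ ζ, Z ζ ∧ ∃ κ ∈ K, l = ζ * κ)
    (hZc : ∀ ζ, Z ζ → ∀ g, ζ⁻¹ * g * ζ * g⁻¹ ∈ K)
    (φ : MulAut G) (hφ1 : ∀ g, φ g * g⁻¹ ∈ K) (hφc : ∀ x, ∃ g, φ x = g * x * g⁻¹)
    (hCol : IsColeman φ) {p : ℕ} (hp : p.Prime) {k : G} (hk : k ∈ K) (hkp : k ^ p = 1) (M : ℕ)
    (hM : ∀ ζ, Z ζ → (((MulAut.conj ζ)⁻¹ * φ) ^ M) k = k⁻¹) : k = 1 := by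
  have hKn := hU.Kn
  obtain ⟨n, a, hn, i, l, hl, hkl⟩ := hU.perp φ hφ1 hφc hCol hp hk hkp
  obtain ⟨ζ, hζ, κ, hκ, rfl⟩ := hZ l hl
  have hτ : ∀ x, ((MulAut.conj ζ)⁻¹ * φ) x * x⁻¹ ∈ K := by
    intro x
    rw [conj_inv_apply']
    have h1 : ζ⁻¹ * φ x * ζ * x⁻¹ = (ζ⁻¹ * φ x * ζ * (φ x)⁻¹) * (φ x * x⁻¹) := by group
    rw [h1]
    exact K.mul_mem (hZc ζ hζ _) (hφ1 x)
  have hO : ∀ x ∈ zpowers n ⊔ K, Odd (orderOf x) := by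
    intro x hx
    obtain ⟨y, ⟨j, rfl⟩, z, hz, rfl⟩ := mem_sup_of_normal_right.1 hx
    have h1 : (n ^ j * z) ^ 3 ^ a ∈ K := by
      rw [← QuotientGroup.eq_one_iff, QuotientGroup.mk_pow, QuotientGroup.mk_mul, (QuotientGroup.eq_one_iff z).2 hz,
        mul_one, ← QuotientGroup.mk_pow, ← zpow_natCast, zpow_comm, zpow_natCast, hn, one_zpow]
      rfl
    have h2 : (n ^ j * z) ^ (3 ^ a * Nat.card K) = 1 := by
      rw [pow_mul]; exact pow_cardK h1
    exact odd_of_pow ((Odd.pow (by decide)).mul hU.Kodd) h2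
  have hKO : K ≤ zpowers n ⊔ K := le_sup_right
  have hnO : n ^ i ∈ zpowers n ⊔ K := (le_sup_left : zpowers n ≤ _) (pow_mem (mem_zpowers n) i)
  obtain ⟨o, ho, h1⟩ := OddG.conj_pow_aut ((MulAut.conj ζ)⁻¹ * φ) (zpowers n ⊔ K) (by
      intro x hx
      have := mul_mem (hKO (hτ x)) hx
      rwa [inv_mul_cancel_right] at this) (κ := ζ⁻¹ * n ^ i * ζ * (n ^ i)⁻¹ * n ^ i * κ) (k := k)
      (mul_mem (mul_mem (hKO (hZc ζ hζ _)) hnO) (hKO hκ))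
      (by rw [conj_inv_apply', hkl]; group) M
  rw [hM ζ hζ] at h1
  exact OddG.conj_inv_elt (hO o ho) (hO k (hKO hk)) h1.symm

end
end WSn

set_option linter.unusedSectionVars false
namespace WSn
open Subgroup

lemma Cyc.nofix : ∀ {σ : Equiv.Perm (Fin 3)}, Cyc σ → ∀ i, σ i ≠ i := by decide

lemma exists_theta {G X : Type*} [Group G] (act : G →* Equiv.Perm X) (pt : Fin 3 → X) (hinj : Function.Injective pt)
    (hcl : ∀ g i, ∃ j, act g (pt i) = pt j) :
    ∃ θ : G →* Equiv.Perm (Fin 3), ∀ g i, act g (pt i) = pt (θ g i) := by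
  choose f hf using hcl
  have h1 : ∀ i, f 1 i = i := by
    intro i; apply hinj; rw [← hf, map_one]; rfl
  have h2 : ∀ a b i, f (a * b) i = f a (f b i) := by
    intro a b i; apply hinj; rw [← hf, map_mul, Equiv.Perm.mul_apply, hf, hf]
  refine ⟨⟨⟨fun g => ⟨f g, f g⁻¹, fun i => ?_, fun i => ?_⟩, ?_⟩, ?_⟩, ?_⟩
  · rw [← h2, inv_mul_cancel, h1]
  · rw [← h2, mul_inv_cancel, h1]
  · ext i; simp [h1]
  · intro a b; ext i; simp [h2]
  · intro g i; exact hf g i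

lemma cyc_of_odd {σ : Equiv.Perm (Fin 3)} (h1 : σ ≠ 1) {m : ℕ} (hm : Odd m) (h2 : σ ^ m = 1) : Cyc σ := by
  refine ⟨h1, ?_⟩
  rcases Int.units_eq_one_or (Equiv.Perm.sign σ) with h | h
  · exact h
  · exfalso
    have h3 : Equiv.Perm.sign (σ ^ m) = 1 := by rw [h2, map_one]
    rw [map_pow, h, hm.neg_one_pow] at h3
    exact absurd h3 (by decide)

section
variable {G : Type*} [Group G] [Finite G] {S K : Subgroup G} {n : ℕ} {w w' t : G} {φ : MulAut G}

/-- if no nontrivial element of prime order of `K` is inverted by the last power, the automorphism is trivial on `K` -/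
lemma triv_of_no_inv (hKn : K.Normal) (hKodd : Odd (Nat.card K)) (hφK : ∀ k ∈ K, φ k ∈ K) (hφ2 : ∃ k : ℕ, φ ^ 2 ^ k = 1)
    (hno : ∀ j : ℕ, ∀ p : ℕ, p.Prime → ∀ k ∈ K, k ^ p = 1 → (φ ^ 2 ^ j) k = k⁻¹ → k = 1) : ∀ k ∈ K, φ k = k := by
  by_contra hcon
  push Not at hcon
  obtain ⟨k0, hk0, hne⟩ := hcon
  obtain ⟨e, he⟩ := hφ2
  have hf2 : (resAut φ K hφK) ^ 2 ^ e = 1 := by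
    ext x
    rw [resAut_pow, he]; rfl
  have hf1 : resAut φ K hφK ≠ 1 := by
    intro hh
    apply hne
    have := congrArg (fun f : MulAut K => ((f ⟨k0, hk0⟩ : K) : G)) hh
    exact this
  obtain ⟨j, hj⟩ := OddG.pow2_order hf2 hf1
  obtain ⟨x, hx, hx1⟩ := OddG.exists_inverted (K := K) ((resAut φ K hφK) ^ 2 ^ j) (OddG.half_sq hj) (OddG.half_ne hj)
  have hx' : (φ ^ 2 ^ j) (x : G) = (x : G)⁻¹ := by
    rw [← resAut_pow (h := hφK), hx]; rfl
  obtain ⟨p, hp, i, h1, h2, h3⟩ := prime_inv (ρ := φ ^ 2 ^ j) (x := (x : G)) (fun hh => hx1 (Subtype.ext hh)) hx'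
  exact h2 (hno j p hp _ (K.pow_mem x.2 i) h1 h3)

theorem caseA (S : Sylow 2 G) (h : Ctx (S : Subgroup G) n w w' t K φ) (hCol : IsColeman φ) (N : Subgroup G) [hN : N.Normal]
    (hNS : N ≤ S) (hK : IsK N K) (hc : El w w' (2 ^ (n-1)) (2 ^ (n-1)) ∈ N) (he : El w w' (2 ^ (n-1)) 0 ∈ N)
    (he' : El w w' 0 (2 ^ (n-1)) ∈ N)
    (hall : ∀ x ∈ N, x = 1 ∨ x = El w w' (2 ^ (n-1)) (2 ^ (n-1)) ∨ x = El w w' (2 ^ (n-1)) 0 ∨ x = El w w' 0 (2 ^ (n-1)))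
    {d : G} (hd : Odd (orderOf d)) (hdc : d ∉ centralizer (N : Set G)) : φ ∈ innAut G := by
  have hKn := h.Kn
  have hn := h.ws.hn
  have hhalf : ¬ (2 ^ n : ℤ) ∣ 2 ^ (n-1) := by
    intro hh
    have h1 : (2:ℤ) ^ n = 2 * 2 ^ (n-1) := by rw [← pow_succ']; congr 1; omega
    have h2 := Int.le_of_dvd (by positivity) hh
    have h3 : (0:ℤ) < 2 ^ (n-1) := by positivity
    omega
  let pt : Fin 3 → G := ![El w w' (2 ^ (n-1)) (2 ^ (n-1)), El w w' (2 ^ (n-1)) 0, El w w' 0 (2 ^ (n-1))]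
  have p0 : pt 0 = El w w' (2 ^ (n-1)) (2 ^ (n-1)) := rfl
  have p1 : pt 1 = El w w' (2 ^ (n-1)) 0 := rfl
  have p2 : pt 2 = El w w' 0 (2 ^ (n-1)) := rfl
  have hptN : ∀ i, pt i ∈ N := by intro i; fin_cases i <;> assumption
  have hpt1 : ∀ i, pt i ≠ 1 := by
    intro i
    fin_cases i
    · intro hh; exact hhalf ((El_eq_one h.ws _ _).1 hh).1
    · intro hh; exact hhalf ((El_eq_one h.ws _ _).1 hh).1
    · intro hh; exact hhalf ((El_eq_one h.ws _ _).1 hh).2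
  have hall' : ∀ x ∈ N, x ≠ 1 → ∃ i, x = pt i := by
    intro x hx hx1
    rcases hall x hx with h1 | h1 | h1 | h1
    · exact absurd h1 hx1
    · exact ⟨0, h1⟩
    · exact ⟨1, h1⟩
    · exact ⟨2, h1⟩
  have hne : ∀ i j : Fin 3, i < j → pt i ≠ pt j := by
    intro i j hij hh
    fin_cases i <;> fin_cases j <;> first | exact absurd hij (by decide) | skip
    · have := ((El_inj h.ws _ _ _ _).1 hh).2; rw [sub_zero] at this; exact hhalf this
    · have := ((El_inj h.ws _ _ _ _).1 hh).1; rw [sub_zero] at this; exact hhalf this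
    · have := ((El_inj h.ws _ _ _ _).1 hh).1; rw [sub_zero] at this; exact hhalf this
  have hinj : Function.Injective pt := by
    intro i j hij
    rcases lt_trichotomy i j with h1 | h1 | h1
    · exact absurd hij (hne i j h1)
    · exact h1
    · exact absurd hij.symm (hne j i h1)
  obtain ⟨θ, hθ⟩ := exists_theta ((MulAut.toPerm G).comp MulAut.conj) pt hinj (by
    intro g i
    apply hall' (g * pt i * g⁻¹) (hN.conj_mem _ (hptN i) g)
    intro hh
    exact hpt1 i (conj_eq_one_iff.1 hh))
  have hθ' : ∀ g i, g * pt i * g⁻¹ = pt (θ g i) := hθ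
  have hθ1 : ∀ g, θ g = 1 ↔ g ∈ centralizer (N : Set G) := by
    intro g
    rw [mem_centralizer_iff]
    constructor
    · intro hg x hx
      by_cases hx1 : x = 1
      · rw [hx1]; group
      · obtain ⟨i, rfl⟩ := hall' x hx hx1
        have := hθ' g i
        rw [hg, Equiv.Perm.one_apply] at this
        exact (mul_inv_eq_iff_eq_mul.1 this).symm
    · intro hg
      ext i
      congr 1
      apply hinj
      rw [← hθ', ← hg _ (hptN i), mul_inv_cancel_right]; rfl
  have hdec : ∀ x, θ x = 1 → ∃ κ ∈ K, ∃ p q : ℤ, x = κ * El w w' p q := by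
    intro x hx
    obtain ⟨κ, hκ, s, hs, rfl⟩ := le_KS S K _ hK.two x ((hθ1 x).1 hx)
    have hs' := (Subgroup.mul_mem_cancel_left _ (hK.le hκ)).1 ((hθ1 _).1 hx)
    obtain ⟨p, q, rfl⟩ := cent_base h.ws (x := 2 ^ (n-1)) (y := 0) (by rwa [sub_zero]) hs (mem_centralizer_iff.1 hs' _ he).symm
    exact ⟨κ, hκ, p, q, rfl⟩
  let π : G →* G ⧸ K := QuotientGroup.mk' K
  have hπ : ∀ x, π x = 1 ↔ x ∈ K := fun x => QuotientGroup.eq_one_iff x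
  have hU : U K K θ := by
    refine ⟨h.Kn, h.Kodd, h.Kn, le_refl _, fun l hl => (hθ1 l).2 (hK.le hl), ?_, fun b hb => hK.two b ((hθ1 b).1 hb), ?_, ?_⟩
    · intro a b ha hb
      obtain ⟨κ, hκ, p, q, rfl⟩ := hdec a ha
      obtain ⟨κ', hκ', p', q', rfl⟩ := hdec b hb
      rw [← hπ]
      simp only [map_mul, map_inv, (hπ _).2 hκ, (hπ _).2 hκ', one_mul]
      rw [← map_mul, (El_comm h.ws p q p' q').eq, map_mul]; group
    · intro m x hm hx hmx
      obtain ⟨κ, hκ, p, q, rfl⟩ := hdec x hx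
      apply K.mul_mem hκ
      by_contra hcon
      have ha1 : El w w' p q ≠ 1 := fun hh => hcon (by rw [hh]; exact K.one_mem)
      have haS := El_mem h.ws p q
      obtain ⟨e, he2⟩ := h.S2 ⟨_, haS⟩
      have he2' : (El w w' p q) ^ 2 ^ e = 1 := congrArg Subtype.val he2
      obtain ⟨j, hj⟩ := OddG.pow2_order he2' ha1
      have hb1 := OddG.half_sq hj
      have hb2 := OddG.half_ne hj
      have hb3 : (El w w' p q) ^ 2 ^ j = El w w' ((2 ^ j : ℕ) * p) ((2 ^ j : ℕ) * q) := by
        rw [← zpow_natCast, El_zpow h.ws]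
      have hcm : π m * π (El w w' p q) = π (El w w' p q) * π m := by
        have := (hπ _).2 hmx
        simp only [map_mul, map_inv, (hπ _).2 hκ, one_mul] at this
        rw [mul_inv_eq_one, mul_inv_eq_iff_eq_mul] at this
        exact this
      have hcm' : m * (El w w' p q) ^ 2 ^ j * m⁻¹ * ((El w w' p q) ^ 2 ^ j)⁻¹ ∈ K := by
        rw [← hπ, map_mul, map_mul, map_mul, map_inv, map_inv, map_pow, mul_inv_eq_one, mul_inv_eq_iff_eq_mul]
        exact (Commute.pow_right (show Commute (π m) _ from hcm) _)
      have hi : ∃ i, (El w w' p q) ^ 2 ^ j = pt i := by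
        rw [hb3] at hb1 hb2 ⊢
        rcases invol_base h.ws hb1 with h1 | h1 | h1 | h1
        · exact absurd h1 hb2
        · exact ⟨0, h1⟩
        · exact ⟨1, h1⟩
        · exact ⟨2, h1⟩
      obtain ⟨i, hi⟩ := hi
      rw [hi] at hcm'
      have h5 := K_inter h.Kodd h.S2 hcm' (mul_mem (hNS (hN.conj_mem _ (hptN i) m)) (inv_mem (hNS (hptN i))))
      rw [mul_inv_eq_one, hθ'] at h5
      exact hm.nofix i (hinj h5)
    · refine ⟨d, cyc_of_odd (fun hh => hdc ((hθ1 d).1 hh)) hd ?_⟩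
      rw [← map_pow, pow_orderOf_eq_one, map_one]
  obtain ⟨m, hm⟩ := modK S h N hNS hK (by
    intro a ha hac b hb hbc
    obtain ⟨p, q, rfl⟩ := cent_base h.ws (x := 2 ^ (n-1)) (y := 0) (by rwa [sub_zero]) ha (mem_centralizer_iff.1 hac _ he).symm
    obtain ⟨p', q', rfl⟩ := cent_base h.ws (x := 2 ^ (n-1)) (y := 0) (by rwa [sub_zero]) hb (mem_centralizer_iff.1 hbc _ he).symm
    exact (El_comm h.ws _ _ _ _).eq)
  apply twist_inn (El w w' m m)
  have h' := h.twist m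
  have hCol' := twist_col (El w w' m m) hCol
  generalize (MulAut.conj (El w w' m m))⁻¹ * φ = ψ at h' hCol' hm ⊢
  have htriv := triv_of_no_inv h'.Kn h'.Kodd h'.φK h'.φ2 (by
    intro j p hp k hk hkp hinv
    refine hU.inv_one (fun ζ => ζ = 1) (fun l hl => ⟨1, rfl, l, hl, by rw [one_mul]⟩) ?_ ψ hm h'.φc hCol' hp hk hkp (2 ^ j) ?_
    · rintro _ rfl g
      have : (1:G)⁻¹ * g * 1 * g⁻¹ = 1 := by group
      rw [this]; exact K.one_mem
    · rintro _ rfl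
      rw [map_one, inv_one, one_mul, hinv])
  rw [fin_triv h'.Kodd htriv hm h'.φ2]
  exact one_mem _

end
end WSn

set_option linter.unusedSectionVars false
namespace WSn
open Subgroup

lemma card_W (n : ℕ) : Nat.card (Wreathed.W n) = 2 ^ (2 * n + 1) := by
  have h : Nat.card (Wreathed.W n) = Nat.card ((Multiplicative (ZMod (2^n)) × Multiplicative (ZMod (2^n))) × Multiplicative (ZMod 2)) :=
    Nat.card_congr SemidirectProduct.equivProd
  rw [h, Nat.card_prod, Nat.card_prod]
  have h1 : ∀ m, Nat.card (Multiplicative (ZMod m)) = m := fun m => Nat.card_zmod m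
  rw [h1, h1]; ring

section
variable {G : Type*} [Group G] [Finite G] {K : Subgroup G} {n : ℕ} {w w' t : G} {φ : MulAut G}

lemma exists_ctx (hn : 2 ≤ n) (hW : ∀ P : Sylow 2 G, Nonempty ((P : Subgroup G) ≃* Wreathed.W n))
    (S : Sylow 2 G) (ws : WS (S : Subgroup G) n w w' t) (hφS : ∀ u ∈ S, φ u = u) (hφc : ∀ x, ∃ g, φ x = g * x * g⁻¹)
    (hφ2 : ∃ k : ℕ, φ ^ 2 ^ k = 1) (N : Subgroup G) [hN : N.Normal] (hNS : N ≤ S)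
    (hnc : ¬ N ≤ centralizer ((S : Subgroup G) : Set G)) :
    ∃ K, IsK N K ∧ Ctx (S : Subgroup G) n w w' t K φ := by
  have hN2 : IsPGroup 2 N := S.isPGroup'.to_le hNS
  obtain ⟨K, hK⟩ := exists_K n hn hW S N hN2 hnc
  refine ⟨K, hK, ws, S.isPGroup', hK.normal, hK.odd, hφS, hφc, hφ2, ?_⟩
  intro k hk
  apply hK.all
  · rw [mem_centralizer_iff]
    intro u hu
    have h1 := mem_centralizer_iff.1 (hK.le hk) u hu
    have h2 := congrArg φ h1
    rwa [map_mul, map_mul, hφS u (hNS hu)] at h2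
  · rw [MulEquiv.orderOf_eq]
    exact odd_of_pow hK.odd (pow_cardK hk)

lemma card_bound (hW : ∀ P : Sylow 2 G, Nonempty ((P : Subgroup G) ≃* Wreathed.W n)) (S : Sylow 2 G)
    (hK : Odd (Nat.card K)) (hG : Nat.card G ≤ 7200) : 2 ^ (2 * n + 1) * Nat.card K ≤ 7200 := by
  obtain ⟨e⟩ := hW S
  have h1 : Nat.card (S : Subgroup G) = 2 ^ (2 * n + 1) := by
    rw [Nat.card_congr e.toEquiv, card_W]
  have h2 := Subgroup.card_subgroup_dvd_card (S : Subgroup G)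
  have h3 := Subgroup.card_subgroup_dvd_card K
  rw [h1] at h2
  exact (Nat.le_of_dvd Nat.card_pos (((Nat.coprime_two_left.2 hK).pow_left _).mul_dvd_of_dvd_of_dvd h2 h3)).trans hG

theorem abelianCase (hn : 2 ≤ n) (hW : ∀ P : Sylow 2 G, Nonempty ((P : Subgroup G) ≃* Wreathed.W n))
    (S : Sylow 2 G) (ws : WS (S : Subgroup G) n w w' t) (hφS : ∀ u ∈ S, φ u = u) (hφc : ∀ x, ∃ g, φ x = g * x * g⁻¹)
    (hφ2 : ∃ k : ℕ, φ ^ 2 ^ k = 1) (hCol : IsColeman φ) (hG : Nat.card G ≤ 7200)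
    (N : Subgroup G) [hN : N.Normal] (hNS : N ≤ S)
    (hnc : ¬ N ≤ centralizer ((S : Subgroup G) : Set G)) (hab : ∀ a ∈ N, ∀ b ∈ N, a * b = b * a) : φ ∈ innAut G := by
  obtain ⟨K, hK, h⟩ := exists_ctx hn hW S ws hφS hφc hφ2 N hNS hnc
  obtain ⟨x, y, hr, hxy⟩ := exists_r ws N hNS hnc
  rcases odd_or_top S N K hK with htop | ⟨d, hd, hdc⟩
  · exact caseI h htop (card_bound hW S hK.odd hG) N hK.le hr hxy
  have hNA : ∀ a ∈ N, ∃ p q, a = El w w' p q := fun a ha => cent_base ws hxy (hNS ha) (hab a ha _ hr)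
  obtain ⟨a, haN, ha2, had⟩ : ∃ a ∈ N, a * a = 1 ∧ d * a * d⁻¹ ≠ a := by
    by_contra hcon
    push Not at hcon
    apply hdc
    rw [mem_centralizer_iff]
    intro u hu
    obtain ⟨k, hk⟩ := S.isPGroup' ⟨u, hNS hu⟩
    have hk' : u ^ 2 ^ k = 1 := congrArg Subtype.val hk
    exact (mul_inv_eq_iff_eq_mul.1 (odd_fix hd N hab (fun a ha => hN.conj_mem a ha d) hcon k u hu hk')).symm
  let Ω : Subgroup G :=
    { carrier := {x | x ∈ N ∧ x * x = 1}
      one_mem' := ⟨N.one_mem, one_mul 1⟩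
      mul_mem' := by
        rintro a b ⟨ha, ha'⟩ ⟨hb, hb'⟩
        refine ⟨N.mul_mem ha hb, ?_⟩
        calc a * b * (a * b) = a * (b * a) * b := by group
          _ = (a * a) * (b * b) := by rw [hab b hb a ha]; group
          _ = 1 := by rw [ha', hb', one_mul]
      inv_mem' := by
        rintro a ⟨ha, ha'⟩
        exact ⟨N.inv_mem ha, by rw [← mul_inv_rev, ha', inv_one]⟩ }
  have hΩ : ∀ x, x ∈ Ω ↔ x ∈ N ∧ x * x = 1 := fun x => Iff.rfl
  have hΩn : Ω.Normal := ⟨by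
    rintro x ⟨hx, hx2⟩ g
    refine ⟨hN.conj_mem x hx g, ?_⟩
    calc g * x * g⁻¹ * (g * x * g⁻¹) = g * (x * x) * g⁻¹ := by group
      _ = 1 := by rw [hx2]; group⟩
  have hΩS : Ω ≤ S := fun x hx => hNS hx.1
  have hall : ∀ x ∈ Ω, x = 1 ∨ x = El w w' (2 ^ (n-1)) (2 ^ (n-1)) ∨ x = El w w' (2 ^ (n-1)) 0 ∨ x = El w w' 0 (2 ^ (n-1)) := by
    rintro x ⟨hx, hx2⟩
    obtain ⟨p, q, rfl⟩ := hNA x hx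
    exact invol_base ws hx2
  have hn2 : (2:ℤ) ^ n = 2 * 2 ^ (n-1) := by rw [← pow_succ']; congr 1; omega
  have hcΩ : El w w' (2 ^ (n-1)) (2 ^ (n-1)) ∈ Ω := by
    refine ⟨(exists_c ws N hr hxy).1, ?_⟩
    rw [El_mul ws, El_eq_one ws, hn2, ← two_mul]; exact ⟨dvd_rfl, dvd_rfl⟩
  have hadΩ : d * a * d⁻¹ ∈ Ω := hΩn.conj_mem a ⟨haN, ha2⟩ d
  have hsw : ∀ p q, El w w' p q ∈ Ω → El w w' q p ∈ Ω := by
    intro p q hp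
    have h1 := hΩn.conj_mem _ hp t
    rwa [t_El ws, mul_inv_cancel_right] at h1
  have hee : El w w' (2 ^ (n-1)) 0 ∈ Ω := by
    have haΩ : a ∈ Ω := ⟨haN, ha2⟩
    rcases hall a haΩ with h1 | h1 | h1 | h1
    · exfalso; apply had; rw [h1]; group
    · rcases hall _ hadΩ with h2 | h2 | h2 | h2
      · exfalso; apply had
        rw [conj_eq_one_iff.1 h2]; group
      · exfalso; apply had; rw [h2, h1]
      · rwa [h2] at hadΩ
      · rw [h2] at hadΩ; exact hsw _ _ hadΩ
    · rwa [h1] at haΩ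
    · rw [h1] at haΩ; exact hsw _ _ haΩ
  have hncΩ : ¬ Ω ≤ centralizer ((S : Subgroup G) : Set G) := by
    intro hle
    have h1 := mem_centralizer_iff.1 (hle hee) t ws.ht
    have h2 := comm_t_iff ws (2 ^ (n-1)) 0 (x := 0) (y := 0) (by
      rw [El_zero, one_mul]; exact h1.symm)
    rw [sub_zero, hn2] at h2
    have h3 := Int.le_of_dvd (by positivity) h2
    have h4 : (0:ℤ) < 2 ^ (n-1) := by positivity
    omega
  obtain ⟨K', hK', h'⟩ := exists_ctx hn hW S ws hφS hφc hφ2 Ω hΩS hncΩ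
  refine caseA S h' hCol Ω hΩS hK' hcΩ hee (hsw _ _ hee) hall hd ?_
  intro hdΩ
  apply had
  rw [← mem_centralizer_iff.1 hdΩ a ⟨haN, ha2⟩, mul_inv_cancel_right]

end
end WSn

set_option linter.unusedSectionVars false
namespace WSn
open Subgroup

section
variable {G : Type*} [Group G] [Finite G] {K : Subgroup G} {n : ℕ} {w w' t : G} {φ : MulAut G}

lemma gen_top (S : Sylow 2 G) (H : Subgroup G) [hH : H.Normal] (hS : ∀ s ∈ S, s ∈ H)
    (hodd : ∀ g, Odd (orderOf g) → g ∈ H) (g : G) : g ∈ H := by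
  have hf : Fact (Nat.Prime 2) := ⟨Nat.prime_two⟩
  have h1 : Odd H.index := by
    have h2 : H.index ∣ (S : Subgroup G).index := Subgroup.index_dvd_of_le hS
    have h3 : Odd (S : Subgroup G).index := Nat.not_even_iff_odd.1 (fun hh => S.not_dvd_index hh.two_dvd)
    exact h3.of_dvd_nat h2
  obtain ⟨k, m, hm, h2, -⟩ := split2 g
  exact mem_of_coprime H ((Nat.coprime_two_left.2 h1).pow_left k) (hodd _ (odd_of_pow hm h2)) (Subgroup.pow_index_mem H g)

lemma swap_or : ∀ σ τ : Equiv.Perm (Fin 3), σ 0 = 0 → σ ≠ 1 → τ 0 = 0 → τ = 1 ∨ τ = σ := by decide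

structure QC (S : Subgroup G) (w w' t : G) (N : Subgroup G) (a b : ℤ) : Prop where
  ws : WS S 2 w w' t
  nS : N ≤ S
  hv : El w w' 1 (-1) ∈ N
  hq : El w w' a b * t ∈ N
  ev : ∀ x y, El w w' x y ∈ N → (2:ℤ) ∣ x - y
  com : ∀ x ∈ N, ∀ y ∈ N, x * y * x⁻¹ * y⁻¹ ∈ centralizer (N : Set G)

variable {S N : Subgroup G} {a b : ℤ}

lemma QC.diag (Q : QC S w w' t N a b) {s : G} (hs : s ∈ S) (hc : s ∈ centralizer (N : Set G)) : ∃ m, s = El w w' m m := by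
  obtain ⟨x, y, rfl⟩ := cent_base Q.ws (x := 1) (y := -1) (by norm_num) hs (mem_centralizer_iff.1 hc _ Q.hv).symm
  exact ⟨y, El_diag Q.ws (comm_t_iff Q.ws x y (mem_centralizer_iff.1 hc _ Q.hq).symm)⟩

lemma QC.diag_mem (Q : QC S w w' t N a b) (m : ℤ) : El w w' m m ∈ centralizer (N : Set G) := by
  rw [mem_centralizer_iff]
  intro u hu
  exact (z_comm Q.ws m (Q.nS hu)).eq.symm

lemma QC.even_mem (Q : QC S w w' t N a b) (m : ℤ) : El w w' (2 * m) (2 * m) ∈ N := by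
  have h1 : El w w' (2 * m) (2 * m) = (El w w' 1 (-1)) ^ (2 * m) := by
    rw [El_zpow Q.ws, El_inj Q.ws]
    refine ⟨by simp, ⟨m, by ring⟩⟩
  rw [h1]; exact N.zpow_mem Q.hv _

lemma QC.invol (Q : QC S w w' t N a b) {m : ℤ} (h : El w w' m m * El w w' m m = 1) : El w w' m m = 1 ∨ El w w' m m = El w w' 2 2 := by
  rw [El_mul Q.ws, El_eq_one Q.ws] at h
  obtain ⟨c, hc⟩ := h.1
  rw [El_eq_one Q.ws, El_inj Q.ws]
  norm_num at hc ⊢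
  omega

/-- elements of `N` modulo the centralizer -/
lemma QC.four (Q : QC S w w' t N a b) {x : G} (hx : x ∈ N) :
    ∃ m : ℤ, El w w' m m ∈ N ∧ (x = El w w' m m ∨ x = El w w' m m * El w w' 1 (-1) ∨ x = El w w' m m * (El w w' a b * t) ∨
      x = El w w' m m * (El w w' 1 (-1) * (El w w' a b * t))) := by
  have key : ∀ x y, El w w' x y ∈ N → ∃ m : ℤ, El w w' m m ∈ N ∧ (El w w' x y = El w w' m m ∨ El w w' x y = El w w' m m * El w w' 1 (-1)) := by
    intro x y hxy
    have h1 := Q.ev x y hxy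
    by_cases h2 : (4:ℤ) ∣ x - y
    · have h3 : El w w' x y = El w w' y y := El_diag Q.ws (by norm_num; exact h2)
      exact ⟨y, h3 ▸ hxy, Or.inl h3⟩
    · have h3 : El w w' x y = El w w' (y + 1) (y + 1) * El w w' 1 (-1) := by
        rw [El_mul Q.ws, El_inj Q.ws]
        norm_num
        omega
      refine ⟨y + 1, ?_, Or.inr h3⟩
      have h4 : El w w' (y + 1) (y + 1) = El w w' x y * (El w w' 1 (-1))⁻¹ := by rw [h3]; group
      rw [h4]; exact N.mul_mem hxy (N.inv_mem Q.hv)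
  obtain ⟨p, q, h1 | h1⟩ := Q.ws.form x (Q.nS hx)
  · have h1' : x = El w w' p q := h1
    obtain ⟨m, hm, h2⟩ := key p q (h1' ▸ hx)
    refine ⟨m, hm, ?_⟩
    rw [h1']
    tauto
  · have h1' : x = El w w' (p - a) (q - b) * (El w w' a b * t) := by
      rw [← mul_assoc, El_mul Q.ws, h1]; unfold El; simp
    obtain ⟨m, hm, h2 | h2⟩ := key (p - a) (q - b) (by
      have : El w w' (p - a) (q - b) = x * (El w w' a b * t)⁻¹ := by rw [h1']; group
      rw [this]; exact N.mul_mem hx (N.inv_mem Q.hq))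
    · exact ⟨m, hm, Or.inr (Or.inr (Or.inl (by rw [h1', h2])))⟩
    · exact ⟨m, hm, Or.inr (Or.inr (Or.inr (by rw [h1', h2, mul_assoc])))⟩

lemma QC.qv (Q : QC S w w' t N a b) : (El w w' a b * t) * El w w' 1 (-1) * (El w w' a b * t)⁻¹ = El w w' 1 (-1) * El w w' 2 2 := by
  rw [mul_inv_eq_iff_eq_mul, mul_assoc, t_El Q.ws, ← mul_assoc, ← mul_assoc, El_mul Q.ws, El_mul Q.ws, El_mul Q.ws]
  congr 1
  rw [El_inj Q.ws]
  constructor <;> norm_num <;> omega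

lemma QC.vq (Q : QC S w w' t N a b) : El w w' 1 (-1) * (El w w' a b * t) * (El w w' 1 (-1))⁻¹ = (El w w' a b * t) * El w w' 2 2 := by
  rw [mul_inv_eq_iff_eq_mul, mul_assoc (_ * t), El_mul Q.ws, mul_assoc, t_El Q.ws, ← mul_assoc, ← mul_assoc, El_mul Q.ws, El_mul Q.ws]
  congr 1
  rw [El_inj Q.ws]
  constructor <;> norm_num <;> omega

lemma QC.wq (Q : QC S w w' t N a b) : w * (El w w' a b * t) * w⁻¹ = El w w' 1 (-1) * (El w w' a b * t) := by
  have h1 : w = El w w' 1 0 := by simp [El]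
  have h2 : El w w' 1 0 * (El w w' a b * t) * (El w w' 1 0)⁻¹ = El w w' 1 (-1) * (El w w' a b * t) := by
    rw [mul_inv_eq_iff_eq_mul, mul_assoc (El w w' 1 (-1)), mul_assoc, t_El Q.ws, ← mul_assoc, ← mul_assoc, ← mul_assoc, El_mul Q.ws, El_mul Q.ws, El_mul Q.ws]
    congr 1
    rw [El_inj Q.ws]
    constructor <;> norm_num
  rwa [← h1] at h2

lemma QC.sqv (Q : QC S w w' t N a b) : El w w' 1 (-1) * El w w' 1 (-1) = El w w' 2 2 := by
  rw [El_mul Q.ws, El_inj Q.ws]; norm_num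

lemma QC.sqq (Q : QC S w w' t N a b) : (El w w' a b * t) * (El w w' a b * t) = El w w' (a + b) (a + b) := by
  rw [mul_assoc, ← mul_assoc t, t_El Q.ws, mul_assoc, Q.ws.tt, mul_one, El_mul Q.ws, add_comm b a]

end
end WSn

set_option linter.unusedSectionVars false
namespace WSn
open Subgroup

section
variable {G : Type*} [Group G] [Finite G] {K : Subgroup G} {w w' t : G} {φ : MulAut G} {N : Subgroup G} {a b : ℤ}

lemma QC.cen (S : Sylow 2 G) (Q : QC (S : Subgroup G) w w' t N a b) [hN : N.Normal] {x : G} (hx : x ∈ N)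
    (hxc : x ∈ centralizer (N : Set G)) (g : G) : g * x * g⁻¹ = x := by
  let Zn : Subgroup G := N ⊓ centralizer (N : Set G)
  have hZn : Zn.Normal := inferInstance
  have hd : ∀ x ∈ Zn, ∃ m, x = El w w' m m := fun x hx => Q.diag (Q.nS hx.1) hx.2
  have hc2 : El w w' 2 2 ∈ Zn := ⟨Q.even_mem 1, Q.diag_mem 2⟩
  have key := gen_top S (centralizer (Zn : Set G)) (by
    intro s hs
    rw [mem_centralizer_iff]
    intro u hu
    obtain ⟨m, rfl⟩ := hd u hu
    exact (z_comm Q.ws m hs).eq) (by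
    intro g hg
    rw [mem_centralizer_iff]
    intro u hu
    obtain ⟨k, hk⟩ := S.isPGroup' ⟨u, Q.nS hu.1⟩
    have hk' : u ^ 2 ^ k = 1 := congrArg Subtype.val hk
    refine (mul_inv_eq_iff_eq_mul.1 (odd_fix hg Zn ?_ (fun a ha => hZn.conj_mem a ha g) ?_ k u hu hk')).symm
    · intro a ha b hb
      exact (mem_centralizer_iff.1 hb.2 a ha.1)
    · intro a ha ha2
      have hthis : ∀ y ∈ Zn, y * y = 1 → y = 1 ∨ y = El w w' 2 2 := by
        intro y hy hy2
        obtain ⟨m, rfl⟩ := hd y hy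
        exact Q.invol hy2
      rcases hthis a ha ha2 with h1 | h1
      · rw [h1]; group
      · rcases hthis (g * a * g⁻¹) (hZn.conj_mem a ha g) (by
          calc g * a * g⁻¹ * (g * a * g⁻¹) = g * (a * a) * g⁻¹ := by group
            _ = 1 := by rw [ha2]; group) with h2 | h2
        · rw [conj_eq_one_iff.1 h2]; group
        · rw [h2, h1]) g
  rw [← mem_centralizer_iff.1 key x ⟨hx, hxc⟩, mul_inv_cancel_right]

lemma QC.cent_gen (S : Sylow 2 G) (Q : QC (S : Subgroup G) w w' t N a b) [hN : N.Normal] {g : G}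
    (h1 : g * El w w' 1 (-1) * g⁻¹ = El w w' 1 (-1)) (h2 : g * (El w w' a b * t) * g⁻¹ = El w w' a b * t) :
    g ∈ centralizer (N : Set G) := by
  have h1' : Commute g (El w w' 1 (-1)) := mul_inv_eq_iff_eq_mul.1 h1
  have h2' : Commute g (El w w' a b * t) := mul_inv_eq_iff_eq_mul.1 h2
  rw [mem_centralizer_iff]
  intro u hu
  obtain ⟨m, hm, h3⟩ := Q.four hu
  have h4 : Commute g (El w w' m m) := mul_inv_eq_iff_eq_mul.1 (Q.cen S hm (Q.diag_mem m) g)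
  have h5 : Commute g u := by
    rcases h3 with h3 | h3 | h3 | h3 <;> rw [h3]
    · exact h4
    · exact h4.mul_right h1'
    · exact h4.mul_right h2'
    · exact h4.mul_right (h1'.mul_right h2')
  exact h5.eq.symm

lemma QC.dec0 (S : Sylow 2 G) (Q : QC (S : Subgroup G) w w' t N a b) [hN : N.Normal] {x y : G} (hy : y ∈ N)
    (h1 : x * El w w' 1 (-1) * x⁻¹ = y * El w w' 1 (-1) * y⁻¹)
    (h2 : x * (El w w' a b * t) * x⁻¹ = y * (El w w' a b * t) * y⁻¹) :
    ∃ y ∈ N, ∃ l ∈ centralizer (N : Set G), x = y * l := by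
  refine ⟨y, hy, y⁻¹ * x, ?_, by group⟩
  have key : ∀ u, x * u * x⁻¹ = y * u * y⁻¹ → (y⁻¹ * x) * u * (y⁻¹ * x)⁻¹ = u := by
    intro u hu
    calc (y⁻¹ * x) * u * (y⁻¹ * x)⁻¹ = y⁻¹ * (x * u * x⁻¹) * y := by group
      _ = u := by rw [hu]; group
  exact Q.cent_gen S (key _ h1) (key _ h2)

lemma QC.dec (S : Sylow 2 G) (Q : QC (S : Subgroup G) w w' t N a b) [hN : N.Normal] {x : G}
    (h1 : (El w w' 1 (-1))⁻¹ * (x * El w w' 1 (-1) * x⁻¹) ∈ N ⊓ centralizer (N : Set G))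
    (h2 : (El w w' a b * t)⁻¹ * (x * (El w w' a b * t) * x⁻¹) ∈ N ⊓ centralizer (N : Set G)) :
    ∃ y ∈ N, ∃ l ∈ centralizer (N : Set G), x = y * l := by
  have key : ∀ u ∈ N, u * u ∈ centralizer (N : Set G) → u⁻¹ * (x * u * x⁻¹) ∈ N ⊓ centralizer (N : Set G) →
      x * u * x⁻¹ = u ∨ x * u * x⁻¹ = u * El w w' 2 2 := by
    intro u hu huu hz
    obtain ⟨m, hm⟩ := Q.diag (Q.nS hz.1) hz.2
    have h3 : x * u * x⁻¹ = u * El w w' m m := by rw [← hm]; group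
    have h4 : u * u = (u * El w w' m m) * (u * El w w' m m) := by
      rw [← h3]
      calc u * u = x * (u * u) * x⁻¹ := (Q.cen S (N.mul_mem hu hu) huu x).symm
        _ = _ := by group
    have h5 : El w w' m m * El w w' m m = 1 := by
      rw [mul_assoc, ← mul_assoc _ u, (z_comm Q.ws m (Q.nS hu)).eq, mul_assoc u, ← mul_assoc u u] at h4
      exact left_eq_mul.1 h4
    rcases Q.invol h5 with h6 | h6
    · left; rw [h3, h6, mul_one]
    · right; rw [h3, h6]
  have hcC := Q.diag_mem 2
  have hcc : ∀ g, g * El w w' 2 2 * g⁻¹ = El w w' 2 2 := Q.cen S (Q.even_mem 1) hcC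
  have hcomm : ∀ g, g * El w w' 2 2 = El w w' 2 2 * g := fun g => mul_inv_eq_iff_eq_mul.1 (hcc g)
  rcases key _ Q.hv (by rw [Q.sqv]; exact hcC) h1 with h3 | h3 <;>
    rcases key _ Q.hq (by rw [Q.sqq]; exact Q.diag_mem _) h2 with h4 | h4
  · exact Q.dec0 S N.one_mem (by rw [h3]; group) (by rw [h4]; group)
  · exact Q.dec0 S Q.hv (by rw [h3]; group) (by rw [h4, Q.vq])
  · exact Q.dec0 S Q.hq (by rw [h3, Q.qv]) (by rw [h4]; group)
  · refine Q.dec0 S (N.mul_mem Q.hv Q.hq) ?_ ?_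
    · rw [h3, mul_inv_rev]
      calc El w w' 1 (-1) * El w w' 2 2 = El w w' 1 (-1) * (El w w' 1 (-1) * El w w' 2 2) * (El w w' 1 (-1))⁻¹ := by
            rw [hcomm (El w w' 1 (-1)), ← mul_assoc, hcomm (El w w' 1 (-1))]; group
        _ = _ := by rw [← Q.qv]; group
    · rw [h4, ← Q.vq]; group

lemma QC.cenK (S : Sylow 2 G) (Q : QC (S : Subgroup G) w w' t N a b) [hN : N.Normal] (hK : IsK N K) (m : ℤ) (g : G) :
    (El w w' m m)⁻¹ * g * El w w' m m * g⁻¹ ∈ K := by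
  have hKn := hK.normal
  let π : G →* G ⧸ K := QuotientGroup.mk' K
  have hπ : ∀ x, π x = 1 ↔ x ∈ K := fun x => QuotientGroup.eq_one_iff x
  let T : Subgroup (G ⧸ K) := (centralizer (N : Set G)).map π
  have hCn : (centralizer (N : Set G)).Normal := inferInstance
  have hT : T.Normal := hCn.map π (QuotientGroup.mk'_surjective K)
  have hrep : ∀ x ∈ T, ∃ m, x = π (El w w' m m) := by
    rintro _ ⟨x, hx, rfl⟩
    obtain ⟨κ, hκ, s, hs, rfl⟩ := le_KS S K _ hK.two x hx
    obtain ⟨m, rfl⟩ := Q.diag hs ((Subgroup.mul_mem_cancel_left _ (hK.le hκ)).1 hx)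
    exact ⟨m, by rw [map_mul, (hπ κ).2 hκ, one_mul]⟩
  have hTn : (centralizer (T : Set (G ⧸ K))).Normal := inferInstance
  have hHn : ((centralizer (T : Set (G ⧸ K))).comap π).Normal := hTn.comap π
  have hcc : ∀ g, g * El w w' 2 2 * g⁻¹ = El w w' 2 2 := Q.cen S (Q.even_mem 1) (Q.diag_mem 2)
  have key := gen_top S ((centralizer (T : Set (G ⧸ K))).comap π) (by
    intro s hs
    rw [mem_comap, mem_centralizer_iff]
    intro u hu
    obtain ⟨m, rfl⟩ := hrep u hu
    rw [← map_mul, (z_comm Q.ws m hs).eq, map_mul]) (by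
    intro g hg
    rw [mem_comap, mem_centralizer_iff]
    intro u hu
    have hg' : Odd (orderOf (π g)) := hg.of_dvd_nat (orderOf_map_dvd π g)
    have hthis : ∀ y ∈ T, y * y = 1 → y = 1 ∨ y = π (El w w' 2 2) := by
      intro y hy hy2
      obtain ⟨m, rfl⟩ := hrep y hy
      rw [← map_mul, hπ] at hy2
      rcases Q.invol (K_inter hK.odd S.isPGroup' hy2 (mul_mem (El_mem Q.ws m m) (El_mem Q.ws m m))) with h1 | h1
      · left; rw [h1, map_one]
      · right; rw [h1]
    have huk : ∃ k : ℕ, u ^ 2 ^ k = 1 := by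
      obtain ⟨m, rfl⟩ := hrep u hu
      obtain ⟨k, hk⟩ := S.isPGroup' ⟨_, El_mem Q.ws m m⟩
      have hk' : (El w w' m m) ^ 2 ^ k = 1 := congrArg Subtype.val hk
      exact ⟨k, by rw [← map_pow, hk', map_one]⟩
    obtain ⟨k, hk⟩ := huk
    refine (mul_inv_eq_iff_eq_mul.1 (odd_fix hg' T ?_ (fun a ha => hT.conj_mem a ha _) ?_ k u hu hk)).symm
    · intro a ha b hb
      obtain ⟨m, rfl⟩ := hrep a ha
      obtain ⟨m', rfl⟩ := hrep b hb
      rw [← map_mul, (El_comm Q.ws m m m' m').eq, map_mul]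
    · intro a ha ha2
      rcases hthis a ha ha2 with h1 | h1
      · rw [h1]; group
      · rw [h1, ← map_inv, ← map_mul, ← map_mul, hcc]) g
  rw [mem_comap, mem_centralizer_iff] at key
  have h1 := key (π (El w w' m m)) ⟨_, Q.diag_mem m, rfl⟩
  rw [← hπ, map_mul, map_mul, map_mul, map_inv, map_inv, mul_assoc (_⁻¹), ← h1]; group

end
end WSn

set_option linter.unusedSectionVars false
namespace WSn
open Subgroup

section
variable {G : Type*} [Group G] [Finite G] {K : Subgroup G} {w w' t : G} {φ : MulAut G} {N : Subgroup G} {a b : ℤ}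

lemma QC.theta (S : Sylow 2 G) (Q : QC (S : Subgroup G) w w' t N a b) [hN : N.Normal] (hK : IsK N K)
    {d : G} (hd : Odd (orderOf d)) (hdc : d ∉ centralizer (N : Set G)) :
    ∃ θ : G →* Equiv.Perm (Fin 3), U K (centralizer (N : Set G)) θ ∧
      (∀ x, θ x = 1 → ∃ y ∈ N, ∃ l ∈ centralizer (N : Set G), x = y * l) ∧
      (∀ g, g * El w w' 1 (-1) * g⁻¹ = El w w' 1 (-1) → θ g = 1 ∨ θ g = θ w) := by
  let Zn : Subgroup G := N ⊓ centralizer (N : Set G)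
  have hZn : Zn.Normal := inferInstance
  have hCn : (centralizer (N : Set G)).Normal := inferInstance
  let ρ : G →* G ⧸ Zn := QuotientGroup.mk' Zn
  have hρ : ∀ x, ρ x = 1 ↔ x ∈ Zn := fun x => QuotientGroup.eq_one_iff x
  let v := El w w' 1 (-1)
  let q := El w w' a b * t
  let pt : Fin 3 → G ⧸ Zn := ![ρ v, ρ q, ρ (v * q)]
  have hZd : ∀ x ∈ Zn, ∃ m, x = El w w' m m := fun x hx => Q.diag (Q.nS hx.1) hx.2
  have hvZ : ρ v ≠ 1 := by
    rw [Ne, hρ]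
    intro hh
    obtain ⟨m, hm⟩ := hZd _ hh
    have := (El_inj Q.ws _ _ _ _).1 hm
    norm_num at this
    omega
  have hEt : ∀ x y, ρ (El w w' x y * t) ≠ 1 := by
    intro x y
    rw [Ne, hρ]
    intro hh
    obtain ⟨m, hm⟩ := hZd _ hh
    exact El_ne Q.ws _ _ _ _ hm
  have hqZ : ρ q ≠ 1 := hEt _ _
  have hvqZ : ρ (v * q) ≠ 1 := by
    have : v * q = El w w' (1 + a) (-1 + b) * t := by
      show El w w' 1 (-1) * (El w w' a b * t) = _
      rw [← mul_assoc, El_mul Q.ws]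
    rw [this]; exact hEt _ _
  have hne01 : ρ v ≠ ρ q := by
    intro hh
    have h1 : ρ (v⁻¹ * q) = 1 := by rw [map_mul, map_inv, hh, inv_mul_cancel]
    have : v⁻¹ * q = El w w' (-1 + a) (- -1 + b) * t := by
      show (El w w' 1 (-1))⁻¹ * (El w w' a b * t) = _
      rw [← mul_assoc, El_inv Q.ws, El_mul Q.ws]
    rw [this] at h1; exact hEt _ _ h1
  have hne02 : ρ v ≠ ρ (v * q) := by
    intro hh
    rw [map_mul, left_eq_mul] at hh
    exact hqZ hh
  have hne12 : ρ q ≠ ρ (v * q) := by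
    intro hh
    rw [map_mul ρ v q, right_eq_mul] at hh
    exact hvZ hh
  have hinj : Function.Injective pt := by
    intro i j hij
    fin_cases i <;> fin_cases j <;> first | rfl | exfalso
    · exact hne01 hij
    · exact hne02 hij
    · exact hne01 hij.symm
    · exact hne12 hij
    · exact hne02 hij.symm
    · exact hne12 hij.symm
  have hall : ∀ x ∈ N, ρ x = 1 ∨ ∃ i, ρ x = pt i := by
    intro x hx
    obtain ⟨m, hm, h1⟩ := Q.four hx
    have h2 : ρ (El w w' m m) = 1 := (hρ _).2 ⟨hm, Q.diag_mem m⟩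
    rcases h1 with h1 | h1 | h1 | h1
    · left; rw [h1, h2]
    · right; exact ⟨0, by rw [h1, map_mul, h2, one_mul]; rfl⟩
    · right; exact ⟨1, by rw [h1, map_mul, h2, one_mul]; rfl⟩
    · right; exact ⟨2, by rw [h1, map_mul, h2, one_mul]; rfl⟩
  have hptN : ∀ i, ∃ x ∈ N, pt i = ρ x ∧ ρ x ≠ 1 := by
    intro i
    fin_cases i
    · exact ⟨v, Q.hv, rfl, hvZ⟩
    · exact ⟨q, Q.hq, rfl, hqZ⟩
    · exact ⟨v * q, N.mul_mem Q.hv Q.hq, rfl, hvqZ⟩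
  obtain ⟨θ, hθ⟩ := exists_theta (((MulAut.toPerm (G ⧸ Zn)).comp MulAut.conj).comp ρ) pt hinj (by
    intro g i
    obtain ⟨x, hx, hxi, hx1⟩ := hptN i
    rw [hxi]
    show ∃ j, ρ g * ρ x * (ρ g)⁻¹ = pt j
    rcases hall (g * x * g⁻¹) (hN.conj_mem _ hx g) with h1 | ⟨j, hj⟩
    · exfalso
      rw [map_mul, map_mul, map_inv] at h1
      exact hx1 (conj_eq_one_iff.1 h1)
    · exact ⟨j, by rw [← hj, map_mul, map_mul, map_inv]⟩)
  have hθ' : ∀ g i, ρ g * pt i * (ρ g)⁻¹ = pt (θ g i) := hθ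
  have hdec : ∀ x, θ x = 1 → ∃ y ∈ N, ∃ l ∈ centralizer (N : Set G), x = y * l := by
    intro x hx
    have h0 := hθ' x 0
    have h1 := hθ' x 1
    rw [hx, Equiv.Perm.one_apply] at h0 h1
    apply Q.dec S
    · rw [← hρ, map_mul, map_inv, map_mul, map_mul, map_inv, inv_mul_eq_one]
      exact h0.symm
    · rw [← hρ, map_mul, map_inv, map_mul, map_mul, map_inv, inv_mul_eq_one]
      exact h1.symm
  have hLB : ∀ l ∈ centralizer (N : Set G), θ l = 1 := by
    intro l hl
    ext i
    congr 1
    apply hinj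
    rw [← hθ']
    obtain ⟨x, hx, hxi, hx1⟩ := hptN i
    rw [hxi, ← map_inv, ← map_mul, ← map_mul, ← mem_centralizer_iff.1 hl x hx, mul_inv_cancel_right]
    exact hxi.symm
  have htwo : ∀ x, θ x = 1 → ∃ j : ℕ, x ^ 2 ^ j ∈ centralizer (N : Set G) := by
    intro x hx
    obtain ⟨y, hy, l, hl, rfl⟩ := hdec x hx
    obtain ⟨k, hk⟩ := S.isPGroup' ⟨y, Q.nS hy⟩
    have hk' : y ^ 2 ^ k = 1 := congrArg Subtype.val hk
    refine ⟨k, ?_⟩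
    rw [← QuotientGroup.eq_one_iff, QuotientGroup.mk_pow, QuotientGroup.mk_mul, (QuotientGroup.eq_one_iff l).2 hl,
        mul_one, ← QuotientGroup.mk_pow, hk']
    rfl
  let π : G →* G ⧸ centralizer (N : Set G) := QuotientGroup.mk' _
  have hπ : ∀ x, π x = 1 ↔ x ∈ centralizer (N : Set G) := fun x => QuotientGroup.eq_one_iff x
  refine ⟨θ, ⟨hK.normal, hK.odd, hCn, hK.le, hLB, ?_, htwo, ?_, ?_⟩, hdec, ?_⟩
  · intro x x' hx hx'
    obtain ⟨y, hy, l, hl, rfl⟩ := hdec x hx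
    obtain ⟨y', hy', l', hl', rfl⟩ := hdec x' hx'
    have := (hπ _).2 (Q.com y hy y' hy')
    rw [← hπ]
    simp only [map_mul, map_inv, (hπ _).2 hl, (hπ _).2 hl', mul_one] at this ⊢
    exact this
  · intro m x hm hx hmx
    obtain ⟨y, hy, l, hl, rfl⟩ := hdec x hx
    apply mul_mem _ hl
    have h1 : m * y * m⁻¹ * y⁻¹ ∈ centralizer (N : Set G) := by
      have := (hπ _).2 hmx
      rw [← hπ]
      simp only [map_mul, map_inv, (hπ _).2 hl, mul_one] at this ⊢
      exact this
    have h2 : ρ (m * y * m⁻¹ * y⁻¹) = 1 := (hρ _).2 ⟨N.mul_mem (hN.conj_mem y hy m) (N.inv_mem hy), h1⟩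
    rw [map_mul, map_mul, map_mul, map_inv, map_inv, mul_inv_eq_one] at h2
    rcases hall y hy with h3 | ⟨i, hi⟩
    · exact ((hρ y).1 h3).2
    · exfalso
      rw [hi, hθ'] at h2
      exact hm.nofix i (hinj h2)
  · refine ⟨d, cyc_of_odd (fun hh => hdc ?_) hd ?_⟩
    · obtain ⟨j, hj⟩ := htwo d hh
      exact mem_of_odd_pow2 _ hd hj
    · rw [← map_pow, pow_orderOf_eq_one, map_one]
  · intro g hg
    have hfix : ∀ g, g * El w w' 1 (-1) * g⁻¹ = El w w' 1 (-1) → θ g 0 = 0 := by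
      intro g hg
      apply hinj
      rw [← hθ']
      show ρ g * ρ v * (ρ g)⁻¹ = ρ v
      rw [← map_inv, ← map_mul, ← map_mul]
      exact congrArg ρ hg
    apply swap_or (θ w) (θ g) (hfix w ?_) ?_ (hfix g hg)
    · have h1 : w = El w w' 1 0 := by simp [El]
      have h2 := (El_comm Q.ws 1 0 1 (-1)).eq
      rw [← h1] at h2
      rw [h2, mul_inv_cancel_right]
    · intro hw
      have h1 := hθ' w 1
      rw [hw, Equiv.Perm.one_apply] at h1
      have h2 : ρ w * ρ q * (ρ w)⁻¹ = ρ (v * q) := by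
        rw [← map_inv, ← map_mul, ← map_mul]
        exact congrArg ρ Q.wq
      have h3 : ρ w * ρ q * (ρ w)⁻¹ = ρ q := h1
      exact hne12 (h3.symm.trans h2)

end
end WSn

set_option linter.unusedSectionVars false
namespace WSn
open Subgroup

section
variable {G : Type*} [Group G] [Finite G] {K : Subgroup G} {w w' t : G} {φ : MulAut G} {N : Subgroup G} {a b : ℤ}

lemma caseQ_aux (S : Sylow 2 G) (Q : QC (S : Subgroup G) w w' t N a b) [hN : N.Normal] (hK : IsK N K)
    (h : Ctx (S : Subgroup G) 2 w w' t K φ) (hCol : IsColeman φ) (hmod : ∀ g, φ g * g⁻¹ ∈ K)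
    {d : G} (hd : Odd (orderOf d)) (hdc : d ∉ centralizer (N : Set G)) : φ ∈ innAut G := by
  have hKn := h.Kn
  obtain ⟨θ, hU, hdec, hfix⟩ := Q.theta S hK hd hdc
  have hNK : ∀ y ∈ N, ∀ k ∈ K, y * k = k * y := fun y hy k hk => mem_centralizer_iff.1 (hK.le hk) y hy
  let Z : G → Prop := fun ζ => ∃ m : ℤ, ζ = El w w' m m
  have hZ : ∀ l ∈ centralizer (N : Set G), ∃ ζ, Z ζ ∧ ∃ κ ∈ K, l = ζ * κ := by
    intro l hl
    obtain ⟨κ, hκ, s, hs, rfl⟩ := le_KS S K _ hK.two l hl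
    refine ⟨s, Q.diag hs ((Subgroup.mul_mem_cancel_left _ (hK.le hκ)).1 hl), s⁻¹ * κ * s, ?_, by group⟩
    have := hKn.conj_mem κ hκ s⁻¹
    rwa [inv_inv] at this
  have hZc : ∀ ζ, Z ζ → ∀ g, ζ⁻¹ * g * ζ * g⁻¹ ∈ K := by
    rintro _ ⟨m, rfl⟩ g
    exact Q.cenK S hK m g
  have hζφ : ∀ m, φ (El w w' m m) = El w w' m m := fun m => h.φS _ (El_mem Q.ws m m)
  -- the square is trivial on K
  have hsq : ∀ k ∈ K, (φ ^ 2) k = k := by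
    apply triv_of_no_inv h.Kn h.Kodd
    · intro k hk
      rw [pow_two, MulAut.mul_apply]
      exact h.φK _ (h.φK k hk)
    · obtain ⟨e, he⟩ := h.φ2
      exact ⟨e, by rw [← pow_mul, mul_comm, pow_mul, he, one_pow]⟩
    · intro j p hp k hk hkp hinv
      refine hU.inv_one Z hZ hZc φ hmod h.φc hCol hp hk hkp (2 * 2 ^ j) ?_
      rintro _ ⟨m, rfl⟩
      rw [(twist_comm _ φ (hζφ m)).mul_pow, MulAut.mul_apply, pow_mul φ, hinv, inv_pow, ← map_pow, pow_mul, pow_two,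
        El_mul Q.ws, ← two_mul, ← map_inv, MulAut.conj_apply, inv_inv]
      have h1 : ((El w w' (2 * m) (2 * m)) ^ 2 ^ j)⁻¹ ∈ N := N.inv_mem (N.pow_mem (Q.even_mem m) _)
      rw [hNK _ h1 _ (K.inv_mem hk), inv_mul_cancel_right]
  -- centralizer of z in K
  have hfz : ∀ x ∈ K, El w w' 1 1 * x * (El w w' 1 1)⁻¹ = x → φ x = x := by
    intro x hx hzx
    by_contra hcon
    have hux : x⁻¹ * φ x ≠ 1 := by
      intro hh
      exact hcon (inv_mul_eq_one.1 hh).symm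
    have huinv : φ (x⁻¹ * φ x) = (x⁻¹ * φ x)⁻¹ := by
      have h1 : φ (φ x) = x := hsq x hx
      rw [map_mul, map_inv, h1]; group
    have huK : x⁻¹ * φ x ∈ K := K.mul_mem (K.inv_mem hx) (h.φK x hx)
    have hz1 : Commute (El w w' 1 1) x := mul_inv_eq_iff_eq_mul.1 hzx
    have hz2 : Commute (El w w' 1 1) (φ x) := by
      have := hz1.map φ
      rwa [hζφ 1] at this
    have hzu : Commute (El w w' 1 1) (x⁻¹ * φ x) := hz1.inv_right.mul_right hz2
    obtain ⟨p, hp, i, h1, h2, h3⟩ := prime_inv (ρ := φ) hux huinv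
    apply h2
    refine hU.inv_one Z hZ hZc φ hmod h.φc hCol hp (K.pow_mem huK i) h1 1 ?_
    rintro _ ⟨m, rfl⟩
    rw [pow_one, conj_inv_apply', h3]
    have h4 : Commute (El w w' m m) ((x⁻¹ * φ x) ^ i)⁻¹ := by
      have h5 : El w w' m m = (El w w' 1 1) ^ m := by rw [El_zpow Q.ws, mul_one]
      rw [h5]
      exact ((hzu.pow_right i).inv_right).zpow_left m
    rw [mul_assoc, ← h4.eq]; group
  let f := resAut φ K h.φK
  have hfv : ∀ k : K, ((f k : K) : G) = φ k := fun k => rfl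
  let c : G →* MulAut K := MulAut.conjNormal
  have hcv : ∀ (u : G) (k : K), ((c u k : K) : G) = u * k * u⁻¹ := fun u k => MulAut.conjNormal_apply u k
  have hcN : ∀ u ∈ N, c u = 1 := by
    intro u hu
    ext k
    rw [hcv, hNK u hu k k.2, mul_inv_cancel_right]; rfl
  have hww : c w * c w = c (El w w' 1 1) := by
    have h1 : w * w = El w w' 1 1 * El w w' 1 (-1) := by
      rw [El_mul Q.ws]; simp [El]
      rw [pow_two]
    rw [← map_mul, h1, map_mul, hcN _ Q.hv, mul_one]
  have hzz : c (El w w' 1 1) * c (El w w' 1 1) = 1 := by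
    rw [← map_mul, El_mul Q.ws]
    exact hcN _ (Q.even_mem 1)
  have hcw : ∀ m : ℤ, c (El w w' m m) = (c w) ^ (2 * m) := by
    intro m
    have h5 : El w w' m m = (El w w' 1 1) ^ m := by rw [El_zpow Q.ws, mul_one]
    rw [h5, map_zpow, ← hww, zpow_mul, zpow_two]
  have hQ := OddG.thmQ h.Kodd f (c w) (c (El w w' 1 1)) (by
      ext k
      exact hsq k k.2) (by
      ext k
      rw [MulAut.mul_apply, MulAut.mul_apply, hfv, hcv, hcv, hfv, map_mul, map_mul, map_inv, h.φS w Q.ws.hw]) hww hzz (by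
      intro x hx
      apply Subtype.ext
      rw [hfv]
      apply hfz x x.2
      rw [← hcv, hx]) (by
      intro k
      obtain ⟨g, hg⟩ := h.φc (k * El w w' 1 (-1))
      rw [map_mul, h.φS _ (El_mem Q.ws _ _)] at hg
      have hg' : φ k * El w w' 1 (-1) = (g * k * g⁻¹) * (g * El w w' 1 (-1) * g⁻¹) := by rw [hg]; group
      have h1 : g * El w w' 1 (-1) * g⁻¹ * (El w w' 1 (-1))⁻¹ = (g * k * g⁻¹)⁻¹ * φ k := by
        rw [mul_inv_eq_iff_eq_mul, mul_assoc _ (φ k), hg']; group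
      have h2 : g * El w w' 1 (-1) * g⁻¹ * (El w w' 1 (-1))⁻¹ = 1 := by
        apply K_inter h.Kodd h.S2
        · rw [h1]; exact K.mul_mem (K.inv_mem (hKn.conj_mem _ k.2 g)) (h.φK k k.2)
        · exact mul_mem (Q.nS (hN.conj_mem _ Q.hv g)) (inv_mem (Q.nS Q.hv))
      rw [h2] at h1
      have h3 : φ k = g * k * g⁻¹ := (inv_mul_eq_one.1 h1.symm).symm
      have h4 : ∃ i : ℤ, ∃ y ∈ N, ∃ l ∈ centralizer (N : Set G), g = w ^ i * (y * l) := by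
        rcases hfix g (mul_inv_eq_one.1 h2) with h5 | h5
        · obtain ⟨y, hy, l, hl, h6⟩ := hdec g h5
          exact ⟨0, y, hy, l, hl, by rw [zpow_zero, one_mul, h6]⟩
        · obtain ⟨y, hy, l, hl, h6⟩ := hdec (w⁻¹ * g) (by rw [map_mul, map_inv, h5, inv_mul_cancel])
          exact ⟨1, y, hy, l, hl, by rw [← h6, zpow_one]; group⟩
      obtain ⟨i, y, hy, l, hl, rfl⟩ := h4
      obtain ⟨_, ⟨m, rfl⟩, κ, hκ, rfl⟩ := hZ l hl
      have h5 : f k = c (w ^ i * (y * (El w w' m m * κ))) k := by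
        apply Subtype.ext
        rw [hfv, hcv, h3]
      have h6 : c (w ^ i * (y * (El w w' m m * κ))) = c w ^ (i + 2 * m) * c κ := by
        rw [map_mul, map_mul, map_mul, hcN y hy, one_mul, hcw, map_zpow, zpow_add, mul_assoc]
      refine ⟨-(i + 2 * m), ⟨κ, hκ⟩, ?_⟩
      rw [MulAut.mul_apply, h5, h6, ← MulAut.mul_apply, ← mul_assoc, zpow_neg, inv_mul_cancel, one_mul]
      apply Subtype.ext
      rw [hcv]; rfl)
  rcases hQ with hQ | hQ
  · rw [fin_triv h.Kodd (fun k hk => by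
      have := congrArg (fun f : MulAut K => ((f ⟨k, hk⟩ : K) : G)) hQ
      exact this) hmod h.φ2]
    exact one_mem _
  · apply twist_inn (El w w' 1 1)
    have h' := h.twist 1
    rw [fin_triv h.Kodd (φ := (MulAut.conj (El w w' 1 1))⁻¹ * φ) (fun k hk => by
      have h1 : φ k = El w w' 1 1 * k * (El w w' 1 1)⁻¹ := by
        have := congrArg (fun f : MulAut K => ((f ⟨k, hk⟩ : K) : G)) hQ
        simp only [hfv, hcv] at this
        exact this
      rw [conj_inv_apply', h1]; group) (fun g => by
      rw [conj_inv_apply']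
      have h1 : (El w w' 1 1)⁻¹ * φ g * (El w w' 1 1) * g⁻¹ = ((El w w' 1 1)⁻¹ * φ g * (El w w' 1 1) * (φ g)⁻¹) * (φ g * g⁻¹) := by group
      rw [h1]
      exact K.mul_mem (Q.cenK S hK 1 _) (hmod g)) h'.φ2]
    exact one_mem _

theorem caseQ (S : Sylow 2 G) (Q : QC (S : Subgroup G) w w' t N a b) [hN : N.Normal] (hK : IsK N K)
    (h : Ctx (S : Subgroup G) 2 w w' t K φ) (hCol : IsColeman φ)
    {d : G} (hd : Odd (orderOf d)) (hdc : d ∉ centralizer (N : Set G)) : φ ∈ innAut G := by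
  obtain ⟨m, hm⟩ := modK S h N Q.nS hK (by
    intro x hx hxc y hy hyc
    obtain ⟨m, rfl⟩ := Q.diag hx hxc
    exact (z_comm Q.ws m hy).eq)
  exact twist_inn _ (caseQ_aux S Q hK (h.twist m) (twist_col _ hCol) hm hd hdc)

end
end WSn

set_option linter.unusedSectionVars false
namespace WSn
open Subgroup

section
variable {G : Type*} [Group G] [Finite G] {K : Subgroup G} {n : ℕ} {w w' t : G} {φ : MulAut G}

/-- the homocyclic base of the wreathed group -/
def baseSub {S : Subgroup G} (ws : WS S n w w' t) : Subgroup G where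
  carrier := {x | ∃ p q, x = El w w' p q}
  one_mem' := ⟨0, 0, El_zero.symm⟩
  mul_mem' := by
    rintro _ _ ⟨p, q, rfl⟩ ⟨p', q', rfl⟩
    exact ⟨_, _, El_mul ws _ _ _ _⟩
  inv_mem' := by
    rintro _ ⟨p, q, rfl⟩
    exact ⟨_, _, El_inv ws _ _⟩

lemma comm_base {S : Subgroup G} (ws : WS S n w w' t) {x y : G} (hx : x ∈ S) (hy : y ∈ S) :
    ∃ p q, x * y * x⁻¹ * y⁻¹ = El w w' p q := by
  have tinv' : t⁻¹ = t := tinv ws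
  have hEt : ∀ p q, (El w w' p q * t)⁻¹ = El w w' (-q) (-p) * t := by
    intro p q
    rw [mul_inv_rev, tinv', El_inv ws, t_El ws]
  have htt : ∀ p q p' q', (El w w' p q * t) * (El w w' p' q' * t) = El w w' (p + q') (q + p') := by
    intro p q p' q'
    rw [mul_assoc, ← mul_assoc t, t_El ws, mul_assoc, ws.tt, mul_one, El_mul ws]
  have hte : ∀ p q p' q', (El w w' p q * t) * (El w w' p' q') = El w w' (p + q') (q + p') * t := by
    intro p q p' q'
    rw [mul_assoc, t_El ws, ← mul_assoc, El_mul ws]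
  have het : ∀ p q p' q', El w w' p q * (El w w' p' q' * t) = El w w' (p + p') (q + q') * t := by
    intro p q p' q'
    rw [← mul_assoc, El_mul ws]
  have hee : ∀ p q p' q', El w w' p q * El w w' p' q' = El w w' (p + p') (q + q') := fun p q p' q' => El_mul ws _ _ _ _
  have hEi : ∀ p q, (El w w' p q)⁻¹ = El w w' (-p) (-q) := fun p q => El_inv ws _ _
  have hf : ∀ s ∈ S, ∃ p q, s = El w w' p q ∨ s = El w w' p q * t := ws.form
  obtain ⟨p, q, h1 | h1⟩ := hf x hx <;> obtain ⟨p', q', h2 | h2⟩ := hf y hy <;> rw [h1, h2] <;>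
    simp only [hEt, hEi, htt, hte, het, hee] <;> exact ⟨_, _, rfl⟩

theorem main (hn : 2 ≤ n) (hW : ∀ P : Sylow 2 G, Nonempty ((P : Subgroup G) ≃* Wreathed.W n))
    (S : Sylow 2 G) (ws : WS (S : Subgroup G) n w w' t) (hφS : ∀ u ∈ S, φ u = u) (hφc : ∀ x, ∃ g, φ x = g * x * g⁻¹)
    (hφ2 : ∃ k : ℕ, φ ^ 2 ^ k = 1) (hCol : IsColeman φ) (hG : Nat.card G ≤ 7200)
    (N : Subgroup G) [hN : N.Normal] (hNS : N ≤ S)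
    (hnc : ¬ N ≤ centralizer ((S : Subgroup G) : Set G)) : φ ∈ innAut G := by
  by_cases hab : ∀ a ∈ N, ∀ b ∈ N, a * b = b * a
  · exact abelianCase hn hW S ws hφS hφc hφ2 hCol hG N hNS hnc hab
  have hcb : ∀ a ∈ N, ∀ b ∈ N, ∃ p q, a * b * a⁻¹ * b⁻¹ = El w w' p q := fun a ha b hb => comm_base ws (hNS ha) (hNS hb)
  have hN' : (⁅N, N⁆ : Subgroup G).Normal := inferInstance
  have hN'A : ⁅N, N⁆ ≤ baseSub ws := Subgroup.commutator_le.2 (fun a ha b hb => hcb a ha b hb)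
  have hN'N : ⁅N, N⁆ ≤ N := Subgroup.commutator_le_left N N
  by_cases hc : ⁅N, N⁆ ≤ centralizer ((S : Subgroup G) : Set G)
  swap
  · refine abelianCase hn hW S ws hφS hφc hφ2 hCol hG ⁅N, N⁆ (hN'N.trans hNS) hc ?_
    intro x hx y hy
    obtain ⟨p, q, rfl⟩ := hN'A hx
    obtain ⟨p', q', rfl⟩ := hN'A hy
    exact (El_comm ws _ _ _ _).eq
  have hcS : ∀ x ∈ N, ∀ y ∈ N, ∀ s ∈ S, s * (x * y * x⁻¹ * y⁻¹) = (x * y * x⁻¹ * y⁻¹) * s := fun x hx y hy =>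
    mem_centralizer_iff.1 (hc (Subgroup.commutator_mem_commutator hx hy))
  obtain ⟨K, hK, h⟩ := exists_ctx hn hW S ws hφS hφc hφ2 N hNS hnc
  obtain ⟨x, y, hr, hxy⟩ := exists_r ws N hNS hnc
  rcases odd_or_top S N K hK with htop | ⟨d, hd, hdc⟩
  · exact caseI h htop (card_bound hW S hK.odd hG) N hK.le hr hxy
  obtain ⟨a, b, hq⟩ : ∃ a b, El w w' a b * t ∈ N := by
    by_contra hcon
    push Not at hcon
    apply hab
    have key : ∀ x ∈ N, ∃ p q, x = El w w' p q := by
      intro x hx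
      obtain ⟨p, q, h1 | h1⟩ := ws.form x (hNS hx)
      · exact ⟨p, q, h1⟩
      · rw [h1] at hx
        exact absurd hx (hcon p q)
    intro x hx y hy
    obtain ⟨p, q, rfl⟩ := key x hx
    obtain ⟨p', q', rfl⟩ := key y hy
    exact (El_comm ws _ _ _ _).eq
  have hv : El w w' 1 (-1) ∈ N := by
    have h1 : El w w' 1 0 * (El w w' a b * t) * (El w w' 1 0)⁻¹ * (El w w' a b * t)⁻¹ ∈ N :=
      N.mul_mem (hN.conj_mem _ hq _) (N.inv_mem hq)
    have h2 : El w w' 1 0 * (El w w' a b * t) * (El w w' 1 0)⁻¹ = El w w' 1 (-1) * (El w w' a b * t) := by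
      rw [mul_inv_eq_iff_eq_mul, mul_assoc (El w w' 1 (-1)), mul_assoc, t_El ws, ← mul_assoc, ← mul_assoc, ← mul_assoc,
        El_mul ws, El_mul ws, El_mul ws]
      congr 1
      rw [El_inj ws]
      constructor <;> ring_nf <;> simp
    rwa [h2, mul_inv_cancel_right] at h1
  have hdiff : ∀ p r, El w w' p r ∈ N → (2 ^ n : ℤ) ∣ 2 * (p - r) := by
    intro p r hp
    have h1 : (El w w' a b * t) * El w w' p r * (El w w' a b * t)⁻¹ * (El w w' p r)⁻¹ = El w w' (r - p) (p - r) := by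
      rw [mul_inv_eq_iff_eq_mul, mul_inv_eq_iff_eq_mul, mul_assoc, t_El ws, ← mul_assoc, ← mul_assoc, El_mul ws, El_mul ws,
        El_mul ws]
      congr 1
      rw [El_inj ws]
      constructor <;> ring_nf <;> simp
    have h2 := hcS _ hq _ hp t ws.ht
    rw [h1] at h2
    have h3 := comm_t_iff ws (r - p) (p - r) (x := 0) (y := 0) (by rw [El_zero, one_mul]; exact h2.symm)
    have h4 : 2 * (p - r) = -(r - p - (p - r)) := by ring
    rw [h4]; exact (dvd_neg).2 h3
  have hn2 : n = 2 := by
    have h1 := hdiff 1 (-1) hv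
    norm_num at h1
    have h2 := Int.le_of_dvd (by norm_num) h1
    by_contra hcon
    have h3 : 3 ≤ n := by omega
    have h4 : (2:ℤ) ^ 3 ≤ 2 ^ n := pow_le_pow_right₀ (by norm_num) h3
    norm_num at h4
    omega
  subst hn2
  have Q : QC (S : Subgroup G) w w' t N a b := by
    refine ⟨ws, hNS, hv, hq, ?_, ?_⟩
    · intro p r hp
      obtain ⟨e, he⟩ := hdiff p r hp
      norm_num at he
      exact ⟨e, by omega⟩
    · intro x hx y hy
      rw [mem_centralizer_iff]
      intro u hu
      exact hcS x hx y hy u (hNS hu)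
  exact caseQ S Q hK h hCol hd hdc

end
end WSn

/-- In a minimal counterexample, `O_2(G) ≤ Z(S)` for a Sylow 2-subgroup `S`: every
normal 2-subgroup of `G` is contained in the center of `S`. -/
theorem minimal_counterexample_O2_le_center_sylow
    (G : Type) [Group G] [Finite G]
    (hW : HasWreathedSylow2 G)
    (φ : MulAut G) (hcp : IsClassPreserving φ) (hcol : IsColeman φ)
    (hord : ∃ k : ℕ, orderOf φ = 2 ^ k) (hni : φ ∉ innAut G)
    (hmin : ∀ (H : Type) [Group H] [Finite H], Nat.card H < Nat.card G →
      HasWreathedSylow2 H → Odd (Nat.card ↥(outC H ⊓ outCol H))) :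
    ∀ S : Sylow 2 G, ∀ N : Subgroup G, N.Normal → IsPGroup 2 N →
      N ≤ (S : Subgroup G) ⊓ Subgroup.centralizer ((S : Subgroup G) : Set G) := by
  intro S N hN hN2
  have hf : Fact (Nat.Prime 2) := ⟨Nat.prime_two⟩
  have hG : Nat.card G ≤ 7200 := Hzero.bound hmin
  have hNS : N ≤ S := hN2.le_sylow_of_normal S
  refine le_inf hNS ?_
  by_contra hnc
  obtain ⟨n, hn, hW⟩ := hW
  obtain ⟨e⟩ := hW S
  obtain ⟨w, w', t, ws⟩ := WSn.W_exists (S : Subgroup G) n hn e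
  obtain ⟨y, hy⟩ := hcol 2 Nat.prime_two S
  have hic : ∀ g : G, MulAut.conj g ∈ autC G := by
    intro g x
    exact isConj_iff.2 ⟨g, rfl⟩
  have hil : ∀ g : G, MulAut.conj g ∈ autCol G := by
    intro g p hp P
    exact ⟨g⁻¹, fun u _ => by simp⟩
  have hψc : MulAut.conj y * φ ∈ autC G := Subgroup.mul_mem _ (hic y) hcp
  have hψl : MulAut.conj y * φ ∈ autCol G := Subgroup.mul_mem _ (hil y) hcol
  have hψS : ∀ u ∈ S, (MulAut.conj y * φ) u = u := by
    intro u hu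
    rw [MulAut.mul_apply, hy u hu, MulAut.conj_apply]; group
  have hψφ : (QuotientGroup.mk (MulAut.conj y * φ) : MulAut G ⧸ innAut G) = QuotientGroup.mk φ := by
    rw [QuotientGroup.mk_mul, (QuotientGroup.eq_one_iff (N := innAut G) (MulAut.conj y)).2 (show MulAut.conj y ∈ innAut G from ⟨y, rfl⟩), one_mul]
  generalize MulAut.conj y * φ = ψ at hψc hψl hψS hψφ
  have hfin : Finite (MulAut G) := Finite.of_injective (fun f : MulAut G => (f : G → G)) DFunLike.coe_injective
  obtain ⟨k, m, hm, -, h2⟩ := WSn.split2 ψ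
  obtain ⟨j, hj⟩ := hord
  have hinn : ψ ^ m ∈ innAut G := by
    refine WSn.main hn hW S ws ?_ ?_ ⟨k, h2⟩ (Subgroup.pow_mem _ hψl m) hG N hNS hnc
    · intro u hu
      have : ∀ i : ℕ, (ψ ^ i) u = u := by
        intro i
        induction i with
        | zero => rfl
        | succ i ih => rw [pow_succ, MulAut.mul_apply, hψS u hu, ih]
      exact this m
    · intro x
      obtain ⟨g, hg⟩ := isConj_iff.1 ((Subgroup.pow_mem _ hψc m : ψ ^ m ∈ autC G) x)
      exact ⟨g, hg.symm⟩
  apply hni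
  have h3 : φ ^ m ∈ innAut G := by
    rw [← QuotientGroup.eq_one_iff, QuotientGroup.mk_pow, ← hψφ, ← QuotientGroup.mk_pow, QuotientGroup.eq_one_iff]
    exact hinn
  refine WSn.mem_of_coprime (innAut G) (a := 2 ^ j) ((Nat.coprime_two_left.2 hm).pow_left j) ?_ h3
  rw [← hj, pow_orderOf_eq_one]
  exact one_mem _
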